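/- (Local well-posedness for arbitrary data) Let $1<\gamma<\infty$, let $F$ be a power-like nonlinearity of degree $\gamma$, and choose exponents $p\in[2,\infty)$, $q\in(2,\infty)$ with $p>\gamma$, $q<2\gamma$ and $\lambda:=1-\frac{\gamma}{p}-\frac{1}{p}>0$ appropriately. Then for every $f\in L^2(\mathbb{T})$ there exists $T>0$, depending only on $\|f\|_{L^2}$ and satisfying $T^{\lambda}\gtrsim \|f\|_{L^2}^{-(\gamma-1)}$, such that the integral equation $u(t)=e^{it\mathcal{L}}f-i\int_0^t e^{i(t-s)\mathcal{L}}F(u(s))\,ds$ has a unique solution $u$ in a ball of $X_T=C([-T,T];L^2(\mathbb{T}))\cap L^p([-T,T];L^q(\mathbb{T}))$, and the map $f\mapsto u$ is continuous from bounded sets of $L^2(\mathbb{T})$ into $X_T$. -/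

import Mathlib

noncomputable section

open Complex MeasureTheory Filter
open scoped ENNReal NNReal Topology

/-- A homogeneous tree of degree `Q+1`: a connected acyclic graph in which every
vertex has exactly `Q+1` neighbours. -/
structure HomTree (Q : ℕ) : Type 1 where
  V : Type
  graph : SimpleGraph V
  isTree : graph.IsTree
  regular : ∀ x : V, {y : V | graph.Adj x y}.ncard = Q + 1

/-- `γ(0) = 2/(Q^{1/2} + Q^{-1/2})`. -/
def gammaZero (Q : ℕ) : ℝ := 2 / (Real.sqrt Q + (Real.sqrt Q)⁻¹)

/-- The radial Schrödinger kernel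
`s_t(n) = e^{it} (2/π) ∑_{k≥0} Q^{-n/2-k} ∫₀^π e^{-iγ(0)t cos λ} sin λ sin((n+2k+1)λ) dλ`. -/
def schKernel (Q : ℕ) (t : ℝ) (n : ℕ) : ℂ :=
  Complex.exp (Complex.I * t) * (2 / Real.pi) *
    ∑' k : ℕ, (((Q : ℝ) ^ (-(n : ℝ) / 2 - (k : ℝ)) : ℝ) : ℂ) *
      ∫ l in (0 : ℝ)..Real.pi,
        Complex.exp (-Complex.I * (gammaZero Q) * t * Real.cos l) *
          (Real.sin l : ℂ) * (Real.sin (((n : ℝ) + 2 * k + 1) * l) : ℂ)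

/-- The sum of `g` over the sphere of radius `n` centred at `x`. -/
def sphereSum {Q : ℕ} (T : HomTree Q) (g : T.V → ℂ) (x : T.V) (n : ℕ) : ℂ :=
  ∑' y : {y : T.V // T.graph.dist x y = n}, g y

/-- The Schrödinger propagator `e^{itℒ}`, realised (and extended to all
`L^p` spaces) as convolution with the radial kernel `s_t`:
`e^{itℒ}g(x) = ∑_{n≥0} s_t(n) ∑_{d(x,y)=n} g(y)`. -/
def propagate {Q : ℕ} (T : HomTree Q) (t : ℝ) (g : T.V → ℂ) (x : T.V) : ℂ :=
  ∑' n : ℕ, schKernel Q t n * sphereSum T g x n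

/-- The `L^q(𝕋)` norm (with the counting measure), valued in `ℝ≥0∞`, for an
exponent `q : ℝ≥0∞`. -/
def spaceNorm {Q : ℕ} (T : HomTree Q) (q : ℝ≥0∞) (g : T.V → ℂ) : ℝ≥0∞ :=
  if q = ∞ then ⨆ x : T.V, (‖g x‖₊ : ℝ≥0∞)
  else (∑' x : T.V, (‖g x‖₊ : ℝ≥0∞) ^ q.toReal) ^ (1 / q.toReal)

/-- The mixed Lebesgue norm `L^p_t L^q_x` over a time set `A ⊆ ℝ`
(with `sup` in time when `p = ∞`), valued in `ℝ≥0∞`. -/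
def mixedNorm {Q : ℕ} (T : HomTree Q) (p q : ℝ≥0∞) (A : Set ℝ)
    (u : ℝ → T.V → ℂ) : ℝ≥0∞ :=
  if p = ∞ then ⨆ t ∈ A, spaceNorm T q (u t)
  else (∫⁻ t in A, (spaceNorm T q (u t)) ^ p.toReal) ^ (1 / p.toReal)

/-- The admissible set `𝒞 = ((0,1/2] × [0,1/2)) ∪ {(0,1/2)}` for the couple
`(1/p, 1/q)`. -/
def admissiblePair (p q : ℝ≥0∞) : Prop :=
  (0 < p⁻¹ ∧ p⁻¹ ≤ 2⁻¹ ∧ q⁻¹ < 2⁻¹) ∨ (p⁻¹ = 0 ∧ q⁻¹ = 2⁻¹)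

/-- A power-like nonlinearity of degree `γ`: `|F(u)| ≤ C|u|^γ` and
`|F(u)-F(v)| ≤ C(|u|^{γ-1} + |v|^{γ-1})|u-v|`. -/
def PowerLike (F : ℂ → ℂ) (γ : ℝ) : Prop :=
  ∃ C : ℝ, 0 < C ∧ (∀ u : ℂ, ‖F u‖ ≤ C * ‖u‖ ^ γ) ∧
    ∀ u v : ℂ, ‖F u - F v‖ ≤ C * (‖u‖ ^ (γ - 1) + ‖v‖ ^ (γ - 1)) * ‖u - v‖

/-- The gauge invariance condition `Im (F(u) ū) = 0`. -/
def GaugeInvariant (F : ℂ → ℂ) : Prop :=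
  ∀ u : ℂ, (F u * (starRingEnd ℂ) u).im = 0

/-- `u` solves the semilinear Schrödinger equation `i∂ₜu + ℒu = F(u)`, `u(0)=f`,
in the Duhamel (integral) form
`u(t) = e^{itℒ}f - i∫₀ᵗ e^{i(t-s)ℒ}F(u(s)) ds`, on the time set `A`. -/
def SolvesNLS {Q : ℕ} (T : HomTree Q) (F : ℂ → ℂ) (f : T.V → ℂ)
    (u : ℝ → T.V → ℂ) (A : Set ℝ) : Prop :=
  ∀ t ∈ A, ∀ x : T.V, u t x = propagate T t f x -
    Complex.I * ∫ s in (0 : ℝ)..t, propagate T (t - s) (fun y => F (u s y)) x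

/-- `u : A → L²(𝕋)` is continuous in the `L²` norm. -/
def ContL2On {Q : ℕ} (T : HomTree Q) (u : ℝ → T.V → ℂ) (A : Set ℝ) : Prop :=
  ∀ t₀ ∈ A, Filter.Tendsto (fun t => spaceNorm T 2 (fun x => u t x - u t₀ x))
    (nhdsWithin t₀ A) (nhds 0)

/-- The norm of the space `X = C(A; L²(𝕋)) ∩ L^p(A; L^q(𝕋))`. -/
def Xnorm {Q : ℕ} (T : HomTree Q) (p q : ℝ≥0∞) (A : Set ℝ)
    (u : ℝ → T.V → ℂ) : ℝ≥0∞ :=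
  (⨆ t ∈ A, spaceNorm T 2 (u t)) + mixedNorm T p q A u

namespace HomTree

variable {Q : ℕ} (T : HomTree Q)

lemma finite_neighbors (y : T.V) : {z | T.graph.Adj y z}.Finite :=
  Set.finite_of_ncard_ne_zero (by rw [T.regular]; omega)

/-- The neighbours of a vertex. -/
def nbrs (y : T.V) : Finset T.V := (T.finite_neighbors y).toFinset

@[simp] lemma mem_nbrs {y z : T.V} : z ∈ T.nbrs y ↔ T.graph.Adj y z := by
  simp [nbrs]

lemma mem_nbrs_comm {y z : T.V} : z ∈ T.nbrs y ↔ y ∈ T.nbrs z := by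
  simp [SimpleGraph.adj_comm]

lemma card_nbrs (y : T.V) : (T.nbrs y).card = Q + 1 := by
  rw [← T.regular y, Set.ncard_eq_toFinset_card _ (T.finite_neighbors y)]; rfl

lemma exists_nbr_closer (x y : T.V) (n : ℕ) (h : T.graph.dist x y = n + 1) :
    ∃ z ∈ T.nbrs y, T.graph.dist x z = n := by
  obtain ⟨p, hp⟩ := T.isTree.connected.exists_walk_length_eq_dist x y
  have hnil : ¬ p.Nil := by
    intro hn
    rw [← SimpleGraph.Walk.length_eq_zero_iff] at hn
    omega
  have hadj := p.adj_penultimate hnil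
  refine ⟨p.penultimate, by simpa using hadj.symm, ?_⟩
  have h1 : T.graph.dist x p.penultimate ≤ n := by
    refine (SimpleGraph.dist_le p.dropLast).trans ?_
    simp; omega
  rcases T.isTree.dist_eq_dist_add_one_of_adj x hadj with h2 | h2 <;> omega

lemma nbr_closer_unique (x y z z' : T.V) (hz : z ∈ T.nbrs y) (hz' : z' ∈ T.nbrs y)
    (h : T.graph.dist x y = T.graph.dist x z + 1)
    (h' : T.graph.dist x y = T.graph.dist x z' + 1) : z = z' := by
  rw [mem_nbrs] at hz hz'
  obtain ⟨p, hp⟩ := T.isTree.connected.exists_walk_length_eq_dist x z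
  obtain ⟨p', hp'⟩ := T.isTree.connected.exists_walk_length_eq_dist x z'
  have e1 : (p.concat hz.symm).IsPath :=
    SimpleGraph.Walk.isPath_of_length_eq_dist _ (by simp [hp, h])
  have e2 : (p'.concat hz'.symm).IsPath :=
    SimpleGraph.Walk.isPath_of_length_eq_dist _ (by simp [hp', h'])
  exact (SimpleGraph.Walk.concat_inj ((T.isTree.existsUnique_path x y).unique e1 e2)).1

lemma sum_nbrs_dist {α : Type*} [CommSemiring α] (φ : ℕ → α) (x y : T.V) :
    ∑ z ∈ T.nbrs y, φ (T.graph.dist x z) =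
      if T.graph.dist x y = 0 then (Q + 1 : α) * φ 1
      else φ (T.graph.dist x y - 1) + (Q : α) * φ (T.graph.dist x y + 1) := by
  classical
  have key : ∀ z ∈ T.nbrs y, T.graph.dist x y = T.graph.dist x z + 1 ∨
      T.graph.dist x z = T.graph.dist x y + 1 := fun z hz =>
    T.isTree.dist_eq_dist_add_one_of_adj x ((T.mem_nbrs).1 hz)
  split_ifs with h
  · have : ∀ z ∈ T.nbrs y, φ (T.graph.dist x z) = φ 1 := by
      intro z hz
      rcases key z hz with h1 | h1
      · omega
      · rw [h1, h]
    rw [Finset.sum_congr rfl this, Finset.sum_const, card_nbrs]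
    simp
  · obtain ⟨z₀, hz₀, hd⟩ := T.exists_nbr_closer x y (T.graph.dist x y - 1) (by omega)
    rw [← Finset.add_sum_erase _ _ hz₀, hd]
    have : ∀ z ∈ (T.nbrs y).erase z₀, φ (T.graph.dist x z) = φ (T.graph.dist x y + 1) := by
      intro z hz
      rw [Finset.mem_erase] at hz
      rcases key z hz.2 with h1 | h1
      · exact absurd (T.nbr_closer_unique x y z z₀ hz.2 hz₀ h1 (by omega)) hz.1
      · rw [h1]
    rw [Finset.sum_congr rfl this, Finset.sum_const, Finset.card_erase_of_mem hz₀, card_nbrs]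
    simp

lemma dist_eq_zero {x y : T.V} : T.graph.dist x y = 0 ↔ x = y :=
  (T.isTree.connected x y).dist_eq_zero_iff

lemma finite_sphere (x : T.V) (n : ℕ) : {y | T.graph.dist x y = n}.Finite := by
  induction n with
  | zero =>
    refine (Set.finite_singleton x).subset ?_
    intro y hy
    exact ((T.dist_eq_zero).1 hy).symm
  | succ n ih =>
    refine (ih.biUnion (t := fun z => (T.nbrs z : Set T.V)) fun z _ => Finset.finite_toSet _).subset ?_
    intro y hy
    obtain ⟨z, hz, hd⟩ := T.exists_nbr_closer x y n hy
    exact Set.mem_biUnion hd (by simpa using (T.mem_nbrs_comm).1 hz)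

instance : Nonempty T.V := T.isTree.connected.nonempty

instance : Countable T.V := by
  rw [← Set.countable_univ_iff]
  have x : T.V := Classical.arbitrary _
  refine (Set.countable_iUnion fun n => (T.finite_sphere x n).countable).mono ?_
  intro y _
  simp

end HomTree

/-- The `ℓ^q` quantity of a nonnegative function. -/
def ell {α : Type*} (q : ℝ) (a : α → ℝ≥0∞) : ℝ≥0∞ := (∑' x, a x ^ q) ^ (1 / q)

namespace HomTree

variable {Q : ℕ} (T : HomTree Q)

/-- The indicator of pairs of vertices at distance `n`. -/
def ind (n : ℕ) (x y : T.V) : ℝ≥0∞ := if T.graph.dist x y = n then 1 else 0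

lemma ind_comm (n : ℕ) (x y : T.V) : T.ind n x y = T.ind n y x := by
  simp [ind, SimpleGraph.dist_comm]

lemma sum_nbrs_ind (n : ℕ) (x y : T.V) :
    ∑ z ∈ T.nbrs x, T.ind (n + 1) z y = T.ind (n + 2) x y +
      (if n = 0 then (Q + 1 : ℝ≥0∞) else Q) * T.ind n x y := by
  have h := T.sum_nbrs_dist (fun d => if d = n + 1 then (1 : ℝ≥0∞) else 0) y x
  simp only [ind] at *
  simp only [SimpleGraph.dist_comm (v := y)]
  rw [h]
  split_ifs <;> first | omega | simp

lemma sum_nbrs_ind_zero (x y : T.V) : ∑ z ∈ T.nbrs x, T.ind 0 z y = T.ind 1 x y := by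
  have h := T.sum_nbrs_dist (fun d => if d = 0 then (1 : ℝ≥0∞) else 0) y x
  simp only [ind] at *
  simp only [SimpleGraph.dist_comm (v := y)]
  rw [h]
  have h1 : ¬ (1 : ℕ) = 0 := one_ne_zero
  split_ifs <;> first | omega | contradiction | simp

/-- Radial profile of the positive eigenfunction at the bottom of the `ℓ²` spectrum. -/
def groundProfile (Q n : ℕ) : ℝ := (Real.sqrt Q)⁻¹ ^ n * (1 + (Q - 1) / (Q + 1) * n)

/-- Eigenvalues of the sphere operators on the ground state. -/
def sphereEig (Q n : ℕ) : ℝ :=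
  if n = 0 then 1 else Real.sqrt Q ^ n * (2 + (n - 1) * (1 - (Q : ℝ)⁻¹))

lemma groundProfile_pos (hQ : 2 ≤ Q) (n : ℕ) : 0 < groundProfile Q n := by
  have : (2 : ℝ) ≤ Q := by exact_mod_cast hQ
  have : (0 : ℝ) ≤ (Q - 1) / (Q + 1) := div_nonneg (by linarith) (by linarith)
  unfold groundProfile
  positivity

lemma sphereEig_nonneg (hQ : 2 ≤ Q) (n : ℕ) : 0 ≤ sphereEig Q n := by
  have h2 : (2 : ℝ) ≤ Q := by exact_mod_cast hQ
  unfold sphereEig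
  split_ifs with h
  · simp
  · have h1 : (1 : ℝ) ≤ n := by exact_mod_cast Nat.one_le_iff_ne_zero.2 h
    have : (Q : ℝ)⁻¹ ≤ 1 := inv_le_one_of_one_le₀ (by linarith)
    have : 0 ≤ ((n : ℝ) - 1) * (1 - (Q : ℝ)⁻¹) := mul_nonneg (by linarith) (by linarith)
    positivity

lemma sphereEig_le (hQ : 2 ≤ Q) (n : ℕ) : sphereEig Q n ≤ (n + 1) * Real.sqrt Q ^ n := by
  have h2 : (2 : ℝ) ≤ Q := by exact_mod_cast hQ
  unfold sphereEig
  split_ifs with h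
  · simp [h]
  · have h1 : (1 : ℝ) ≤ n := by exact_mod_cast Nat.one_le_iff_ne_zero.2 h
    rw [mul_comm]
    have : 0 ≤ (Q : ℝ)⁻¹ := by positivity
    exact mul_le_mul_of_nonneg_right (by nlinarith) (by positivity)

lemma sphereEig_rec (hQ : 2 ≤ Q) (n : ℕ) :
    sphereEig Q (n + 2) + (if n = 0 then (Q + 1 : ℝ) else Q) * sphereEig Q n =
      2 * Real.sqrt Q * sphereEig Q (n + 1) := by
  have h2 : (0 : ℝ) < Q := by positivity
  have hs : Real.sqrt Q ^ 2 = Q := Real.sq_sqrt h2.le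
  rcases n with _ | n
  · simp only [sphereEig]
    norm_num
    have : (Q : ℝ) * (Q : ℝ)⁻¹ = 1 := mul_inv_cancel₀ h2.ne'
    nlinarith
  · simp only [sphereEig]
    norm_num
    have : Real.sqrt Q ^ (n + 1 + 2) = Real.sqrt Q ^ (n + 1) * Q := by rw [pow_add, hs]
    rw [this]
    have : 2 * Real.sqrt Q * (Real.sqrt Q ^ (n + 1 + 1) * (2 + ((n : ℝ) + 1) * (1 - (Q : ℝ)⁻¹)))
      = 2 * Real.sqrt Q ^ 2 * (Real.sqrt Q ^ (n + 1) * (2 + ((n : ℝ) + 1) * (1 - (Q : ℝ)⁻¹))) := by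
      ring
    rw [this, hs]
    ring

/-- The ground state centred at `o`. -/
def ground (o x : T.V) : ℝ≥0∞ := ENNReal.ofReal (groundProfile Q (T.graph.dist o x))

lemma sum_nbrs_ground (hQ : 2 ≤ Q) (o x : T.V) :
    ∑ z ∈ T.nbrs x, T.ground o z = ENNReal.ofReal (2 * Real.sqrt Q) * T.ground o x := by
  unfold ground
  rw [← ENNReal.ofReal_sum_of_nonneg fun z _ => (groundProfile_pos hQ _).le,
    ← ENNReal.ofReal_mul (by positivity), T.sum_nbrs_dist (fun d => groundProfile Q d) o x]
  congr 1
  have h2 : (0 : ℝ) < Q := by positivity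
  have hs : Real.sqrt Q ^ 2 = Q := Real.sq_sqrt h2.le
  have hs0 : 0 < Real.sqrt Q := Real.sqrt_pos.2 h2
  have hi : (Q : ℝ) * (Real.sqrt Q)⁻¹ = Real.sqrt Q := by
    field_simp; rw [hs]
  split_ifs with h
  · rw [h]
    simp only [groundProfile]
    norm_num
    field_simp
    rw [hs]; ring
  · obtain ⟨m, hm⟩ : ∃ m, T.graph.dist o x = m + 1 := ⟨T.graph.dist o x - 1, by omega⟩
    rw [hm]
    simp only [groundProfile, Nat.add_sub_cancel]
    have e1 : (Real.sqrt Q)⁻¹ ^ m = Real.sqrt Q * (Real.sqrt Q)⁻¹ ^ (m + 1) := by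
      rw [pow_succ]; field_simp
    have e2 : (Q : ℝ) * ((Real.sqrt Q)⁻¹ ^ (m + 1 + 1) * (1 + (Q - 1) / (Q + 1) * ((m + 1 + 1 : ℕ) : ℝ)))
      = (Q : ℝ) * (Real.sqrt Q)⁻¹ * (Real.sqrt Q)⁻¹ ^ (m + 1) *
        (1 + (Q - 1) / (Q + 1) * ((m + 1 + 1 : ℕ) : ℝ)) := by ring
    rw [e2, hi, e1]
    push_cast
    ring

lemma tsum_ind_ground (hQ : 2 ≤ Q) (o : T.V) (n : ℕ) (x : T.V) :
    ∑' y, T.ind n x y * T.ground o y = ENNReal.ofReal (sphereEig Q n) * T.ground o x := by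
  classical
  have h0 : ∀ x, ∑' y, T.ind 0 x y * T.ground o y = T.ground o x := by
    intro x
    rw [tsum_eq_single x]
    · simp [ind]
    · intro y hy
      simp [ind, T.dist_eq_zero, hy.symm]
  have h1 : ∀ x, ∑' y, T.ind 1 x y * T.ground o y
      = ENNReal.ofReal (2 * Real.sqrt Q) * T.ground o x := by
    intro x
    rw [← T.sum_nbrs_ground hQ]
    simp_rw [← sum_nbrs_ind_zero, Finset.sum_mul]
    rw [Summable.tsum_finsetSum fun _ _ => ENNReal.summable]
    exact Finset.sum_congr rfl fun z _ => h0 z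
  suffices H : ∀ n, (∀ x, ∑' y, T.ind n x y * T.ground o y
      = ENNReal.ofReal (sphereEig Q n) * T.ground o x) ∧
      (∀ x, ∑' y, T.ind (n + 1) x y * T.ground o y
      = ENNReal.ofReal (sphereEig Q (n + 1)) * T.ground o x) from (H n).1 x
  intro n
  induction n with
  | zero =>
    refine ⟨fun x => by simp [h0, sphereEig], fun x => ?_⟩
    rw [h1]
    simp [sphereEig, mul_comm]
  | succ n ih =>
    refine ⟨ih.2, fun x => ?_⟩
    have hsum : ∑ z ∈ T.nbrs x, ∑' y, T.ind (n + 1) z y * T.ground o y =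
        ∑' y, T.ind (n + 2) x y * T.ground o y +
        (if n = 0 then (Q + 1 : ℝ≥0∞) else Q) * ∑' y, T.ind n x y * T.ground o y := by
      rw [← Summable.tsum_finsetSum fun _ _ => ENNReal.summable, ← ENNReal.tsum_mul_left,
        ← ENNReal.tsum_add]
      refine tsum_congr fun y => ?_
      rw [← Finset.sum_mul, sum_nbrs_ind]
      ring
    simp_rw [ih.2] at hsum
    rw [← Finset.mul_sum, T.sum_nbrs_ground hQ, ih.1, ← mul_assoc, ← mul_assoc,
      ← ENNReal.ofReal_mul (sphereEig_nonneg hQ _), mul_comm (sphereEig Q (n + 1)),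
      ← sphereEig_rec hQ, ENNReal.ofReal_add (sphereEig_nonneg hQ _) (mul_nonneg (by
        split_ifs <;> positivity) (sphereEig_nonneg hQ _)), ENNReal.ofReal_mul (by
        split_ifs <;> positivity), add_mul] at hsum
    have hc : ENNReal.ofReal (if n = 0 then (Q + 1 : ℝ) else Q) =
        if n = 0 then (Q + 1 : ℝ≥0∞) else Q := by
      split_ifs
      · rw [ENNReal.ofReal_add (by positivity) (by positivity)]; simp
      · simp
    rw [hc] at hsum
    refine ((ENNReal.add_left_inj ?_).1 hsum).symm
    refine ENNReal.mul_ne_top (ENNReal.mul_ne_top ?_ ENNReal.ofReal_ne_top) ENNReal.ofReal_ne_top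
    rw [← hc]
    exact ENNReal.ofReal_ne_top

end HomTree

section Ell

variable {α : Type*}

lemma tsum_rpow_mul_rpow_le (a b : α → ℝ≥0∞) {s t : ℝ} (hs : 0 ≤ s) (ht : 0 ≤ t)
    (hst : s + t = 1) : ∑' x, a x ^ s * b x ^ t ≤ (∑' x, a x) ^ s * (∑' x, b x) ^ t := by
  let _ : MeasurableSpace α := ⊤
  simp only [← lintegral_count]
  exact ENNReal.lintegral_mul_norm_pow_le (measurable_from_top.aemeasurable)
    (measurable_from_top.aemeasurable) hs ht hst

lemma ell_rpow {q : ℝ} (hq : 0 < q) (a : α → ℝ≥0∞) : ell q a ^ q = ∑' x, a x ^ q := by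
  rw [ell, ← ENNReal.rpow_mul, one_div_mul_cancel hq.ne', ENNReal.rpow_one]

lemma le_ell {q : ℝ} (hq : 0 < q) (a : α → ℝ≥0∞) (x : α) : a x ≤ ell q a := by
  rw [← ENNReal.rpow_le_rpow_iff hq, ell_rpow hq]
  exact ENNReal.le_tsum x

lemma ell_anti {p q : ℝ} (hp : 0 < p) (hpq : p ≤ q) (a : α → ℝ≥0∞) : ell q a ≤ ell p a := by
  have hq := hp.trans_le hpq
  rw [← ENNReal.rpow_le_rpow_iff hq, ell_rpow hq]
  calc ∑' x, a x ^ q = ∑' x, a x ^ p * a x ^ (q - p) := by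
        refine tsum_congr fun x => ?_
        rw [← ENNReal.rpow_add_of_nonneg _ _ hp.le (sub_nonneg.2 hpq), add_sub_cancel]
    _ ≤ ∑' x, a x ^ p * ell p a ^ (q - p) := by
        gcongr with x
        exact le_ell hp a x
    _ = ell p a ^ q := by
        rw [ENNReal.tsum_mul_right, ← ell_rpow hp,
          ← ENNReal.rpow_add_of_nonneg _ _ hp.le (sub_nonneg.2 hpq), add_sub_cancel]

lemma ell_add_le {q : ℝ} (hq : 1 ≤ q) (a b : α → ℝ≥0∞) :
    ell q (fun x => a x + b x) ≤ ell q a + ell q b := by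
  let _ : MeasurableSpace α := ⊤
  simp only [ell, ← lintegral_count]
  exact ENNReal.lintegral_Lp_add_le (measurable_from_top.aemeasurable)
    (measurable_from_top.aemeasurable) hq

lemma ell_mono {q : ℝ} (hq : 0 < q) {a b : α → ℝ≥0∞} (h : ∀ x, a x ≤ b x) :
    ell q a ≤ ell q b := by
  unfold ell
  gcongr with x
  exact h x

lemma ell_const_mul {q : ℝ} (hq : 0 < q) (c : ℝ≥0∞) (a : α → ℝ≥0∞) :
    ell q (fun x => c * a x) = c * ell q a := by
  simp only [ell, ENNReal.mul_rpow_of_nonneg _ _ hq.le, ENNReal.tsum_mul_left]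
  rw [ENNReal.mul_rpow_of_nonneg _ _ (by positivity), ← ENNReal.rpow_mul, mul_one_div_cancel hq.ne',
    ENNReal.rpow_one]

lemma ell_rpow_mul_le {r γ : ℝ} (hr : 0 < r) (hγ : 1 < γ) (a b : α → ℝ≥0∞) :
    ell r (fun x => a x ^ (γ - 1) * b x) ≤ ell (r * γ) a ^ (γ - 1) * ell (r * γ) b := by
  have hγ0 : 0 < γ := by linarith
  rw [← ENNReal.rpow_le_rpow_iff hr, ell_rpow hr, ENNReal.mul_rpow_of_nonneg _ _ hr.le]
  have h := tsum_rpow_mul_rpow_le (fun x => a x ^ (r * γ)) (fun x => b x ^ (r * γ))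
    (s := (γ - 1) / γ) (t := 1 / γ) (div_nonneg (by linarith) hγ0.le) (by positivity)
    (by field_simp; ring)
  rw [← ell_rpow (by positivity), ← ell_rpow (by positivity)] at h
  simp only [← ENNReal.rpow_mul] at h ⊢
  have e1 : r * γ * ((γ - 1) / γ) = (γ - 1) * r := by field_simp
  have e2 : r * γ * (1 / γ) = r := by field_simp
  rw [e1, e2] at h
  refine le_trans (le_of_eq (tsum_congr fun x => ?_)) h
  rw [ENNReal.mul_rpow_of_nonneg _ _ hr.le, ← ENNReal.rpow_mul]

end Ell

namespace HomTree

variable {Q : ℕ} (T : HomTree Q)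

lemma ind_bilin_two (hQ : 2 ≤ Q) (n : ℕ) (g h : T.V → ℝ≥0∞) :
    ∑' z : T.V × T.V, T.ind n z.1 z.2 * (g z.2 * h z.1) ≤
      ENNReal.ofReal (sphereEig Q n) *
        ((∑' y, g y ^ (2 : ℝ)) ^ (1 / 2 : ℝ) * (∑' x, h x ^ (2 : ℝ)) ^ (1 / 2 : ℝ)) := by
  have o : T.V := Classical.arbitrary _
  set ψ := T.ground o with hψ
  have h0 : ∀ x, ψ x ≠ 0 := fun x => by
    simpa [hψ, ground] using groundProfile_pos hQ _
  have ht : ∀ x, ψ x ≠ ∞ := fun x => ENNReal.ofReal_ne_top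
  have key : ∀ g : T.V → ℝ≥0∞, ∑' y, ∑' x, T.ind n x y * (g y ^ (2 : ℝ) * (ψ x / ψ y)) =
      ENNReal.ofReal (sphereEig Q n) * ∑' y, g y ^ (2 : ℝ) := by
    intro g
    rw [← ENNReal.tsum_mul_left]
    refine tsum_congr fun y => ?_
    have : ∀ x, T.ind n x y * (g y ^ (2 : ℝ) * (ψ x / ψ y)) =
        g y ^ (2 : ℝ) / ψ y * (T.ind n y x * ψ x) := fun x => by
      rw [ind_comm, div_eq_mul_inv, div_eq_mul_inv]; ring
    simp_rw [this]
    rw [ENNReal.tsum_mul_left, T.tsum_ind_ground hQ, ← mul_assoc, mul_comm _ (ψ y), ← mul_assoc,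
      ENNReal.mul_div_cancel (h0 y) (ht y), mul_comm]
  have hold := tsum_rpow_mul_rpow_le
    (fun z : T.V × T.V => T.ind n z.1 z.2 * (g z.2 ^ (2 : ℝ) * (ψ z.1 / ψ z.2)))
    (fun z : T.V × T.V => T.ind n z.1 z.2 * (h z.1 ^ (2 : ℝ) * (ψ z.2 / ψ z.1)))
    (s := 1 / 2) (t := 1 / 2) (by norm_num) (by norm_num) (by norm_num)
  have key2 : ∑' x, ∑' y, T.ind n x y * (h x ^ (2 : ℝ) * (ψ y / ψ x)) =
      ENNReal.ofReal (sphereEig Q n) * ∑' x, h x ^ (2 : ℝ) := by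
    rw [← key h]
    exact tsum_congr fun x => tsum_congr fun y => by rw [ind_comm]
  rw [ENNReal.tsum_prod (f := fun x y => T.ind n x y * (g y ^ (2 : ℝ) * (ψ x / ψ y))),
    ENNReal.tsum_comm, key,
    ENNReal.tsum_prod (f := fun x y => T.ind n x y * (h x ^ (2 : ℝ) * (ψ y / ψ x))), key2] at hold
  refine le_trans (le_of_eq (tsum_congr fun z => ?_)) (hold.trans (le_of_eq ?_))
  · have hi : T.ind n z.1 z.2 ^ (1 / 2 : ℝ) * T.ind n z.1 z.2 ^ (1 / 2 : ℝ) = T.ind n z.1 z.2 := by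
      unfold ind; split_ifs <;> simp
    have hp : (ψ z.1 / ψ z.2) ^ (1 / 2 : ℝ) * (ψ z.2 / ψ z.1) ^ (1 / 2 : ℝ) = 1 := by
      rw [← ENNReal.mul_rpow_of_nonneg _ _ (by norm_num), ← mul_div_assoc,
        ENNReal.div_mul_cancel (h0 _) (ht _), ENNReal.div_self (h0 _) (ht _), ENNReal.one_rpow]
    simp only [ENNReal.mul_rpow_of_nonneg _ _ (show (0 : ℝ) ≤ 1 / 2 by norm_num), ← ENNReal.rpow_mul]
    norm_num at hi hp ⊢
    calc _ = T.ind n z.1 z.2 * (g z.2 * h z.1) * 1 := by ring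
      _ = _ := by rw [← hp]; nth_rewrite 1 [← hi]; ring
  · rw [ENNReal.mul_rpow_of_nonneg _ _ (by norm_num), ENNReal.mul_rpow_of_nonneg _ _ (by norm_num)]
    have : ∀ c : ℝ≥0∞, c = c ^ (1 / 2 : ℝ) * c ^ (1 / 2 : ℝ) := fun c => by
      rw [← ENNReal.rpow_add_of_nonneg _ _ (by norm_num) (by norm_num)]; norm_num
    nth_rewrite 3 [this (ENNReal.ofReal (sphereEig Q n))]
    ring

lemma ind_bilin (hQ : 2 ≤ Q) {a r : ℝ} (ha : 2 < a) (hr : a.HolderConjugate r) (n : ℕ)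
    (g h : T.V → ℝ≥0∞) :
    ∑' z : T.V × T.V, T.ind n z.1 z.2 * (g z.2 * h z.1) ≤
      ENNReal.ofReal (sphereEig Q n) ^ (2 / a) * (ell r g * ell r h) := by
  have hr0 : 0 < r := hr.symm.pos
  have ha0 : 0 < a := by linarith
  have hθ : 2 / a ≤ 1 := by rw [div_le_one ha0]; exact ha.le
  have hinv := hr.inv_add_inv_eq_one
  have hra : r * (1 - 1 / a) = 1 := by
    have : r⁻¹ = 1 - 1 / a := by rw [one_div]; linarith
    rw [← this, mul_inv_cancel₀ hr0.ne']
  have hold := tsum_rpow_mul_rpow_le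
    (fun z : T.V × T.V => T.ind n z.1 z.2 * (g z.2 ^ (r / 2) * h z.1 ^ (r / 2)))
    (fun z : T.V × T.V => g z.2 ^ r * h z.1 ^ r)
    (s := 2 / a) (t := 1 - 2 / a) (by positivity) (by linarith) (by ring)
  have b2 := T.ind_bilin_two hQ n (fun y => g y ^ (r / 2)) (fun x => h x ^ (r / 2))
  have hprod : ∑' z : T.V × T.V, g z.2 ^ r * h z.1 ^ r = ell r g ^ r * ell r h ^ r := by
    rw [ENNReal.tsum_prod (f := fun x y => g y ^ r * h x ^ r), ell_rpow hr0, ell_rpow hr0]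
    simp_rw [ENNReal.tsum_mul_right, ENNReal.tsum_mul_left]
  simp only [← ENNReal.rpow_mul, div_mul_cancel₀ r (two_ne_zero)] at b2
  rw [← ell_rpow hr0, ← ell_rpow hr0] at b2
  simp only [← ENNReal.rpow_mul] at b2
  rw [hprod] at hold
  refine le_trans (le_of_eq (tsum_congr fun z => ?_)) (hold.trans ?_)
  · have hi : T.ind n z.1 z.2 ^ (2 / a) = T.ind n z.1 z.2 := by
      unfold ind
      have : 0 < 2 / a := by positivity
      split_ifs <;> simp [this]
    have hg : ∀ c : ℝ≥0∞, c ^ (r / 2 * (2 / a)) * c ^ (r * (1 - 2 / a)) = c := fun c => by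
      rw [← ENNReal.rpow_add_of_nonneg _ _ (by positivity)
        (mul_nonneg hr0.le (by linarith))]
      rw [show r / 2 * (2 / a) + r * (1 - 2 / a) = r * (1 - 1 / a) by ring, hra, ENNReal.rpow_one]
    simp only [ENNReal.mul_rpow_of_nonneg _ _ (show (0 : ℝ) ≤ 2 / a by positivity),
      ENNReal.mul_rpow_of_nonneg _ _ (show (0 : ℝ) ≤ 1 - 2 / a by linarith), ← ENNReal.rpow_mul, hi]
    calc T.ind n z.1 z.2 * (g z.2 * h z.1) = T.ind n z.1 z.2 *
          ((g z.2 ^ (r / 2 * (2 / a)) * g z.2 ^ (r * (1 - 2 / a))) *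
            (h z.1 ^ (r / 2 * (2 / a)) * h z.1 ^ (r * (1 - 2 / a)))) := by rw [hg, hg]
      _ = _ := by ring
  · calc _ ≤ (ENNReal.ofReal (sphereEig Q n) * (ell r g ^ (r * (1 / 2)) * ell r h ^ (r * (1 / 2))))
          ^ (2 / a) * (ell r g ^ r * ell r h ^ r) ^ (1 - 2 / a) := by
          gcongr
      _ = _ := by
        simp only [ENNReal.mul_rpow_of_nonneg _ _ (show (0 : ℝ) ≤ 2 / a by positivity),
          ENNReal.mul_rpow_of_nonneg _ _ (show (0 : ℝ) ≤ 1 - 2 / a by linarith), ← ENNReal.rpow_mul]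
        have hg : ∀ c : ℝ≥0∞, c ^ (r * (1 / 2) * (2 / a)) * c ^ (r * (1 - 2 / a)) = c := fun c => by
          rw [← ENNReal.rpow_add_of_nonneg _ _ (by positivity)
            (mul_nonneg hr0.le (by linarith))]
          rw [show r * (1 / 2) * (2 / a) + r * (1 - 2 / a) = r * (1 - 1 / a) by ring, hra,
            ENNReal.rpow_one]
        calc _ = ENNReal.ofReal (sphereEig Q n) ^ (2 / a) *
              ((ell r g ^ (r * (1 / 2) * (2 / a)) * ell r g ^ (r * (1 - 2 / a))) *
                (ell r h ^ (r * (1 / 2) * (2 / a)) * ell r h ^ (r * (1 - 2 / a)))) := by ring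
          _ = _ := by rw [hg, hg]

/-- Radial kernels act from `ℓ^{a'}` to `ℓ^a` for `a > 2`. -/
lemma radial_bilin (hQ : 2 ≤ Q) {a r : ℝ} (ha : 2 < a) (hr : a.HolderConjugate r)
    (k : ℕ → ℝ≥0∞) (g h : T.V → ℝ≥0∞) :
    ∑' x, ∑' y, k (T.graph.dist x y) * (g y * h x) ≤
      (∑' n, k n * ENNReal.ofReal (sphereEig Q n) ^ (2 / a)) * (ell r g * ell r h) := by
  have hk : ∀ x y, k (T.graph.dist x y) * (g y * h x) =
      ∑' n, k n * (T.ind n x y * (g y * h x)) := fun x y => by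
    rw [tsum_eq_single (T.graph.dist x y)]
    · simp [ind]
    · intro n hn
      simp [ind, hn.symm]
  simp_rw [hk]
  rw [← ENNReal.tsum_prod (f := fun x y => ∑' n, k n * (T.ind n x y * (g y * h x))),
    ENNReal.tsum_comm, ← ENNReal.tsum_mul_right]
  gcongr with n
  rw [ENNReal.tsum_mul_left, mul_assoc]
  gcongr
  exact T.ind_bilin hQ ha hr n g h

end HomTree

namespace HomTree

variable {Q : ℕ} (T : HomTree Q)

/-- The Hilbert space `ℓ²` of the tree. -/
abbrev L2 : Type := lp (fun _ : T.V => ℂ) 2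

lemma enorm_rpow_two (z : ℂ) : ‖z‖ₑ ^ (2 : ℝ) = ((‖z‖₊ ^ (2 : ℝ) : ℝ≥0) : ℝ≥0∞) := by
  rw [enorm_eq_nnnorm, ENNReal.coe_rpow_of_nonneg _ (by norm_num)]

variable {T} in
lemma memℓp_two_iff {g : T.V → ℂ} : Memℓp g 2 ↔ ell 2 (fun x => ‖g x‖ₑ) ≠ ∞ := by
  have h2 : (∑' x, ‖g x‖ₑ ^ (2 : ℝ)) = ∑' x, ((‖g x‖₊ ^ (2 : ℝ) : ℝ≥0) : ℝ≥0∞) :=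
    tsum_congr fun x => enorm_rpow_two _
  rw [memℓp_gen_iff (by norm_num), ell, ne_eq, ENNReal.rpow_eq_top_iff_of_pos (by norm_num), h2, ← ne_eq,
    ENNReal.tsum_coe_ne_top_iff_summable, ← NNReal.summable_coe]
  simp

lemma enorm_eq_ell (g : T.L2) : ‖g‖ₑ = ell 2 (fun x => ‖g x‖ₑ) := by
  have h2 : (∑' x, ‖g x‖ₑ ^ (2 : ℝ)) = ∑' x, ((‖g x‖₊ ^ (2 : ℝ) : ℝ≥0) : ℝ≥0∞) :=
    tsum_congr fun x => enorm_rpow_two _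
  have hs : Summable fun x => (‖g x‖₊ ^ (2 : ℝ) : ℝ≥0) := by
    rw [← NNReal.summable_coe]
    simpa using (memℓp_gen_iff (by norm_num)).1 g.2
  rw [ell, h2, ← ENNReal.coe_tsum hs, ← ENNReal.coe_rpow_of_nonneg _ (by norm_num), enorm_eq_nnnorm,
    ENNReal.coe_inj, ← NNReal.coe_inj, coe_nnnorm, lp.norm_eq_tsum_rpow (by norm_num)]
  simp [NNReal.coe_tsum]

/-- The `ℓ²` vector with given square summable coordinates. -/
def toL2 (g : T.V → ℂ) (hg : ell 2 (fun x => ‖g x‖ₑ) ≠ ∞) : T.L2 := ⟨g, memℓp_two_iff.2 hg⟩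

@[simp] lemma toL2_apply (g : T.V → ℂ) (hg) (x : T.V) : T.toL2 g hg x = g x := rfl

lemma ell_two_ne_top (g : T.L2) : ell 2 (fun x => ‖g x‖ₑ) ≠ ∞ := by
  rw [← enorm_eq_ell]; exact enorm_ne_top

lemma tsum_sum_nbrs (φ : T.V → ℝ≥0∞) :
    ∑' x, ∑ z ∈ T.nbrs x, φ z = (Q + 1) * ∑' z, φ z := by
  classical
  have h1 : ∀ x, ∑ z ∈ T.nbrs x, φ z = ∑' z, if z ∈ T.nbrs x then φ z else 0 := fun x => by
    rw [tsum_eq_sum (s := T.nbrs x) (fun z hz => by simp [hz])]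
    exact Finset.sum_congr rfl fun z hz => by simp [hz]
  simp_rw [h1]
  rw [ENNReal.tsum_comm, ← ENNReal.tsum_mul_left]
  refine tsum_congr fun z => ?_
  rw [tsum_eq_sum (s := T.nbrs z) (fun x hx => by rw [mem_nbrs_comm] at hx; simp [hx]),
    Finset.sum_congr rfl (g := fun _ => φ z) fun x hx => by rw [mem_nbrs_comm] at hx; simp [hx]]
  simp [T.card_nbrs]

/-- The averaging operator on functions. -/
def avgFun (g : T.V → ℂ) (x : T.V) : ℂ := (Q + 1 : ℂ)⁻¹ * ∑ z ∈ T.nbrs x, g z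

lemma ell_avgFun_le (g : T.V → ℂ) :
    ell 2 (fun x => ‖T.avgFun g x‖ₑ) ≤ ell 2 (fun x => ‖g x‖ₑ) := by
  have hQ0 : (Q + 1 : ℝ≥0∞) ≠ 0 := by simp
  have hQt : (Q + 1 : ℝ≥0∞) ≠ ∞ := by finiteness
  have hn : ‖(Q + 1 : ℂ)⁻¹‖ₑ = (Q + 1 : ℝ≥0∞)⁻¹ := by
    rw [enorm_inv (by exact_mod_cast Nat.succ_ne_zero Q)]
    congr 1
    have : ((Q : ℂ) + 1) = ((Q + 1 : ℕ) : ℂ) := by push_cast; rfl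
    rw [this, ← ofReal_norm, Complex.norm_natCast, ENNReal.ofReal_natCast]
    push_cast; rfl
  unfold ell
  gcongr ?_ ^ _
  calc ∑' x, ‖T.avgFun g x‖ₑ ^ (2 : ℝ)
      ≤ ∑' x, (Q + 1 : ℝ≥0∞)⁻¹ * ∑ z ∈ T.nbrs x, ‖g z‖ₑ ^ (2 : ℝ) := by
        gcongr with x
        calc ‖T.avgFun g x‖ₑ ^ (2 : ℝ)
            ≤ ((Q + 1 : ℝ≥0∞)⁻¹ * ∑ z ∈ T.nbrs x, ‖g z‖ₑ) ^ (2 : ℝ) := by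
              rw [avgFun, enorm_mul, hn]
              gcongr
              exact enorm_sum_le _ _
          _ ≤ ((Q + 1 : ℝ≥0∞)⁻¹) ^ (2 : ℝ) *
              ((T.nbrs x).card ^ ((2 : ℝ) - 1) * ∑ z ∈ T.nbrs x, ‖g z‖ₑ ^ (2 : ℝ)) := by
              rw [ENNReal.mul_rpow_of_nonneg _ _ (by norm_num)]
              gcongr
              exact ENNReal.rpow_sum_le_const_mul_sum_rpow _ _ (by norm_num)
          _ = _ := by
              rw [T.card_nbrs, ← mul_assoc]
              congr 1
              norm_num [sq]
              rw [mul_assoc, ENNReal.inv_mul_cancel hQ0 hQt, mul_one]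
    _ = _ := by
        rw [ENNReal.tsum_mul_left, T.tsum_sum_nbrs, ← mul_assoc, ENNReal.inv_mul_cancel hQ0 hQt,
          one_mul]

/-- The averaging operator on `ℓ²`. -/
def avg : T.L2 →L[ℂ] T.L2 :=
  LinearMap.mkContinuous
    { toFun := fun g => T.toL2 (T.avgFun g)
        (ne_top_of_le_ne_top (T.ell_two_ne_top g) (T.ell_avgFun_le g))
      map_add' := fun f g => by
        ext x
        have : ∑ z ∈ T.nbrs x, (f + g) z = ∑ z ∈ T.nbrs x, f z + ∑ z ∈ T.nbrs x, g z :=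
          Finset.sum_add_distrib
        simp only [toL2_apply, avgFun, lp.coeFn_add, Pi.add_apply] at this ⊢
        rw [this, mul_add]
      map_smul' := fun c g => by
        ext x
        simp [avgFun, Finset.mul_sum, mul_left_comm] } 1 fun g => by
    rw [one_mul, ← enorm_le_iff_norm_le, enorm_eq_ell, enorm_eq_ell]
    exact T.ell_avgFun_le g

@[simp] lemma avg_apply (g : T.L2) (x : T.V) : T.avg g x = T.avgFun g x := rfl

open Classical in
/-- Point masses. -/
def delta (x : T.V) : T.L2 := lp.single 2 x 1

open Classical in
lemma delta_apply (x y : T.V) : T.delta x y = if x = y then 1 else 0 := by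
  rw [delta, lp.single_apply, Pi.single_apply]
  simp only [eq_comm (a := x)]

lemma inner_delta_left (x : T.V) (g : T.L2) : inner ℂ (T.delta x) g = g x := by
  classical
  rw [delta, lp.inner_single_left]; simp

lemma inner_delta_right (x : T.V) (g : T.L2) : inner ℂ g (T.delta x) = (starRingEnd ℂ) (g x) := by
  rw [← inner_conj_symm, inner_delta_left]

lemma avg_delta (x : T.V) : T.avg (T.delta x) = (Q + 1 : ℂ)⁻¹ • ∑ z ∈ T.nbrs x, T.delta z := by
  classical
  ext y
  have : (∑ z ∈ T.nbrs x, T.delta z) y = ∑ z ∈ T.nbrs x, T.delta z y := by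
    rw [lp.coeFn_sum, Finset.sum_apply]
  rw [lp.coeFn_smul, Pi.smul_apply, this]
  simp [avgFun, delta_apply, T.graph.adj_comm]

lemma star_avg : star T.avg = T.avg := by
  rw [ContinuousLinearMap.star_eq_adjoint]
  ext g x
  rw [← inner_delta_left, ContinuousLinearMap.adjoint_inner_right, avg_delta, inner_smul_left,
    sum_inner]
  simp [inner_delta_left, avgFun]

/-- The skew-adjoint generator `iℒ`. -/
def gen : T.L2 →L[ℂ] T.L2 := I • (1 - T.avg)

lemma star_gen : star T.gen = -T.gen := by
  rw [gen, star_smul, star_sub, star_one, star_avg]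
  simp

/-- The Schrödinger group on `ℓ²`. -/
def U (t : ℝ) : T.L2 →L[ℂ] T.L2 := NormedSpace.exp ((t : ℂ) • T.gen)

lemma U_zero : T.U 0 = 1 := by simp [U]

lemma U_add (s t : ℝ) : T.U (s + t) = T.U s * T.U t := by
  let +nondep : NormedAlgebra ℚ (T.L2 →L[ℂ] T.L2) := NormedAlgebra.restrictScalars ℚ ℂ _
  rw [U, ofReal_add, add_smul, NormedSpace.exp_add_of_commute]
  · rfl
  · exact ((Commute.refl T.gen).smul_left (s : ℂ)).smul_right (t : ℂ)

lemma U_add_apply (s t : ℝ) (g : T.L2) : T.U (s + t) g = T.U s (T.U t g) := by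
  rw [U_add]; rfl

lemma continuous_U : Continuous T.U := by
  let +nondep : NormedAlgebra ℚ (T.L2 →L[ℂ] T.L2) := NormedAlgebra.restrictScalars ℚ ℂ _
  unfold U
  fun_prop

lemma adjoint_U (t : ℝ) : ContinuousLinearMap.adjoint (T.U t) = T.U (-t) := by
  rw [← ContinuousLinearMap.star_eq_adjoint, U, NormedSpace.star_exp, star_smul, star_gen, U]
  simp

lemma inner_U_left (t : ℝ) (f g : T.L2) : inner ℂ (T.U t f) g = inner ℂ f (T.U (-t) g) := by
  rw [← adjoint_U, ContinuousLinearMap.adjoint_inner_right]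

lemma U_neg_apply (t : ℝ) (g : T.L2) : T.U (-t) (T.U t g) = g := by
  rw [← U_add_apply, neg_add_cancel, U_zero]; rfl

lemma norm_U (t : ℝ) (g : T.L2) : ‖T.U t g‖ = ‖g‖ := by
  rw [@norm_eq_sqrt_re_inner ℂ, @norm_eq_sqrt_re_inner ℂ _ _ _ _ g, inner_U_left, U_neg_apply]

lemma hasSum_U_delta (t : ℝ) (x y : T.V) :
    HasSum (fun j : ℕ => ((j.factorial : ℂ)⁻¹ * (t : ℂ) ^ j) * (T.gen ^ j) (T.delta x) y)
      (T.U t (T.delta x) y) := by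
  have h := NormedSpace.exp_series_hasSum_exp' (𝕂 := ℂ) ((t : ℂ) • T.gen)
  have h2 := ((innerSL ℂ (T.delta y)).comp
    (ContinuousLinearMap.apply ℂ T.L2 (T.delta x))).hasSum h
  have h3 : ∀ A : T.L2 →L[ℂ] T.L2, ((innerSL ℂ (T.delta y)).comp
      (ContinuousLinearMap.apply ℂ T.L2 (T.delta x))) A = A (T.delta x) y := fun A =>
    T.inner_delta_left y (A (T.delta x))
  simp only [h3] at h2
  refine Eq.mp (congrArg (HasSum · _) (funext fun j => ?_)) h2
  rw [smul_pow, smul_smul]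
  rfl

end HomTree

lemma inv_sqrt_lt_one {Q : ℕ} (hQ : 2 ≤ Q) : (Real.sqrt Q)⁻¹ < 1 := by
  have : (2 : ℝ) ≤ Q := by exact_mod_cast hQ
  exact inv_lt_one_of_one_lt₀ (Real.lt_sqrt_of_sq_lt (by linarith))

lemma summable_inv_sqrt_pow {Q : ℕ} (hQ : 2 ≤ Q) (n : ℕ) :
    Summable fun k : ℕ => (Real.sqrt Q)⁻¹ ^ (n + 2 * k) := by
  simp_rw [pow_add, pow_mul]
  refine (summable_geometric_of_lt_one (by positivity) ?_).mul_left _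
  exact pow_lt_one₀ (by positivity) (inv_sqrt_lt_one hQ) two_ne_zero

/-- The weighted series of sines in the radial Schrödinger kernel. -/
def sinSeries (Q n : ℕ) (l : ℝ) : ℝ :=
  ∑' k : ℕ, (Real.sqrt Q)⁻¹ ^ (n + 2 * k) * Real.sin (((n : ℝ) + 2 * k + 1) * l)

lemma norm_sinSeries_term_le (Q n k : ℕ) (l : ℝ) :
    ‖(Real.sqrt Q)⁻¹ ^ (n + 2 * k) * Real.sin (((n : ℝ) + 2 * k + 1) * l)‖ ≤
      (Real.sqrt Q)⁻¹ ^ (n + 2 * k) := by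
  rw [norm_mul, Real.norm_of_nonneg (by positivity)]
  exact mul_le_of_le_one_right (by positivity) (Real.abs_sin_le_one _)

lemma hasSum_sinSeries {Q : ℕ} (hQ : 2 ≤ Q) (n : ℕ) (l : ℝ) :
    HasSum (fun k : ℕ => (Real.sqrt Q)⁻¹ ^ (n + 2 * k) * Real.sin (((n : ℝ) + 2 * k + 1) * l))
      (sinSeries Q n l) :=
  (Summable.of_norm_bounded (summable_inv_sqrt_pow hQ n)
    fun k => norm_sinSeries_term_le Q n k l).hasSum

lemma continuous_sinSeries {Q : ℕ} (hQ : 2 ≤ Q) (n : ℕ) : Continuous (sinSeries Q n) :=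
  continuous_tsum (fun k => by fun_prop) (summable_inv_sqrt_pow hQ n)
    fun k l => norm_sinSeries_term_le Q n k l

lemma two_mul_cos_mul_sin (a l : ℝ) :
    2 * Real.cos l * Real.sin (a * l) = Real.sin ((a + 1) * l) + Real.sin ((a - 1) * l) := by
  rw [show (a + 1) * l = a * l + l by ring, show (a - 1) * l = a * l - l by ring, Real.sin_add,
    Real.sin_sub]
  ring

lemma sinSeries_succ_rec {Q : ℕ} (hQ : 2 ≤ Q) (n : ℕ) (l : ℝ) :
    2 * Real.cos l * sinSeries Q (n + 1) l =
      Real.sqrt Q * sinSeries Q (n + 2) l + (Real.sqrt Q)⁻¹ * sinSeries Q n l := by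
  have hs : Real.sqrt Q ≠ 0 := by positivity
  refine ((hasSum_sinSeries hQ (n + 1) l).mul_left (2 * Real.cos l)).unique ?_
  refine Eq.mp (congrArg (HasSum · _) (funext fun k => ?_))
    (((hasSum_sinSeries hQ (n + 2) l).mul_left (Real.sqrt Q)).add
      ((hasSum_sinSeries hQ n l).mul_left (Real.sqrt Q)⁻¹))
  rw [show 2 * Real.cos l * ((Real.sqrt Q)⁻¹ ^ (n + 1 + 2 * k) *
    Real.sin ((((n + 1 : ℕ) : ℝ) + 2 * k + 1) * l)) = (Real.sqrt Q)⁻¹ ^ (n + 1 + 2 * k) *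
    (2 * Real.cos l * Real.sin ((((n + 1 : ℕ) : ℝ) + 2 * k + 1) * l)) by ring, two_mul_cos_mul_sin,
    show n + 2 + 2 * k = (n + 1 + 2 * k) + 1 by ring, pow_succ _ (n + 1 + 2 * k),
    show n + 1 + 2 * k = (n + 2 * k) + 1 by ring, pow_succ _ (n + 2 * k)]
  push_cast
  rw [show (n : ℝ) + 1 + 2 * k + 1 + 1 = n + 2 + 2 * k + 1 by ring,
    show (n : ℝ) + 1 + 2 * k + 1 - 1 = n + 2 * k + 1 by ring]
  field_simp

lemma sinSeries_zero_rec {Q : ℕ} (hQ : 2 ≤ Q) (l : ℝ) :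
    2 * Real.cos l * sinSeries Q 0 l = (Real.sqrt Q + (Real.sqrt Q)⁻¹) * sinSeries Q 1 l := by
  have hs : Real.sqrt Q ≠ 0 := by positivity
  have h1 := hasSum_sinSeries hQ 1 l
  have hshift : HasSum (fun k : ℕ => (Real.sqrt Q)⁻¹ ^ (2 * k) * Real.sin (2 * k * l))
      ((Real.sqrt Q)⁻¹ * sinSeries Q 1 l) := by
    rw [← hasSum_nat_add_iff' 1]
    simp only [Finset.range_one, Finset.sum_singleton, Nat.cast_zero, mul_zero, zero_mul,
      Real.sin_zero, sub_zero]
    refine Eq.mp (congrArg (HasSum · _) (funext fun k => ?_)) (h1.mul_left (Real.sqrt Q)⁻¹)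
    push_cast
    rw [show 2 * ((k : ℝ) + 1) = 1 + 2 * k + 1 by ring]
    ring
  refine ((hasSum_sinSeries hQ 0 l).mul_left (2 * Real.cos l)).unique ?_
  rw [add_mul]
  refine Eq.mp (congrArg (HasSum · _) (funext fun k => ?_))
    ((h1.mul_left (Real.sqrt Q)).add hshift)
  rw [show 2 * Real.cos l * ((Real.sqrt Q)⁻¹ ^ (0 + 2 * k) *
    Real.sin ((((0 : ℕ) : ℝ) + 2 * k + 1) * l)) = (Real.sqrt Q)⁻¹ ^ (2 * k) *
    (2 * Real.cos l * Real.sin ((((0 : ℕ) : ℝ) + 2 * k + 1) * l)) by ring, two_mul_cos_mul_sin,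
    pow_add]
  push_cast
  rw [show (0 : ℝ) + 2 * k + 1 + 1 = 1 + 2 * k + 1 by ring,
    show (0 : ℝ) + 2 * k + 1 - 1 = 2 * k by ring]
  field_simp

lemma gammaZero_pos {Q : ℕ} (hQ : 2 ≤ Q) : 0 < gammaZero Q := by
  unfold gammaZero; positivity

lemma hasSum_integral_mul_sinSeries {Q : ℕ} (hQ : 2 ≤ Q) (n : ℕ) {f : ℝ → ℂ}
    (hf : Continuous f) :
    HasSum (fun k : ℕ => (((Real.sqrt Q)⁻¹ ^ (n + 2 * k) : ℝ) : ℂ) *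
        ∫ l in (0 : ℝ)..Real.pi, f l * (Real.sin (((n : ℝ) + 2 * k + 1) * l) : ℂ))
      (∫ l in (0 : ℝ)..Real.pi, f l * (sinSeries Q n l : ℂ)) := by
  simp_rw [← intervalIntegral.integral_const_mul]
  have hs := summable_inv_sqrt_pow hQ n
  refine intervalIntegral.hasSum_integral_of_dominated_convergence
    (fun k l => (Real.sqrt Q)⁻¹ ^ (n + 2 * k) * ‖f l‖)
    (fun k => (by fun_prop : Continuous _).aestronglyMeasurable)
    (fun k => .of_forall fun l _ => ?_) (.of_forall fun l _ => hs.mul_right _) ?_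
    (.of_forall fun l _ => ?_)
  · rw [norm_mul, norm_mul, norm_real, norm_real, Real.norm_of_nonneg (by positivity)]
    gcongr
    exact mul_le_of_le_one_right (norm_nonneg _) (Real.abs_sin_le_one _)
  · simp_rw [tsum_mul_right]
    exact (by fun_prop : Continuous _).intervalIntegrable _ _
  · have := (Complex.hasSum_ofReal.2 (hasSum_sinSeries hQ n l)).mul_left (f l)
    refine Eq.mp (congrArg (HasSum · _) (funext fun k => ?_)) this
    push_cast
    ring

lemma integral_sin_mul_sin {m : ℕ} (hm : 1 ≤ m) :
    ∫ l in (0 : ℝ)..Real.pi, Real.sin l * Real.sin (m * l) = if m = 1 then Real.pi / 2 else 0 := by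
  have hc : ∀ k : ℕ, k ≠ 0 → ∫ l in (0 : ℝ)..Real.pi, Real.cos (k * l) = 0 := fun k hk => by
    rw [intervalIntegral.integral_comp_mul_left _ (Nat.cast_ne_zero.2 hk)]
    simp
  have h : ∀ l, Real.sin l * Real.sin (m * l) =
      2⁻¹ * (Real.cos ((m - 1 : ℕ) * l) - Real.cos ((m + 1 : ℕ) * l)) := fun l => by
    push_cast [hm]
    rw [show ((m : ℝ) - 1) * l = m * l - l by ring, show ((m : ℝ) + 1) * l = m * l + l by ring,
      Real.cos_sub, Real.cos_add]
    ring
  simp_rw [h]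
  rw [intervalIntegral.integral_const_mul, intervalIntegral.integral_sub
    ((by fun_prop : Continuous _).intervalIntegrable _ _)
    ((by fun_prop : Continuous _).intervalIntegrable _ _), hc (m + 1) (by omega)]
  split_ifs with h1
  · subst h1; simp; ring
  · rw [hc (m - 1) (by omega)]; simp

lemma integral_sin_mul_sinSeries {Q : ℕ} (hQ : 2 ≤ Q) (n : ℕ) :
    ∫ l in (0 : ℝ)..Real.pi, (Real.sin l : ℂ) * (sinSeries Q n l : ℂ) =
      if n = 0 then (Real.pi : ℂ) / 2 else 0 := by
  refine (hasSum_integral_mul_sinSeries hQ n (by fun_prop : Continuous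
    fun l : ℝ => (Real.sin l : ℂ))).unique ?_
  have h : ∀ k : ℕ, ∫ l in (0 : ℝ)..Real.pi, (Real.sin l : ℂ) *
      (Real.sin (((n : ℝ) + 2 * k + 1) * l) : ℂ) = if n + 2 * k + 1 = 1 then (Real.pi : ℂ) / 2 else 0 :=
    fun k => by
      have := congrArg (fun r : ℝ => (r : ℂ)) (integral_sin_mul_sin (m := n + 2 * k + 1) (by omega))
      simp only [← intervalIntegral.integral_ofReal] at this
      push_cast at this ⊢
      rw [this]
      split_ifs <;> simp
  simp_rw [h]
  refine Eq.mp (congrArg (HasSum _ ·) ?_) (hasSum_single 0 fun k hk => ?_)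
  · split_ifs <;> first | omega | simp_all
  · rw [if_neg (by omega), mul_zero]

/-- The spectral weight attached to distance `n`. -/
def spectralWeight (Q n : ℕ) (l : ℝ) : ℂ := (Real.sin l : ℂ) * (sinSeries Q n l : ℂ)

lemma continuous_spectralWeight {Q : ℕ} (hQ : 2 ≤ Q) (n : ℕ) : Continuous (spectralWeight Q n) := by
  have := continuous_sinSeries hQ n
  unfold spectralWeight
  fun_prop

/-- The symbol of `iℒ`. -/
def symb (Q : ℕ) (l : ℝ) : ℂ := I * (1 - gammaZero Q * Real.cos l)

lemma continuous_symb (Q : ℕ) : Continuous (symb Q) := by unfold symb; fun_prop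

lemma spectralWeight_rec {Q : ℕ} (hQ : 2 ≤ Q) (n : ℕ) (l : ℝ) :
    (gammaZero Q * Real.cos l : ℂ) * spectralWeight Q n l = (Q + 1 : ℂ)⁻¹ *
      (if n = 0 then (Q + 1 : ℂ) * spectralWeight Q 1 l
        else spectralWeight Q (n - 1) l + (Q : ℂ) * spectralWeight Q (n + 1) l) := by
  have hs : Real.sqrt Q ≠ 0 := by positivity
  have hQs : Real.sqrt Q ^ 2 = Q := Real.sq_sqrt (by positivity)
  have hQ1 : (Q : ℝ) + 1 ≠ 0 := by positivity
  have h : gammaZero Q * Real.cos l * sinSeries Q n l = ((Q : ℝ) + 1)⁻¹ *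
      (if n = 0 then ((Q : ℝ) + 1) * sinSeries Q 1 l
        else sinSeries Q (n - 1) l + (Q : ℝ) * sinSeries Q (n + 1) l) := by
    rcases n with _ | n
    · have := sinSeries_zero_rec hQ l
      simp only [gammaZero, if_true]
      field_simp at this ⊢
      linear_combination this
    · have := sinSeries_succ_rec hQ n l
      simp only [gammaZero, Nat.succ_ne_zero, if_false, Nat.add_sub_cancel]
      generalize Real.sqrt Q = s at *
      rw [← hQs] at hQ1 ⊢
      field_simp at this ⊢
      linear_combination this
  have h' := congrArg (fun r : ℝ => (Real.sin l : ℂ) * (r : ℂ)) h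
  unfold spectralWeight
  split_ifs at h' ⊢ <;> push_cast at h' ⊢ <;> linear_combination h'

namespace HomTree

variable {Q : ℕ} (T : HomTree Q)

lemma gen_pow_delta (hQ : 2 ≤ Q) (j : ℕ) (x y : T.V) :
    (T.gen ^ j) (T.delta x) y = 2 / Real.pi *
      ∫ l in (0 : ℝ)..Real.pi, symb Q l ^ j * spectralWeight Q (T.graph.dist x y) l := by
  classical
  have hπ : (Real.pi : ℂ) ≠ 0 := by exact_mod_cast Real.pi_ne_zero
  have hi : ∀ j n : ℕ, IntervalIntegrable (fun l => symb Q l ^ j * spectralWeight Q n l) volume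
      0 Real.pi := fun j n =>
    (((continuous_symb Q).pow j).mul (continuous_spectralWeight hQ n)).intervalIntegrable _ _
  induction j generalizing y with
  | zero =>
    simp only [pow_zero, one_mul, spectralWeight]
    rw [integral_sin_mul_sinSeries hQ, one_apply_eq_self, delta_apply]
    simp only [T.dist_eq_zero]
    split_ifs
    · field_simp
    · simp
  | succ j ih =>
    have h1 : (T.gen ^ (j + 1)) (T.delta x) y = I * ((T.gen ^ j) (T.delta x) y -
        (Q + 1 : ℂ)⁻¹ * ∑ z ∈ T.nbrs y, (T.gen ^ j) (T.delta x) z) := by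
      rw [pow_succ', mul_apply_eq_comp]
      rfl
    rw [h1, ih, Finset.sum_congr rfl fun z _ => ih z, ← Finset.mul_sum,
      ← intervalIntegral.integral_finsetSum fun z _ => hi j _]
    have h2 : ∀ l, ∑ z ∈ T.nbrs y, symb Q l ^ j * spectralWeight Q (T.graph.dist x z) l =
        symb Q l ^ j * ((Q + 1) * ((gammaZero Q * Real.cos l : ℂ) *
          spectralWeight Q (T.graph.dist x y) l)) := fun l => by
      rw [← Finset.mul_sum, T.sum_nbrs_dist (fun d => spectralWeight Q d l), spectralWeight_rec hQ,
        mul_inv_cancel_left₀ (by exact_mod_cast Nat.succ_ne_zero Q)]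
    simp_rw [h2]
    have e : ∀ A B : ℂ, I * (2 / Real.pi * A - (Q + 1 : ℂ)⁻¹ * (2 / Real.pi * B)) =
        2 / Real.pi * (I * A - (I * (Q + 1 : ℂ)⁻¹) * B) := fun A B => by ring
    rw [e, ← intervalIntegral.integral_const_mul, ← intervalIntegral.integral_const_mul,
      ← intervalIntegral.integral_sub]
    · congr 1
      refine intervalIntegral.integral_congr fun l _ => ?_
      have : (Q + 1 : ℂ) ≠ 0 := by exact_mod_cast Nat.succ_ne_zero Q
      simp only [symb, pow_succ]
      field_simp
    · exact (hi j _).const_mul _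
    · have := continuous_symb Q
      have := continuous_spectralWeight hQ (T.graph.dist x y)
      exact (by fun_prop : Continuous _).intervalIntegrable _ _

end HomTree

lemma natCast_rpow_eq_inv_sqrt_pow (Q n k : ℕ) :
    (Q : ℝ) ^ (-(n : ℝ) / 2 - (k : ℝ)) = (Real.sqrt Q)⁻¹ ^ (n + 2 * k) := by
  rw [Real.sqrt_eq_rpow, ← Real.rpow_neg Q.cast_nonneg, ← Real.rpow_mul_natCast Q.cast_nonneg]
  congr 1
  push_cast
  ring

lemma schKernel_eq_integral {Q : ℕ} (hQ : 2 ≤ Q) (t : ℝ) (n : ℕ) :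
    schKernel Q t n = 2 / Real.pi *
      ∫ l in (0 : ℝ)..Real.pi, exp (t * symb Q l) * spectralWeight Q n l := by
  have h := hasSum_integral_mul_sinSeries hQ n (f := fun l : ℝ =>
    exp (-I * (gammaZero Q) * t * Real.cos l) * (Real.sin l : ℂ)) (by fun_prop)
  simp only [schKernel, natCast_rpow_eq_inv_sqrt_pow]
  rw [h.tsum_eq, mul_comm (exp _), mul_assoc, ← intervalIntegral.integral_const_mul (exp _)]
  congr 1
  refine intervalIntegral.integral_congr fun l _ => ?_
  simp only [spectralWeight, symb]
  rw [mul_assoc (exp _) (Real.sin l : ℂ), ← mul_assoc (exp _), ← exp_add]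
  ring_nf

lemma norm_symb_le (Q : ℕ) (l : ℝ) : ‖symb Q l‖ ≤ 1 + |gammaZero Q| := by
  rw [symb, norm_mul, norm_I, one_mul]
  refine (norm_sub_le _ _).trans ?_
  rw [norm_one, norm_mul, norm_real, norm_real]
  gcongr
  exact mul_le_of_le_one_right (norm_nonneg _) (Real.abs_cos_le_one l)

lemma norm_integral_oscillatory_le {Q : ℕ} (hQ : 2 ≤ Q) (t : ℝ) {m : ℝ} {N : ℕ} (hm : m = N)
    (hm1 : 1 ≤ m) :
    (1 + |t|) * ‖∫ l in (0 : ℝ)..Real.pi, exp (-I * (gammaZero Q) * t * Real.cos l) *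
      (Real.sin l : ℂ) * (Real.sin (m * l) : ℂ)‖ ≤ Real.pi * (1 + (gammaZero Q)⁻¹) * m := by
  have hg := gammaZero_pos hQ
  have hπ := Real.pi_pos
  have he : ∀ l : ℝ, ‖exp (-I * (gammaZero Q) * t * Real.cos l)‖ = 1 := fun l => by
    rw [show -I * (gammaZero Q) * t * Real.cos l = ((-(gammaZero Q * t * Real.cos l) : ℝ) : ℂ) * I by
      push_cast; ring, norm_exp_ofReal_mul_I]
  set J := ∫ l in (0 : ℝ)..Real.pi, exp (-I * (gammaZero Q) * t * Real.cos l) *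
      (Real.sin l : ℂ) * (Real.sin (m * l) : ℂ) with hJ
  have h1 : ‖J‖ ≤ Real.pi := by
    have := intervalIntegral.norm_integral_le_of_norm_le_const (a := 0) (b := Real.pi) (C := 1)
      (f := fun l : ℝ => exp (-I * (gammaZero Q) * t * Real.cos l) *
        (Real.sin l : ℂ) * (Real.sin (m * l) : ℂ)) fun l _ => by
      rw [norm_mul, norm_mul, he, one_mul, norm_real, norm_real]
      exact mul_le_one₀ (Real.abs_sin_le_one l) (norm_nonneg _) (Real.abs_sin_le_one _)
    rwa [one_mul, sub_zero, abs_of_pos hπ] at this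
  have h2 : |t| * ‖J‖ ≤ Real.pi * (gammaZero Q)⁻¹ * m := by
    have hparts := intervalIntegral.integral_mul_deriv_eq_deriv_mul (a := 0) (b := Real.pi)
      (u := fun l : ℝ => (Real.sin (m * l) : ℂ)) (u' := fun l : ℝ => ((Real.cos (m * l) * m : ℝ) : ℂ))
      (v := fun l : ℝ => exp (-I * (gammaZero Q) * t * Real.cos l))
      (v' := fun l : ℝ => exp (-I * (gammaZero Q) * t * Real.cos l) *
        (-I * (gammaZero Q) * t * (-Real.sin l : ℝ)))
      (fun l _ => (((hasDerivAt_id l).const_mul m).sin.congr_deriv (by simp)).ofReal_comp)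
      (fun l _ => ((Real.hasDerivAt_cos l).ofReal_comp.const_mul _).cexp)
      ((by fun_prop : Continuous _).intervalIntegrable _ _)
      ((by fun_prop : Continuous _).intervalIntegrable _ _)
    have hl : ∫ l in (0 : ℝ)..Real.pi, (Real.sin (m * l) : ℂ) *
        (exp (-I * (gammaZero Q) * t * Real.cos l) *
          (-I * (gammaZero Q) * t * (-Real.sin l : ℝ))) = (I * gammaZero Q * t) * J := by
      rw [hJ, ← intervalIntegral.integral_const_mul]
      refine intervalIntegral.integral_congr fun l _ => ?_
      simp only [ofReal_neg]
      ring
    have hs : Real.sin (m * Real.pi) = 0 := by rw [hm]; exact Real.sin_nat_mul_pi N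
    rw [hl] at hparts
    simp only [hs, mul_zero, Real.sin_zero, ofReal_zero, zero_mul, zero_sub, sub_zero] at hparts
    have h3 := congrArg norm hparts
    have h4 := intervalIntegral.norm_integral_le_of_norm_le_const (a := 0) (b := Real.pi) (C := m)
      (f := fun l : ℝ => ((Real.cos (m * l) * m : ℝ) : ℂ) *
        exp (-I * (gammaZero Q) * t * Real.cos l)) fun l _ => by
      rw [norm_mul, he, mul_one, norm_real, norm_mul, Real.norm_of_nonneg (by linarith : 0 ≤ m)]
      exact mul_le_of_le_one_left (by linarith) (Real.abs_cos_le_one _)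
    rw [norm_neg, norm_mul, norm_mul, norm_mul, norm_I, norm_real, norm_real,
      Real.norm_of_nonneg hg.le, one_mul, Real.norm_eq_abs] at h3
    rw [← h3, sub_zero, abs_of_pos hπ] at h4
    rw [mul_right_comm, ← div_eq_mul_inv, le_div_iff₀ hg]
    linarith
  have h3 : Real.pi * 1 ≤ Real.pi * m := by gcongr
  linarith

lemma exists_norm_schKernel_le {Q : ℕ} (hQ : 2 ≤ Q) : ∃ C : ℝ, 0 ≤ C ∧ ∀ (t : ℝ) (n : ℕ),
    ‖schKernel Q t n‖ ≤ C * ((n + 1) * (Real.sqrt Q)⁻¹ ^ n) / (1 + |t|) := by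
  have hπ := Real.pi_pos
  have hg := gammaZero_pos hQ
  set σ := (Real.sqrt Q)⁻¹ with hσ
  have hσ0 : 0 ≤ σ := by positivity
  have hsum : Summable fun k : ℕ => (2 * k + 1 : ℝ) * σ ^ (2 * k) := by
    have hσ2 : ‖σ ^ 2‖ < 1 := by
      rw [Real.norm_of_nonneg (by positivity)]
      exact pow_lt_one₀ hσ0 (inv_sqrt_lt_one hQ) two_ne_zero
    have h1 := (summable_pow_mul_geometric_of_norm_lt_one 1 hσ2).mul_left 2
    have h2 := summable_geometric_of_norm_lt_one hσ2
    refine (h1.add h2).congr fun k => ?_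
    rw [pow_mul]; ring
  set S := ∑' k : ℕ, (2 * k + 1 : ℝ) * σ ^ (2 * k) with hS
  have hS0 : 0 ≤ S := tsum_nonneg fun k => by positivity
  refine ⟨2 / Real.pi * (Real.pi * (1 + (gammaZero Q)⁻¹)) * S, by positivity, fun t n => ?_⟩
  rw [le_div_iff₀ (by positivity)]
  have hterm : ∀ k : ℕ, ‖((σ ^ (n + 2 * k) : ℝ) : ℂ) *
      ∫ l in (0 : ℝ)..Real.pi, exp (-I * (gammaZero Q) * t * Real.cos l) *
        (Real.sin l : ℂ) * (Real.sin (((n : ℝ) + 2 * k + 1) * l) : ℂ)‖ ≤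
      (Real.pi * (1 + (gammaZero Q)⁻¹) * ((n + 1) * σ ^ n) / (1 + |t|)) *
        ((2 * k + 1) * σ ^ (2 * k)) := fun k => by
    have h := norm_integral_oscillatory_le hQ t (m := (n : ℝ) + 2 * k + 1) (N := n + 2 * k + 1)
      (by push_cast; rfl) (by
        have : (0 : ℝ) ≤ n := n.cast_nonneg
        have : (0 : ℝ) ≤ k := k.cast_nonneg
        linarith)
    rw [mul_comm, ← le_div_iff₀ (by positivity)] at h
    rw [norm_mul, norm_real, Real.norm_of_nonneg (by positivity)]
    calc _ ≤ σ ^ (n + 2 * k) * (Real.pi * (1 + (gammaZero Q)⁻¹) * (n + 2 * k + 1) / (1 + |t|)) := by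
          gcongr
      _ ≤ σ ^ (n + 2 * k) *
          (Real.pi * (1 + (gammaZero Q)⁻¹) * ((n + 1) * (2 * k + 1)) / (1 + |t|)) := by
          gcongr
          have : (0 : ℝ) ≤ n * k := by positivity
          linarith
      _ = _ := by rw [pow_add]; ring
  have hle := tsum_of_norm_bounded (hsum.hasSum.mul_left _) hterm
  simp only [schKernel, natCast_rpow_eq_inv_sqrt_pow]
  rw [norm_mul, norm_mul, show I * (t : ℂ) = t * I by ring, norm_exp_ofReal_mul_I, one_mul]
  have h2 : ‖(2 / Real.pi : ℂ)‖ = 2 / Real.pi := by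
    rw [norm_div, norm_real, Real.norm_of_nonneg hπ.le]; simp
  rw [h2]
  calc _ ≤ 2 / Real.pi * (Real.pi * (1 + (gammaZero Q)⁻¹) * ((n + 1) * σ ^ n) / (1 + |t|) * S) *
        (1 + |t|) := by
        gcongr
    _ = _ := by
        have : 1 + |t| ≠ 0 := by positivity
        field_simp

namespace HomTree

variable {Q : ℕ} (T : HomTree Q)

lemma U_delta (hQ : 2 ≤ Q) (t : ℝ) (x y : T.V) :
    T.U t (T.delta x) y = schKernel Q t (T.graph.dist x y) := by
  have hsymb := continuous_symb Q
  have hw := continuous_spectralWeight hQ (T.graph.dist x y)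
  rw [schKernel_eq_integral hQ]
  refine (T.hasSum_U_delta t x y).unique ?_
  simp_rw [T.gen_pow_delta hQ, mul_left_comm _ (2 / (Real.pi : ℂ)),
    ← intervalIntegral.integral_const_mul ((_ : ℂ) * _)]
  refine HasSum.mul_left _ ?_
  have hexp : ∀ r : ℝ, HasSum (fun j : ℕ => r ^ j / j.factorial) (Real.exp r) := fun r => by
    rw [Real.exp_eq_exp_ℝ]; exact NormedSpace.expSeries_div_hasSum_exp r
  refine intervalIntegral.hasSum_integral_of_dominated_convergence
    (fun j l => (|t| * (1 + |gammaZero Q|)) ^ j / j.factorial *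
      ‖spectralWeight Q (T.graph.dist x y) l‖)
    (fun k => (by fun_prop : Continuous _).aestronglyMeasurable)
    (fun k => .of_forall fun l _ => ?_)
    (.of_forall fun l _ => (hexp _).summable.mul_right _) ?_ (.of_forall fun l _ => ?_)
  · rw [← mul_assoc, norm_mul, norm_mul, norm_mul, norm_pow, norm_pow, norm_inv, norm_real,
      Complex.norm_natCast, Real.norm_eq_abs]
    have := norm_symb_le Q l
    rw [mul_pow, div_eq_inv_mul, mul_assoc (k.factorial : ℝ)⁻¹]
    gcongr
  · simp_rw [tsum_mul_right]
    exact (by fun_prop : Continuous _).intervalIntegrable _ _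
  · have h1 : HasSum (fun j : ℕ => (t * symb Q l) ^ j / j.factorial) (exp (t * symb Q l)) := by
      rw [Complex.exp_eq_exp_ℂ]; exact NormedSpace.expSeries_div_hasSum_exp _
    refine Eq.mp (congrArg (HasSum · _) (funext fun j => ?_)) (h1.mul_right _)
    rw [mul_pow, div_eq_inv_mul]
    ring

lemma U_delta_comm (t : ℝ) (x y : T.V) :
    (starRingEnd ℂ) (T.U (-t) (T.delta x) y) = T.U t (T.delta y) x := by
  rw [← inner_delta_right, inner_U_left, neg_neg, inner_delta_left]

lemma hasSum_U (hQ : 2 ≤ Q) (t : ℝ) (g : T.L2) (x : T.V) :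
    HasSum (fun y => schKernel Q t (T.graph.dist x y) * g y) (T.U t g x) := by
  have h := lp.hasSum_inner (𝕜 := ℂ) (T.U (-t) (T.delta x)) g
  rw [inner_U_left, neg_neg, inner_delta_left] at h
  refine Eq.mp (congrArg (HasSum · _) (funext fun y => ?_)) h
  rw [RCLike.inner_apply, U_delta_comm, U_delta T hQ, SimpleGraph.dist_comm, mul_comm]

lemma propagate_eq (hQ : 2 ≤ Q) (t : ℝ) (g : T.L2) (x : T.V) :
    propagate T t g x = T.U t g x := by
  have h := (T.hasSum_U hQ t g x).tsum_fiberwise (T.graph.dist x)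
  rw [propagate, ← h.tsum_eq]
  refine tsum_congr fun n => ?_
  rw [sphereSum, ← tsum_mul_left]
  refine tsum_congr fun y => ?_
  rw [show T.graph.dist x y = n from y.2]

end HomTree

/-- The decay profile of the dispersive estimate. -/
def decay (A t : ℝ) : ℝ≥0∞ := ENNReal.ofReal (A / (1 + |t|))

lemma decay_le {A : ℝ} (hA : 0 ≤ A) (t : ℝ) : decay A t ≤ ENNReal.ofReal A := by
  refine ENNReal.ofReal_le_ofReal (div_le_self hA ?_)
  linarith [abs_nonneg t]

lemma measurable_decay (A : ℝ) : Measurable (decay A) := by unfold decay; fun_prop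

lemma decay_neg (A t : ℝ) : decay A (-t) = decay A t := by simp [decay]

lemma lintegral_decay_rpow_lt_top {A p : ℝ} (hA : 0 ≤ A) (hp : 2 < p) :
    ∫⁻ t, decay A t ^ (p / 2) < ∞ := by
  have h : ∀ t, decay A t ^ (p / 2) =
      ENNReal.ofReal (A ^ (p / 2)) * ENNReal.ofReal ((1 + ‖t‖) ^ (-(p / 2))) := fun t => by
    have h1 : 0 ≤ 1 + |t| := by positivity
    rw [decay, ENNReal.ofReal_rpow_of_nonneg (by positivity) (by linarith),
      ← ENNReal.ofReal_mul (by positivity), Real.div_rpow hA h1, Real.norm_eq_abs,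
      Real.rpow_neg h1, div_eq_mul_inv]
  simp_rw [h]
  rw [lintegral_const_mul _ (by fun_prop)]
  refine ENNReal.mul_lt_top ENNReal.ofReal_lt_top (finite_integral_one_add_norm ?_)
  simp; linarith

/-- Young's inequality in trilinear form. -/
lemma lintegral_young {κ g h : ℝ → ℝ≥0∞} (hκ : Measurable κ) (hκn : ∀ t, κ (-t) = κ t) {S : Set ℝ}
    (hg : AEMeasurable g (volume.restrict S)) (hh : AEMeasurable h (volume.restrict S))
    {p r : ℝ} (hp : 2 < p) (hr : p.HolderConjugate r) :
    ∫⁻ t in S, ∫⁻ s in S, κ (t - s) * g s * h t ≤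
      (∫⁻ t, κ t ^ (p / 2)) ^ (2 / p) *
        ((∫⁻ s in S, g s ^ r) ^ (1 / r) * (∫⁻ t in S, h t ^ r) ^ (1 / r)) := by
  set μ := volume.restrict S with hμ
  have hp0 : 0 < p := by linarith
  have hr0 := hr.symm.pos
  have hinv := hr.inv_add_inv_eq_one
  have hg2 : AEMeasurable (fun z : ℝ × ℝ => g z.2) (μ.prod μ) := hg.comp_snd
  have hh2 : AEMeasurable (fun z : ℝ × ℝ => h z.1) (μ.prod μ) := hh.comp_fst
  have hκ2 : Measurable (fun z : ℝ × ℝ => κ (z.1 - z.2)) := by fun_prop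
  set f : Fin 3 → ℝ × ℝ → ℝ≥0∞ := ![fun z => κ (z.1 - z.2) ^ (p / 2) * g z.2 ^ r,
    fun z => κ (z.1 - z.2) ^ (p / 2) * h z.1 ^ r, fun z => h z.1 ^ r * g z.2 ^ r] with hf
  have hfm : ∀ i, AEMeasurable (f i) (μ.prod μ) := by
    intro i
    fin_cases i
    · exact (hκ2.pow_const _).aemeasurable.mul (hg2.pow_const _)
    · exact (hκ2.pow_const _).aemeasurable.mul (hh2.pow_const _)
    · exact (hh2.pow_const _).mul (hg2.pow_const _)
  set e : Fin 3 → ℝ := ![1 / p, 1 / p, 1 - 2 / p] with he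
  have he0 : 0 ≤ 1 - 2 / p := by
    rw [sub_nonneg, div_le_one hp0]; exact hp.le
  have hold := ENNReal.lintegral_prod_norm_pow_le (μ := μ.prod μ) Finset.univ (f := f)
    (fun i _ => hfm i) (p := e) (by simp [he, Fin.sum_univ_three]; ring) (by
      intro i _
      fin_cases i
      · simp [he]; positivity
      · simp [he]; positivity
      · exact he0)
  simp only [Fin.prod_univ_three, hf, he, Matrix.cons_val_zero, Matrix.cons_val_one,
    Matrix.cons_val_two, Matrix.head_cons, Matrix.tail_cons] at hold
  set K := ∫⁻ t, κ t ^ (p / 2) with hK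
  have hKle : ∀ s, ∫⁻ t, κ (t - s) ^ (p / 2) ∂μ ≤ K := fun s =>
    (lintegral_mono' Measure.restrict_le_self le_rfl).trans
      (lintegral_sub_right_eq_self (fun t => κ t ^ (p / 2)) s).le
  have i1 : ∫⁻ z, κ (z.1 - z.2) ^ (p / 2) * g z.2 ^ r ∂(μ.prod μ) ≤ K * ∫⁻ s, g s ^ r ∂μ := by
    rw [lintegral_prod_symm _ (show AEMeasurable (fun z : ℝ × ℝ => κ (z.1 - z.2) ^ (p / 2) *
      g z.2 ^ r) (μ.prod μ) from hfm 0), ← lintegral_const_mul'' _ (hg.pow_const _)]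
    refine lintegral_mono fun s => ?_
    dsimp only
    rw [lintegral_mul_const _ (by fun_prop)]
    gcongr
    exact hKle s
  have i2 : ∫⁻ z, κ (z.1 - z.2) ^ (p / 2) * h z.1 ^ r ∂(μ.prod μ) ≤ K * ∫⁻ s, h s ^ r ∂μ := by
    rw [lintegral_prod _ (show AEMeasurable (fun z : ℝ × ℝ => κ (z.1 - z.2) ^ (p / 2) *
      h z.1 ^ r) (μ.prod μ) from hfm 1), ← lintegral_const_mul'' _ (hh.pow_const _)]
    refine lintegral_mono fun t => ?_
    dsimp only
    rw [lintegral_mul_const _ (by fun_prop)]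
    gcongr
    refine le_trans (le_of_eq (lintegral_congr fun s => ?_)) (hKle t)
    rw [← hκn, neg_sub]
  have i3 : ∫⁻ z, h z.1 ^ r * g z.2 ^ r ∂(μ.prod μ) = (∫⁻ s, h s ^ r ∂μ) * ∫⁻ s, g s ^ r ∂μ :=
    lintegral_prod_mul (hh.pow_const _) (hg.pow_const _)
  have hexp : r / p + r * (1 - 2 / p) = 1 := by
    have : r * (1 - 1 / p) = 1 := by
      rw [show 1 - 1 / p = r⁻¹ by rw [one_div]; linarith, mul_inv_cancel₀ hr0.ne']
    linear_combination this
  have hrr : 1 / r = 1 / p + (1 - 2 / p) := by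
    rw [one_div, one_div, div_eq_mul_inv]; linarith
  have hsplit : ∀ c : ℝ≥0∞, c = (c ^ r) ^ (1 / p) * (c ^ r) ^ (1 - 2 / p) := fun c => by
    rw [← ENNReal.rpow_mul, ← ENNReal.rpow_mul,
      ← ENNReal.rpow_add_of_nonneg _ _ (by positivity) (mul_nonneg hr0.le he0), mul_one_div, hexp,
      ENNReal.rpow_one]
  calc ∫⁻ t, ∫⁻ s, κ (t - s) * g s * h t ∂μ ∂μ
      = ∫⁻ z, κ (z.1 - z.2) * g z.2 * h z.1 ∂(μ.prod μ) := by
        rw [lintegral_prod]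
        exact (hκ2.aemeasurable.mul hg2).mul hh2
    _ = ∫⁻ z, (κ (z.1 - z.2) ^ (p / 2) * g z.2 ^ r) ^ (1 / p) *
          (κ (z.1 - z.2) ^ (p / 2) * h z.1 ^ r) ^ (1 / p) *
          (h z.1 ^ r * g z.2 ^ r) ^ (1 - 2 / p) ∂(μ.prod μ) := by
        refine lintegral_congr fun z => ?_
        rw [ENNReal.mul_rpow_of_nonneg _ _ (by positivity), ENNReal.mul_rpow_of_nonneg _ _ (by positivity),
          ENNReal.mul_rpow_of_nonneg _ _ he0]
        have hkk : (κ (z.1 - z.2) ^ (p / 2)) ^ (1 / p) * (κ (z.1 - z.2) ^ (p / 2)) ^ (1 / p) =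
            κ (z.1 - z.2) := by
          rw [← ENNReal.rpow_mul, ← ENNReal.rpow_add_of_nonneg _ _ (by positivity) (by positivity)]
          rw [show p / 2 * (1 / p) + p / 2 * (1 / p) = 1 by field_simp; norm_num, ENNReal.rpow_one]
        calc _ = ((κ (z.1 - z.2) ^ (p / 2)) ^ (1 / p) * (κ (z.1 - z.2) ^ (p / 2)) ^ (1 / p)) *
              ((g z.2 ^ r) ^ (1 / p) * (g z.2 ^ r) ^ (1 - 2 / p)) *
              ((h z.1 ^ r) ^ (1 / p) * (h z.1 ^ r) ^ (1 - 2 / p)) := by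
              rw [hkk, ← hsplit, ← hsplit]
          _ = _ := by ring
    _ ≤ _ := hold
    _ ≤ (K * ∫⁻ s, g s ^ r ∂μ) ^ (1 / p) * (K * ∫⁻ s, h s ^ r ∂μ) ^ (1 / p) *
        ((∫⁻ s, h s ^ r ∂μ) * ∫⁻ s, g s ^ r ∂μ) ^ (1 - 2 / p) := by
        rw [i3]
        gcongr
    _ = _ := by
        rw [ENNReal.mul_rpow_of_nonneg _ _ (by positivity), ENNReal.mul_rpow_of_nonneg _ _ (by positivity),
          ENNReal.mul_rpow_of_nonneg _ _ he0, hrr,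
          ENNReal.rpow_add_of_nonneg _ _ (by positivity) he0,
          ENNReal.rpow_add_of_nonneg _ _ (by positivity) he0,
          show (2 : ℝ) / p = 1 / p + 1 / p by ring,
          ENNReal.rpow_add_of_nonneg _ _ (by positivity) (by positivity)]
        ring

namespace HomTree

variable {Q : ℕ} (T : HomTree Q)

variable {T} in
/-- The `ℓ^q` norm of an `ℓ²` vector. -/
def lq (q : ℝ) (g : T.L2) : ℝ≥0∞ := ell q (fun x => ‖g x‖ₑ)

lemma exists_dispersive (hQ : 2 ≤ Q) {a r : ℝ} (ha : 2 < a) (hr : a.HolderConjugate r) :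
    ∃ A : ℝ, 0 ≤ A ∧ ∀ (t : ℝ) (g h : T.L2),
      ‖inner ℂ h (T.U t g)‖ₑ ≤ decay A t * (lq r g * lq r h) := by
  obtain ⟨C, hC, hker⟩ := exists_norm_schKernel_le hQ
  have ha0 : 0 < a := by linarith
  have hs1 : 0 < Real.sqrt Q := by positivity
  set σ := (Real.sqrt Q)⁻¹ with hσ
  have hσ0 : 0 < σ := by positivity
  set ρ := σ ^ (1 - 2 / a) with hρ
  have h2a : 2 / a < 1 := (div_lt_one ha0).2 ha
  have hρ1 : ‖ρ‖ < 1 := by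
    rw [Real.norm_of_nonneg (by positivity)]
    exact Real.rpow_lt_one hσ0.le (inv_sqrt_lt_one hQ) (by linarith)
  have hsum : Summable fun n : ℕ => ((n : ℝ) + 1) ^ 2 * ρ ^ n := by
    have h1 := summable_pow_mul_geometric_of_norm_lt_one 2 hρ1
    have h2 := (summable_pow_mul_geometric_of_norm_lt_one 1 hρ1).mul_left 2
    have h3 := summable_geometric_of_norm_lt_one hρ1
    exact ((h1.add h2).add h3).congr fun n => by ring
  set S := ∑' n : ℕ, ((n : ℝ) + 1) ^ 2 * ρ ^ n with hS
  have hterm : ∀ n : ℕ, ((n + 1) * σ ^ n) * ((n + 1) * Real.sqrt Q ^ n) ^ (2 / a) ≤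
      ((n : ℝ) + 1) ^ 2 * ρ ^ n := fun n => by
    rw [Real.mul_rpow (by positivity) (by positivity)]
    have e1 : ((n : ℝ) + 1) ^ (2 / a) ≤ (n : ℝ) + 1 := by
      conv_rhs => rw [← Real.rpow_one ((n : ℝ) + 1)]
      exact Real.rpow_le_rpow_of_exponent_le (by linarith [n.cast_nonneg (α := ℝ)]) h2a.le
    have e2 : σ ^ n * (Real.sqrt Q ^ n) ^ (2 / a) = ρ ^ n := by
      have : Real.sqrt Q = σ⁻¹ := by rw [hσ, inv_inv]
      clear_value σ
      rw [this, inv_pow, Real.inv_rpow (by positivity), ← Real.rpow_natCast_mul hσ0.le, hρ,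
        ← Real.rpow_mul_natCast hσ0.le, ← Real.rpow_natCast, ← Real.rpow_neg hσ0.le,
        ← Real.rpow_add hσ0]
      congr 1
      ring
    calc _ = ((n : ℝ) + 1) * ((n : ℝ) + 1) ^ (2 / a) * (σ ^ n * (Real.sqrt Q ^ n) ^ (2 / a)) := by
          ring
      _ ≤ ((n : ℝ) + 1) * ((n : ℝ) + 1) * (σ ^ n * (Real.sqrt Q ^ n) ^ (2 / a)) := by gcongr
      _ = _ := by rw [e2]; ring
  refine ⟨C * S, mul_nonneg hC (tsum_nonneg fun n => by positivity), fun t g h => ?_⟩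
  have hrad := T.radial_bilin hQ ha hr (fun n => ‖schKernel Q t n‖ₑ) (fun y => ‖g y‖ₑ)
    (fun x => ‖h x‖ₑ)
  have hinner : ‖inner ℂ h (T.U t g)‖ₑ ≤
      ∑' x, ∑' y, ‖schKernel Q t (T.graph.dist x y)‖ₑ * (‖g y‖ₑ * ‖h x‖ₑ) := by
    rw [lp.inner_eq_tsum]
    refine enorm_tsum_le_tsum_enorm.trans ?_
    gcongr with x
    rw [← (T.hasSum_U hQ t g x).tsum_eq, RCLike.inner_apply, enorm_mul, RCLike.enorm_conj]
    simp_rw [← mul_assoc]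
    rw [ENNReal.tsum_mul_right]
    gcongr
    refine enorm_tsum_le_tsum_enorm.trans (le_of_eq ?_)
    simp_rw [enorm_mul]
  refine hinner.trans (hrad.trans ?_)
  refine mul_le_mul_left ?_ _
  calc ∑' n, ‖schKernel Q t n‖ₑ * ENNReal.ofReal (sphereEig Q n) ^ (2 / a)
      ≤ ∑' n : ℕ, ENNReal.ofReal (C / (1 + |t|) * (((n : ℝ) + 1) ^ 2 * ρ ^ n)) := by
        gcongr with n
        rw [← ofReal_norm, ENNReal.ofReal_rpow_of_nonneg (sphereEig_nonneg hQ n) (by positivity),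
          ← ENNReal.ofReal_mul (norm_nonneg _)]
        refine ENNReal.ofReal_le_ofReal ?_
        calc _ ≤ (C * ((n + 1) * σ ^ n) / (1 + |t|)) * ((n + 1) * Real.sqrt Q ^ n) ^ (2 / a) := by
              have := sphereEig_nonneg hQ n
              gcongr
              · exact hker t n
              · exact sphereEig_le hQ n
          _ = C / (1 + |t|) * (((n + 1) * σ ^ n) * ((n + 1) * Real.sqrt Q ^ n) ^ (2 / a)) := by ring
          _ ≤ _ := by gcongr ?_ * ?_; exact hterm n
    _ = decay (C * S) t := by
        rw [← ENNReal.ofReal_tsum_of_nonneg (fun n => by positivity) (hsum.mul_left _),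
          tsum_mul_left, decay]
        congr 1
        ring

end HomTree

lemma ENNReal.rpow_le_of_le_mul_rpow {p r : ℝ} (hr : p.HolderConjugate r) {x c : ℝ≥0∞} (hx : x ≠ ∞)
    (h : x ≤ c * x ^ (1 / r)) : x ^ (1 / p) ≤ c := by
  have hp0 := hr.pos
  rcases eq_or_ne x 0 with rfl | h0
  · rw [ENNReal.zero_rpow_of_pos (by positivity)]; exact zero_le
  have hk0 : x ^ (1 / r) ≠ 0 := (ENNReal.rpow_pos (pos_iff_ne_zero.2 h0) hx).ne'
  have hkt : x ^ (1 / r) ≠ ∞ := ENNReal.rpow_ne_top_of_nonneg (by have := hr.symm.pos; positivity) hx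
  have hx1 : x = x ^ (1 / p) * x ^ (1 / r) := by
    rw [← ENNReal.rpow_add _ _ h0 hx, one_div, one_div, hr.inv_add_inv_eq_one, ENNReal.rpow_one]
  nth_rewrite 1 [hx1] at h
  exact (ENNReal.mul_le_mul_iff_left hk0 hkt).1 h

namespace HomTree

variable {Q : ℕ} (T : HomTree Q)

lemma hasSum_smul_delta (g : T.L2) : HasSum (fun x => g x • T.delta x) g := by
  classical
  have h := lp.hasSum_single (p := 2) (by simp) g
  refine Eq.mp (congrArg (HasSum · _) (funext fun x => ?_)) h
  ext y
  rw [lp.coeFn_smul, Pi.smul_apply, delta_apply, lp.single_apply, Pi.single_apply]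
  by_cases hxy : y = x
  · subst hxy; simp
  · simp [hxy, Ne.symm hxy]

section Measurability

variable {T} {Ω : Type*} [MeasurableSpace Ω] {μ : Measure Ω} {G : Ω → T.L2}

lemma aestronglyMeasurable_coord (hG : AEStronglyMeasurable G μ) (x : T.V) :
    AEStronglyMeasurable (fun t => G t x) μ := by
  refine ((innerSL ℂ (T.delta x)).continuous.comp_aestronglyMeasurable hG).congr
    (ae_of_all _ fun t => ?_)
  exact T.inner_delta_left x (G t)

lemma aestronglyMeasurable_of_coord (h : ∀ x, AEStronglyMeasurable (fun t => G t x) μ) :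
    AEStronglyMeasurable G μ :=
  aestronglyMeasurable_of_tendsto_ae atTop
    (fun s : Finset T.V => Finset.aestronglyMeasurable_fun_sum s fun x _ =>
      (h x).smul (aestronglyMeasurable_const (b := T.delta x)))
    (ae_of_all _ fun t => T.hasSum_smul_delta (G t))

lemma aemeasurable_lq (hG : AEStronglyMeasurable G μ) (q : ℝ) :
    AEMeasurable (fun t => lq q (G t)) μ :=
  (AEMeasurable.tsum fun x =>
    (aestronglyMeasurable_coord hG x).enorm.pow_const q).pow_const _

end Measurability

lemma lq_le_enorm {a : ℝ} (ha : 2 ≤ a) (w : T.L2) : lq a w ≤ ‖w‖ₑ := by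
  rw [enorm_eq_ell]
  exact ell_anti two_pos ha _

lemma lq_ne_top {a : ℝ} (ha : 2 ≤ a) (w : T.L2) : lq a w ≠ ∞ :=
  ne_top_of_le_ne_top enorm_ne_top (T.lq_le_enorm ha w)

lemma exists_dual {a r : ℝ} (ha : 2 ≤ a) (hr : a.HolderConjugate r) :
    ∃ D : T.L2 → T.L2, (∀ w, inner ℂ (D w) w = ((lq a w).toReal : ℂ)) ∧ (∀ w, lq r (D w) ≤ 1) ∧
      (∀ w, ‖D w‖ₑ ≤ 1) ∧ ∀ w x, D w x =
        (((lq a w).toReal ^ (1 - a) * ‖w x‖ ^ (a - 2) : ℝ) : ℂ) * w x := by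
  have ha0 : 0 < a := by linarith
  have hr0 := hr.symm.pos
  have hra : r * (a - 1) = a := by
    have := hr.mul_eq_add; linarith
  have hr2 : r ≤ 2 := by nlinarith
  set d : T.L2 → T.V → ℂ := fun w x =>
    (((lq a w).toReal ^ (1 - a) * ‖w x‖ ^ (a - 2) : ℝ) : ℂ) * w x with hd
  have hlq0 : ∀ w : T.L2, lq a w = 0 → ∀ x, w x = 0 := fun w h x => by
    have := le_ell ha0 (fun x => ‖w x‖ₑ) x
    rw [show ell a (fun x => ‖w x‖ₑ) = 0 from h] at this
    simpa using this
  have hnorm : ∀ w x, ‖d w x‖ = (lq a w).toReal ^ (1 - a) * ‖w x‖ ^ (a - 1) := fun w x => by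
    rw [hd, norm_mul, Complex.norm_real, Real.norm_of_nonneg (by positivity), mul_assoc]
    congr 1
    rcases eq_or_ne (w x) 0 with h | h
    · rw [h, norm_zero, mul_zero, Real.zero_rpow (by linarith)]
    · rw [← Real.rpow_add_one (norm_ne_zero_iff.2 h)]; congr 1; ring
  have henorm : ∀ w : T.L2, lq a w ≠ 0 → ∀ x, ‖d w x‖ₑ ^ r = lq a w ^ (-a) * ‖w x‖ₑ ^ a := by
    intro w h x
    have hN : 0 < (lq a w).toReal := ENNReal.toReal_pos h (T.lq_ne_top ha w)
    rw [← ofReal_norm, hnorm, ENNReal.ofReal_rpow_of_nonneg (by positivity) hr0.le,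
      Real.mul_rpow (by positivity) (by positivity), ← Real.rpow_mul hN.le,
      ← Real.rpow_mul (norm_nonneg _), ENNReal.ofReal_mul (by positivity),
      ← ENNReal.ofReal_rpow_of_pos hN, ENNReal.ofReal_toReal (T.lq_ne_top ha w),
      ← ENNReal.ofReal_rpow_of_nonneg (norm_nonneg _) (by nlinarith), ofReal_norm]
    congr 2 <;> linarith
  have hell : ∀ w : T.L2, ell r (fun x => ‖d w x‖ₑ) ≤ 1 := fun w => by
    rw [← ENNReal.rpow_le_rpow_iff hr0, ell_rpow hr0, ENNReal.one_rpow]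
    rcases eq_or_ne (lq a w) 0 with h | h
    · have : ∀ x, d w x = 0 := fun x => by simp [hd, hlq0 w h x]
      simp [this, hr0]
    · simp_rw [henorm w h]
      rw [ENNReal.tsum_mul_left, ← ell_rpow ha0]
      change lq a w ^ (-a) * lq a w ^ a ≤ 1
      rw [← ENNReal.rpow_add _ _ h (T.lq_ne_top ha w)]
      simp
  have h2 : ∀ w : T.L2, ell 2 (fun x => ‖d w x‖ₑ) ≤ 1 := fun w =>
    (ell_anti hr0 hr2 _).trans (hell w)
  refine ⟨fun w => T.toL2 (d w) (ne_top_of_le_ne_top ENNReal.one_ne_top (h2 w)), fun w => ?_, hell,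
    fun w => by rw [enorm_eq_ell]; exact h2 w, fun w x => rfl⟩
  have hterm : ∀ x, inner ℂ (d w x) (w x) =
      (((lq a w).toReal ^ (1 - a) * ‖w x‖ ^ a : ℝ) : ℂ) := fun x => by
    rw [hd, RCLike.inner_apply, map_mul, Complex.conj_ofReal, mul_left_comm, Complex.mul_conj']
    rw [← ofReal_pow, ← ofReal_mul, mul_assoc]
    congr 2
    rcases eq_or_ne (w x) 0 with h | h
    · rw [h, norm_zero, Real.zero_rpow ha0.ne']; simp
    · rw [← Real.rpow_add_natCast (norm_ne_zero_iff.2 h)]; congr 1; push_cast; ring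
  rw [lp.inner_eq_tsum]
  simp only [toL2_apply, hterm]
  rw [← Complex.ofReal_tsum, tsum_mul_left]
  congr 1
  have hN : ∑' x, ‖w x‖ ^ a = (lq a w).toReal ^ a := by
    rw [ENNReal.toReal_rpow, lq, ell_rpow ha0, ENNReal.tsum_toReal_eq fun x => by finiteness]
    refine tsum_congr fun x => ?_
    rw [← ENNReal.toReal_rpow, toReal_enorm]
  rw [hN]
  rcases eq_or_ne (lq a w).toReal 0 with h | h
  · rw [h, Real.zero_rpow ha0.ne', mul_zero]
  · rw [← Real.rpow_add (ENNReal.toReal_nonneg.lt_of_ne' h)]; simp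

lemma integrable_U {μ : Measure ℝ} {G : ℝ → T.L2} (hG : Integrable G μ) (φ : ℝ → ℝ)
    (hφ : Continuous φ) : Integrable (fun s => T.U (φ s) (G s)) μ := by
  refine hG.norm.mono' ?_ (ae_of_all _ fun s => (T.norm_U _ _).le)
  exact (ContinuousLinearMap.id ℂ _).aestronglyMeasurable_comp₂
    (T.continuous_U.comp hφ).aestronglyMeasurable hG.1

variable {T} in
/-- The dispersive estimate with decay constant `A` and spatial exponent `r`. -/
def Dispersive (T : HomTree Q) (A r : ℝ) : Prop :=
  ∀ (t : ℝ) (g h : T.L2), ‖inner ℂ h (T.U t g)‖ₑ ≤ decay A t * (lq r g * lq r h)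

/-- The constant of the Strichartz estimates. -/
def strichartzConst (A p : ℝ) : ℝ≥0∞ := (∫⁻ t, decay A t ^ (p / 2)) ^ (1 / p)

lemma strichartzConst_ne_top {A p : ℝ} (hA : 0 ≤ A) (hp : 2 < p) : strichartzConst A p ≠ ∞ :=
  ENNReal.rpow_ne_top_of_nonneg (by positivity) (lintegral_decay_rpow_lt_top hA hp).ne

lemma strichartzConst_sq (A p : ℝ) :
    (∫⁻ t, decay A t ^ (p / 2)) ^ (2 / p) = strichartzConst A p ^ 2 := by
  rw [strichartzConst, ← ENNReal.rpow_natCast, ← ENNReal.rpow_mul]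
  congr 1
  push_cast
  ring

variable {T} {A a r p p' : ℝ}

lemma enorm_inner_comm (v w : T.L2) : ‖inner ℂ v w‖ₑ = ‖inner ℂ w v‖ₑ := by
  rw [← ofReal_norm, norm_inner_symm, ofReal_norm]

lemma enorm_inner_le (v w : T.L2) : ‖inner ℂ v w‖ₑ ≤ ‖v‖ₑ * ‖w‖ₑ := by
  rw [← ofReal_norm, ← ofReal_norm, ← ofReal_norm, ← ENNReal.ofReal_mul (norm_nonneg _)]
  exact ENNReal.ofReal_le_ofReal (norm_inner_le_norm _ _)

lemma enorm_integral_U_neg_le (hd : Dispersive T A r) (hp : 2 < p) (hp' : p.HolderConjugate p')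
    {S : Set ℝ} {G : ℝ → T.L2} (hG : IntegrableOn G S) :
    ‖∫ s in S, T.U (-s) (G s)‖ₑ ≤
      strichartzConst A p * (∫⁻ s in S, lq r (G s) ^ p') ^ (1 / p') := by
  set y := ∫ s in S, T.U (-s) (G s) with hy
  have hi := T.integrable_U hG _ continuous_neg
  have h1 : ∀ c : T.L2, ‖inner ℂ c y‖ₑ ≤ ∫⁻ s in S, ‖inner ℂ c (T.U (-s) (G s))‖ₑ := fun c => by
    rw [hy, ← integral_inner hi]
    exact enorm_integral_le_lintegral_enorm _
  have hm := aemeasurable_lq hG.1 r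
  rw [← ENNReal.pow_le_pow_left_iff two_ne_zero, mul_pow, ← strichartzConst_sq A p, sq (_ ^ (1 / p'))]
  calc ‖y‖ₑ ^ 2 = ‖inner ℂ y y‖ₑ := by
        rw [inner_self_eq_norm_sq_to_K, ← ofReal_norm, ← ofReal_norm,
          ← ENNReal.ofReal_pow (norm_nonneg _)]
        simp
    _ ≤ ∫⁻ s in S, ‖inner ℂ y (T.U (-s) (G s))‖ₑ := h1 y
    _ ≤ ∫⁻ s in S, ∫⁻ t in S, ‖inner ℂ (T.U (-s) (G s)) (T.U (-t) (G t))‖ₑ := by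
        gcongr with s
        rw [enorm_inner_comm]
        exact h1 _
    _ ≤ ∫⁻ s in S, ∫⁻ t in S, decay A (s - t) * lq r (G t) * lq r (G s) := by
        gcongr with s t
        rw [inner_U_left, ← U_add_apply, neg_neg, ← sub_eq_add_neg, mul_assoc]
        exact hd _ _ _
    _ ≤ _ := lintegral_young (measurable_decay A) (decay_neg A) hm hm hp hp'

/-- The homogeneous Strichartz estimate. -/
lemma lintegral_lq_U_le (hd : Dispersive T A r) (ha : 2 ≤ a) (hr : a.HolderConjugate r)
    (hp : 2 < p) (hp' : p.HolderConjugate p') {S : Set ℝ} (hS : volume S ≠ ∞) (f : T.L2) :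
    (∫⁻ t in S, lq a (T.U t f) ^ p) ^ (1 / p) ≤ strichartzConst A p * ‖f‖ₑ := by
  obtain ⟨D, hD, hDr, hD2, hDx⟩ := T.exists_dual ha hr
  have hp0 : 0 < p := by linarith
  have hp'0 := hp'.symm.pos
  have hle : ∀ t, lq a (T.U t f) ≤ ‖f‖ₑ := fun t => by
    refine (T.lq_le_enorm ha _).trans (le_of_eq ?_)
    rw [← ofReal_norm, norm_U, ofReal_norm]
  have hUm : AEStronglyMeasurable (fun t => T.U t f) (volume.restrict S) :=
    (by have := T.continuous_U; fun_prop : Continuous fun t => T.U t f).aestronglyMeasurable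
  have hm := (aemeasurable_lq hUm a)
  set φ : ℝ → ℝ := fun t => (lq a (T.U t f)).toReal ^ (p - 1) with hφ
  have hφb : ∀ t, φ t ≤ ‖f‖ ^ (p - 1) := fun t => by
    refine Real.rpow_le_rpow ENNReal.toReal_nonneg ?_ (by linarith)
    rw [← toReal_enorm]
    exact ENNReal.toReal_mono enorm_ne_top (hle t)
  have hφ0 : ∀ t, 0 ≤ φ t := fun t => by positivity
  set G : ℝ → T.L2 := fun t => (φ t : ℂ) • D (T.U t f) with hG
  have hDm : AEStronglyMeasurable G (volume.restrict S) := by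
    refine AEStronglyMeasurable.smul (Complex.measurable_ofReal.comp_aemeasurable
      (hm.ennreal_toReal.pow_const _)).aestronglyMeasurable (aestronglyMeasurable_of_coord fun x => ?_)
    simp only [hDx]
    have := aestronglyMeasurable_coord hUm x
    refine AEStronglyMeasurable.mul ?_ this
    exact (Complex.measurable_ofReal.comp_aemeasurable ((hm.ennreal_toReal.pow_const _).mul
      (this.norm.aemeasurable.pow_const _))).aestronglyMeasurable
  have hfin : IsFiniteMeasure (volume.restrict S) := ⟨by simpa using hS.lt_top⟩
  have hGi : IntegrableOn G S := by
    refine Integrable.mono' (integrable_const (‖f‖ ^ (p - 1))) hDm (ae_of_all _ fun t => ?_)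
    rw [hG, norm_smul, Complex.norm_real, Real.norm_of_nonneg (hφ0 t)]
    have : ‖D (T.U t f)‖ ≤ 1 := by
      rw [← toReal_enorm]; exact ENNReal.toReal_le_of_le_ofReal zero_le_one (by simpa using hD2 _)
    calc _ ≤ ‖f‖ ^ (p - 1) * 1 := mul_le_mul (hφb t) this (norm_nonneg _) (by positivity)
      _ = _ := mul_one _
  set X := ∫⁻ t in S, lq a (T.U t f) ^ p with hX
  have hXt : X ≠ ∞ := by
    refine ne_top_of_le_ne_top ?_ (lintegral_mono fun t => ENNReal.rpow_le_rpow (hle t) hp0.le)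
    rw [lintegral_const]
    finiteness
  have hlqG : ∀ t, lq r (G t) ≤ lq a (T.U t f) ^ (p - 1) := fun t => by
    have : lq r (G t) = ‖(φ t : ℂ)‖ₑ * lq r (D (T.U t f)) := by
      rw [lq, lq, ← ell_const_mul hr.symm.pos]
      simp only [hG, lp.coeFn_smul, Pi.smul_apply, smul_eq_mul, enorm_mul]
    rw [this, ← ofReal_norm, Complex.norm_real, Real.norm_of_nonneg (hφ0 t), hφ,
      ← ENNReal.ofReal_rpow_of_nonneg ENNReal.toReal_nonneg (by linarith),
      ENNReal.ofReal_toReal (T.lq_ne_top ha _)]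
    exact mul_le_of_le_one_right' (hDr _)
  have hpp : (p - 1) * p' = p := by have := hp'.mul_eq_add; linarith
  refine ENNReal.rpow_le_of_le_mul_rpow hp' hXt ?_
  calc X = ‖∫ t in S, inner ℂ (T.U t f) (G t)‖ₑ := by
        have e1 : ∀ t, inner ℂ (T.U t f) (G t) = (((lq a (T.U t f)).toReal ^ p : ℝ) : ℂ) := fun t => by
          rw [hG, inner_smul_right, ← inner_conj_symm, hD, Complex.conj_ofReal, ← ofReal_mul, hφ]
          congr 1
          rcases eq_or_ne (lq a (T.U t f)).toReal 0 with h | h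
          · simp [h, hp0.ne']
          · rw [← Real.rpow_add_one h]; congr 1; ring
        simp only [e1]
        rw [integral_complex_ofReal, ← ofReal_norm, Complex.norm_real, Real.norm_of_nonneg
          (integral_nonneg fun t => by positivity), ofReal_integral_eq_lintegral_ofReal]
        · refine lintegral_congr fun t => ?_
          rw [← ENNReal.ofReal_rpow_of_nonneg ENNReal.toReal_nonneg hp0.le,
            ENNReal.ofReal_toReal (T.lq_ne_top ha _)]
        · refine Integrable.mono' (integrable_const (‖f‖ ^ p))
            (hm.ennreal_toReal.pow_const _).aestronglyMeasurable (ae_of_all _ fun t => ?_)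
          rw [Real.norm_of_nonneg (by positivity), ← toReal_enorm f]
          exact Real.rpow_le_rpow ENNReal.toReal_nonneg (ENNReal.toReal_mono enorm_ne_top (hle t)) hp0.le
        · exact ae_of_all _ fun t => by positivity
    _ = ‖inner ℂ f (∫ t in S, T.U (-t) (G t))‖ₑ := by
        rw [← integral_inner (T.integrable_U hGi _ continuous_neg)]
        simp only [inner_U_left]
    _ ≤ ‖f‖ₑ * (strichartzConst A p * (∫⁻ s in S, lq r (G s) ^ p') ^ (1 / p')) :=
        (enorm_inner_le _ _).trans (by gcongr; exact enorm_integral_U_neg_le hd hp hp' hGi)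
    _ ≤ ‖f‖ₑ * (strichartzConst A p * (∫⁻ s in S, lq a (T.U s f) ^ p) ^ (1 / p')) := by
        gcongr with s
        calc lq r (G s) ^ p' ≤ (lq a (T.U s f) ^ (p - 1)) ^ p' := by gcongr; exact hlqG s
          _ = _ := by rw [← ENNReal.rpow_mul, hpp]
    _ = _ := by rw [← mul_assoc, mul_comm ‖f‖ₑ]

/-- The Duhamel operator. -/
def duhamel (G : ℝ → T.L2) (t : ℝ) : T.L2 := ∫ s in (0 : ℝ)..t, T.U (t - s) (G s)

variable {S : Set ℝ} {G : ℝ → T.L2} {t : ℝ}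

lemma duhamel_eq (G : ℝ → T.L2) (t : ℝ) :
    duhamel G t = T.U t (∫ s in (0 : ℝ)..t, T.U (-s) (G s)) := by
  have h : ∀ s, T.U (t - s) (G s) = T.U t (T.U (-s) (G s)) := fun s => by
    rw [← U_add_apply, sub_eq_add_neg]
  have hinj : ∀ v, T.U (-t) (T.U t v) = v := T.U_neg_apply t
  rw [duhamel]
  simp only [h]
  let e : T.L2 ≃L[ℂ] T.L2 := ContinuousLinearEquiv.equivOfInverse (T.U t) (T.U (-t)) hinj fun v => by
    simpa using T.U_neg_apply (-t) v
  have he : ∀ v, e v = T.U t v := fun _ => rfl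
  simp only [intervalIntegral, ← he, map_sub]
  rw [e.integral_comp_comm, e.integral_comp_comm]

lemma enorm_duhamel_le (hd : Dispersive T A r) (hp : 2 < p) (hp' : p.HolderConjugate p')
    (hG : IntegrableOn G S) (ht : Set.uIoc 0 t ⊆ S) :
    ‖duhamel G t‖ₑ ≤ strichartzConst A p * (∫⁻ s in S, lq r (G s) ^ p') ^ (1 / p') := by
  rw [duhamel_eq, ← ofReal_norm, norm_U, intervalIntegral.norm_integral_eq_norm_integral_uIoc, ofReal_norm]
  refine (enorm_integral_U_neg_le hd hp hp' (hG.mono_set ht)).trans ?_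
  have := hp'.symm.pos
  gcongr

lemma lq_duhamel_le (hd : Dispersive T A r) (ha : 2 ≤ a) (hr : a.HolderConjugate r)
    (hG : IntegrableOn G S) (ht : Set.uIoc 0 t ⊆ S) :
    lq a (duhamel G t) ≤ ∫⁻ s in S, decay A (t - s) * lq r (G s) := by
  obtain ⟨D, hD, hDr, hD2, hDx⟩ := T.exists_dual ha hr
  set v := duhamel G t with hv
  calc lq a v = ‖inner ℂ (D v) v‖ₑ := by
        rw [hD, ← ofReal_norm, Complex.norm_real, Real.norm_of_nonneg ENNReal.toReal_nonneg,
          ENNReal.ofReal_toReal (T.lq_ne_top ha _)]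
    _ = ‖∫ s in Set.uIoc 0 t, inner ℂ (D v) (T.U (t - s) (G s))‖ₑ := by
        rw [integral_inner (T.integrable_U (hG.mono_set ht) _ (by fun_prop)), hv]
        nth_rewrite 2 [duhamel]
        rw [intervalIntegral.intervalIntegral_eq_integral_uIoc, inner_smul_right_eq_smul]
        split_ifs <;> simp
    _ ≤ ∫⁻ s in Set.uIoc 0 t, ‖inner ℂ (D v) (T.U (t - s) (G s))‖ₑ :=
        enorm_integral_le_lintegral_enorm _
    _ ≤ ∫⁻ s in S, ‖inner ℂ (D v) (T.U (t - s) (G s))‖ₑ := lintegral_mono_set ht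
    _ ≤ _ := by
        gcongr with s
        refine (hd _ _ _).trans ?_
        gcongr
        exact mul_le_of_le_one_right' (hDr _)

/-- The inhomogeneous Strichartz estimate. -/
lemma lintegral_lq_duhamel_le (hA : 0 ≤ A) (hd : Dispersive T A r) (ha : 2 ≤ a)
    (hr : a.HolderConjugate r) (hp : 2 < p) (hp' : p.HolderConjugate p')
    (hS : volume S ≠ ∞) (hSm : MeasurableSet S) (hG : IntegrableOn G S)
    (hGr : ∫⁻ s in S, lq r (G s) ≠ ∞) (ht : ∀ t ∈ S, Set.uIoc 0 t ⊆ S) :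
    (∫⁻ t in S, lq a (duhamel G t) ^ p) ^ (1 / p) ≤
      strichartzConst A p ^ 2 * (∫⁻ s in S, lq r (G s) ^ p') ^ (1 / p') := by
  have hp0 : 0 < p := by linarith
  have hm := aemeasurable_lq hG.1 r
  set W : ℝ → ℝ≥0∞ := fun t => ∫⁻ s in S, decay A (t - s) * lq r (G s) with hW
  have hWm : AEMeasurable W (volume.restrict S) := by
    refine AEMeasurable.lintegral_prod_right' (f := fun z : ℝ × ℝ => decay A (z.1 - z.2) * lq r (G z.2)) ?_
    have := measurable_decay A
    exact (by fun_prop : Measurable fun z : ℝ × ℝ => decay A (z.1 - z.2)).aemeasurable.mul hm.comp_snd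
  have hWb : ∀ t, W t ≤ ENNReal.ofReal A * ∫⁻ s in S, lq r (G s) := fun t => by
    rw [← lintegral_const_mul'' _ hm]
    refine lintegral_mono fun s => ?_
    dsimp only
    gcongr
    exact decay_le hA _
  set X := ∫⁻ t in S, W t ^ p with hX
  have hXt : X ≠ ∞ := by
    refine ne_top_of_le_ne_top ?_ (lintegral_mono fun t => ENNReal.rpow_le_rpow (hWb t) hp0.le)
    rw [lintegral_const, Measure.restrict_apply_univ]
    finiteness
  have hpp : (p - 1) * p' = p := by have := hp'.mul_eq_add; linarith
  refine le_trans (b := X ^ (1 / p)) ?_ (ENNReal.rpow_le_of_le_mul_rpow hp' hXt ?_)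
  · refine ENNReal.rpow_le_rpow (setLIntegral_mono' hSm fun t h => ?_) (by positivity)
    gcongr
    exact lq_duhamel_le hd ha hr hG (ht t h)
  calc X = ∫⁻ t in S, ∫⁻ s in S, decay A (t - s) * lq r (G s) * W t ^ (p - 1) := by
        refine lintegral_congr fun t => ?_
        have := measurable_decay A
        have hmt : AEMeasurable (fun s => decay A (t - s) * lq r (G s)) (volume.restrict S) :=
          (by fun_prop : Measurable fun s => decay A (t - s)).aemeasurable.mul hm
        rw [lintegral_mul_const'' _ hmt]
        change W t ^ p = W t * W t ^ (p - 1)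
        nth_rewrite 2 [← ENNReal.rpow_one (W t)]
        rw [← ENNReal.rpow_add_of_nonneg _ _ zero_le_one (by linarith), add_sub_cancel]
    _ ≤ strichartzConst A p ^ 2 * ((∫⁻ s in S, lq r (G s) ^ p') ^ (1 / p') *
          (∫⁻ t in S, (W t ^ (p - 1)) ^ p') ^ (1 / p')) := by
        rw [← strichartzConst_sq A p]
        exact lintegral_young (measurable_decay A) (decay_neg A) hm (hWm.pow_const _) hp hp'
    _ = _ := by simp only [← ENNReal.rpow_mul, hpp, mul_assoc]; rfl

end HomTree

lemma ENNReal.lintegral_rpow_mul_Lp_le {Ω : Type*} [MeasurableSpace Ω] {μ : Measure Ω}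
    {a b : Ω → ℝ≥0∞} (ha : AEMeasurable a μ) (hb : AEMeasurable b μ) {p p' γ : ℝ} (hγ : 1 < γ)
    (hp' : p.HolderConjugate p') (hlam : 0 < 1 - γ / p - 1 / p) :
    (∫⁻ t, (a t ^ (γ - 1) * b t) ^ p' ∂μ) ^ (1 / p') ≤
      μ Set.univ ^ (1 - γ / p - 1 / p) *
        (((∫⁻ t, a t ^ p ∂μ) ^ (1 / p)) ^ (γ - 1) * (∫⁻ t, b t ^ p ∂μ) ^ (1 / p)) := by
  have hp0 := hp'.pos
  have hp'0 := hp'.symm.pos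
  set l := 1 - γ / p - 1 / p with hl
  have hγ1 : 0 ≤ γ - 1 := by linarith
  have hsum : l * p' + (γ - 1) / p * p' + 1 / p * p' = 1 := by
    have h1 : l + (γ - 1) / p + 1 / p = p'⁻¹ := by
      have := hp'.inv_add_inv_eq_one
      rw [hl]; field_simp at this ⊢; linarith
    rw [← add_mul, ← add_mul, h1, inv_mul_cancel₀ hp'0.ne']
  set e : Fin 3 → ℝ := ![l * p', (γ - 1) / p * p', 1 / p * p'] with he
  set f : Fin 3 → Ω → ℝ≥0∞ := ![fun _ => 1, fun t => a t ^ p, fun t => b t ^ p] with hf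
  have hold := ENNReal.lintegral_prod_norm_pow_le (μ := μ) Finset.univ (f := f)
    (fun i _ => by
      fin_cases i
      · exact aemeasurable_const
      · exact ha.pow_const _
      · exact hb.pow_const _) (p := e) (by simpa [he, Fin.sum_univ_three] using hsum) (by
      intro i _
      fin_cases i
      · change 0 ≤ l * p'; positivity
      · change 0 ≤ (γ - 1) / p * p'; positivity
      · change 0 ≤ 1 / p * p'; positivity)
  simp only [Fin.prod_univ_three, hf, he, Matrix.cons_val_zero, Matrix.cons_val_one,
    Matrix.cons_val_two, Matrix.head_cons, Matrix.tail_cons, ENNReal.one_rpow, one_mul,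
    lintegral_const] at hold
  have hint : ∀ t, (a t ^ (γ - 1) * b t) ^ p' =
      (a t ^ p) ^ ((γ - 1) / p * p') * (b t ^ p) ^ (1 / p * p') := fun t => by
    rw [ENNReal.mul_rpow_of_nonneg _ _ hp'0.le, ← ENNReal.rpow_mul, ← ENNReal.rpow_mul,
      ← ENNReal.rpow_mul]
    congr 2 <;> field_simp
  simp_rw [hint]
  refine (ENNReal.rpow_le_rpow hold (by positivity)).trans (le_of_eq ?_)
  rw [ENNReal.mul_rpow_of_nonneg _ _ (by positivity), ENNReal.mul_rpow_of_nonneg _ _ (by positivity)]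
  simp only [← ENNReal.rpow_mul]
  rw [mul_assoc]
  congr 2
  · field_simp
  · congr 1; field_simp
  · field_simp

/-- The difference estimate of a power-like nonlinearity in extended norms. -/
lemma PowerLike.exists_enorm_sub_le {F : ℂ → ℂ} {γ : ℝ} (hγ : 1 < γ) (hF : PowerLike F γ) :
    ∃ C : ℝ≥0, 0 < C ∧ F 0 = 0 ∧
      ∀ z w : ℂ, ‖F z - F w‖ₑ ≤ C * ((‖z‖ₑ + ‖w‖ₑ) ^ (γ - 1) * ‖z - w‖ₑ) := by
  obtain ⟨C, hC, h0, h⟩ := hF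
  have hγ1 : 0 ≤ γ - 1 := by linarith
  refine ⟨(2 * C).toNNReal, Real.toNNReal_pos.2 (by positivity), ?_,
    fun z w => ?_⟩
  · have := h0 0
    rw [norm_zero, Real.zero_rpow (by linarith), mul_zero] at this
    simpa using this
  · change _ ≤ ENNReal.ofReal (2 * C) * _
    rw [← ofReal_norm, ← ofReal_norm, ← ofReal_norm, ← ofReal_norm,
      ← ENNReal.ofReal_add (norm_nonneg _) (norm_nonneg _),
      ENNReal.ofReal_rpow_of_nonneg (by positivity) hγ1, ← ENNReal.ofReal_mul (by positivity),
      ← ENNReal.ofReal_mul (by positivity)]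
    refine ENNReal.ofReal_le_ofReal ((h z w).trans ?_)
    have h1 : ‖z‖ ^ (γ - 1) ≤ (‖z‖ + ‖w‖) ^ (γ - 1) :=
      Real.rpow_le_rpow (norm_nonneg _) (by simp) hγ1
    have h2 : ‖w‖ ^ (γ - 1) ≤ (‖z‖ + ‖w‖) ^ (γ - 1) :=
      Real.rpow_le_rpow (norm_nonneg _) (by simp) hγ1
    calc _ ≤ C * ((‖z‖ + ‖w‖) ^ (γ - 1) + (‖z‖ + ‖w‖) ^ (γ - 1)) * ‖z - w‖ := by gcongr
      _ = _ := by ring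

lemma ell_sub_le {α : Type*} {F : ℂ → ℂ} {γ : ℝ} (hγ : 1 < γ) {C : ℝ≥0}
    (hF : ∀ z w : ℂ, ‖F z - F w‖ₑ ≤ C * ((‖z‖ₑ + ‖w‖ₑ) ^ (γ - 1) * ‖z - w‖ₑ))
    {r s : ℝ} (hr : 0 < r) (hs : 1 ≤ s) (hsr : s ≤ r * γ) (u v : α → ℂ) :
    ell r (fun x => ‖F (u x) - F (v x)‖ₑ) ≤
      C * ((ell s (fun x => ‖u x‖ₑ) + ell s (fun x => ‖v x‖ₑ)) ^ (γ - 1) *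
        ell s (fun x => ‖u x - v x‖ₑ)) := by
  have hs0 : 0 < s := by linarith
  have hγ1 : 0 ≤ γ - 1 := by linarith
  refine (ell_mono hr fun x => hF (u x) (v x)).trans ?_
  rw [ell_const_mul hr]
  gcongr
  refine (ell_rpow_mul_le hr hγ _ _).trans ?_
  gcongr
  · exact (ell_anti hs0 hsr _).trans (ell_add_le hs _ _)
  · exact ell_anti hs0 hsr _

/-- Data of a power-like nonlinearity in the form used for the fixed point argument. -/
structure LocLip (F : ℂ → ℂ) (γ : ℝ) (C : ℝ≥0) : Prop where
  one_lt : 1 < γ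
  map_zero : F 0 = 0
  enorm_sub_le : ∀ z w : ℂ, ‖F z - F w‖ₑ ≤ C * ((‖z‖ₑ + ‖w‖ₑ) ^ (γ - 1) * ‖z - w‖ₑ)

namespace HomTree

variable {Q : ℕ} {T : HomTree Q} {F : ℂ → ℂ} {γ : ℝ} {C : ℝ≥0}

lemma LocLip.ell_two_ne_top (hF : LocLip F γ C) (u : T.L2) :
    ell 2 (fun x => ‖F (u x)‖ₑ) ≠ ∞ := by
  have h1 := hF.one_lt
  have h := ell_sub_le hF.one_lt hF.enorm_sub_le (r := 2) (s := 2) two_pos one_le_two (by linarith) u 0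
  simp only [Pi.zero_apply, hF.map_zero, sub_zero, ← enorm_eq_ell, enorm_zero] at h
  refine ne_top_of_le_ne_top ?_ h
  have hz : ell 2 (fun _ : T.V => (0 : ℝ≥0∞)) = 0 := by simp [ell]
  rw [hz, add_zero]
  have : 0 ≤ γ - 1 := by linarith
  finiteness

/-- The nonlinearity acting on `ℓ²`. -/
def nonlin (hF : LocLip F γ C) (u : T.L2) : T.L2 :=
  T.toL2 (fun x => F (u x)) (LocLip.ell_two_ne_top hF u)

@[simp] lemma nonlin_apply (hF : LocLip F γ C) (u : T.L2) (x : T.V) : nonlin hF u x = F (u x) := rfl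

lemma lq_nonlin_sub_le (hF : LocLip F γ C) {r s : ℝ} (hr : 0 < r) (hs : 1 ≤ s) (hsr : s ≤ r * γ)
    (u v : T.L2) :
    lq r (nonlin hF u - nonlin hF v) ≤ C * ((lq s u + lq s v) ^ (γ - 1) * lq s (u - v)) :=
  ell_sub_le hF.one_lt hF.enorm_sub_le hr hs hsr u v

lemma enorm_nonlin_sub_le (hF : LocLip F γ C) (u v : T.L2) :
    ‖nonlin hF u - nonlin hF v‖ₑ ≤ C * ((‖u‖ₑ + ‖v‖ₑ) ^ (γ - 1) * ‖u - v‖ₑ) := by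
  have h1 := hF.one_lt
  simp only [enorm_eq_ell]
  exact lq_nonlin_sub_le hF two_pos one_le_two (by linarith) u v

lemma nonlin_zero (hF : LocLip F γ C) : nonlin hF (0 : T.L2) = 0 := by
  ext x; simp [hF.map_zero]

lemma continuous_nonlin (hF : LocLip F γ C) : Continuous (nonlin (T := T) hF) := by
  have h1 := hF.one_lt
  rw [continuous_iff_continuousAt]
  intro v
  rw [ContinuousAt, tendsto_iff_edist_tendsto_0]
  have hlim : Tendsto (fun u : T.L2 => C * ((‖u‖ₑ + ‖v‖ₑ) ^ (γ - 1) * ‖u - v‖ₑ)) (𝓝 v) (𝓝 0) := by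
    have e1 : Tendsto (fun u : T.L2 => (‖u‖ₑ + ‖v‖ₑ) ^ (γ - 1)) (𝓝 v)
        (𝓝 ((‖v‖ₑ + ‖v‖ₑ) ^ (γ - 1))) :=
      ((ENNReal.continuous_rpow_const.comp (continuous_enorm.add continuous_const)).tendsto v)
    have e2 : Tendsto (fun u : T.L2 => ‖u - v‖ₑ) (𝓝 v) (𝓝 0) := by
      have : Continuous fun u : T.L2 => ‖u - v‖ₑ := by fun_prop
      simpa using this.tendsto v
    have hfin : (‖v‖ₑ + ‖v‖ₑ) ^ (γ - 1) ≠ ∞ := by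
      have : 0 ≤ γ - 1 := by linarith
      finiteness
    have e3 := ENNReal.Tendsto.const_mul (a := (C : ℝ≥0∞))
      (ENNReal.Tendsto.mul e1 (.inr ENNReal.zero_ne_top) e2 (.inr hfin)) (.inr ENNReal.coe_ne_top)
    simpa using e3
  refine tendsto_of_tendsto_of_tendsto_of_le_of_le tendsto_const_nhds hlim (fun _ => zero_le) fun u => ?_
  rw [edist_eq_enorm_sub]
  exact enorm_nonlin_sub_le hF u v

lemma lq_add_le {q : ℝ} (hq : 1 ≤ q) (u v : T.L2) : lq q (u + v) ≤ lq q u + lq q v := by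
  refine (ell_mono (by linarith) fun x => ?_).trans (ell_add_le hq _ _)
  exact enorm_add_le _ _

lemma lq_neg (q : ℝ) (u : T.L2) : lq q (-u) = lq q u := by
  simp [lq]

/-- The norm of `C(S; ℓ²) ∩ L^p(S; ℓ^q)`. -/
def xnorm (S : Set ℝ) (p q : ℝ) (u : ℝ → T.L2) : ℝ≥0∞ :=
  (⨆ t ∈ S, ‖u t‖ₑ) + (∫⁻ t in S, lq q (u t) ^ p) ^ (1 / p)

section

variable {S : Set ℝ} {p q : ℝ} {u v w : ℝ → T.L2}

lemma enorm_le_xnorm {t : ℝ} (ht : t ∈ S) : ‖u t‖ₑ ≤ xnorm S p q u :=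
  (le_iSup₂ (f := fun t _ => ‖u t‖ₑ) t ht).trans le_self_add

lemma xnorm_congr (hS : MeasurableSet S) (h : ∀ t ∈ S, u t = v t) : xnorm S p q u = xnorm S p q v := by
  rw [xnorm, xnorm, setLIntegral_congr_fun hS fun t ht => by rw [h t ht]]
  congr 1
  exact iSup_congr fun t => iSup_congr fun ht => by rw [h t ht]

lemma xnorm_add_le (hp : 1 ≤ p) (hq : 1 ≤ q) (hu : AEStronglyMeasurable u (volume.restrict S))
    (hv : AEStronglyMeasurable v (volume.restrict S)) :
    xnorm S p q (u + v) ≤ xnorm S p q u + xnorm S p q v := by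
  have h1 : ⨆ t ∈ S, ‖(u + v) t‖ₑ ≤ (⨆ t ∈ S, ‖u t‖ₑ) + ⨆ t ∈ S, ‖v t‖ₑ :=
    iSup₂_le fun t ht => (enorm_add_le _ _).trans (add_le_add
      (le_iSup₂ (f := fun t _ => ‖u t‖ₑ) t ht) (le_iSup₂ (f := fun t _ => ‖v t‖ₑ) t ht))
  have h2 : (∫⁻ t in S, lq q ((u + v) t) ^ p) ^ (1 / p) ≤
      (∫⁻ t in S, lq q (u t) ^ p) ^ (1 / p) + (∫⁻ t in S, lq q (v t) ^ p) ^ (1 / p) := by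
    refine le_trans ?_ (ENNReal.lintegral_Lp_add_le (aemeasurable_lq hu q) (aemeasurable_lq hv q) hp)
    gcongr with t
    exact lq_add_le hq _ _
  calc _ ≤ _ := add_le_add h1 h2
    _ = _ := by unfold xnorm; ring

lemma xnorm_neg : xnorm S p q (-u) = xnorm S p q u := by simp [xnorm, lq_neg]

lemma xnorm_le_of_enorm_le (hS : MeasurableSet S) (hp : 0 < p) (hq : 2 ≤ q) {ε : ℝ≥0∞}
    (h : ∀ t ∈ S, ‖u t‖ₑ ≤ ε) : xnorm S p q u ≤ ε * (1 + volume S ^ (1 / p)) := by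
  have h2 : (∫⁻ t in S, lq q (u t) ^ p) ^ (1 / p) ≤ ε * volume S ^ (1 / p) := by
    calc _ ≤ (∫⁻ _ in S, ε ^ p) ^ (1 / p) := by
          refine ENNReal.rpow_le_rpow (setLIntegral_mono' hS fun t ht => ?_) (by positivity)
          gcongr
          exact (T.lq_le_enorm hq _).trans (h t ht)
      _ = _ := by
          rw [setLIntegral_const, ENNReal.mul_rpow_of_nonneg _ _ (by positivity), ← ENNReal.rpow_mul,
            mul_one_div_cancel hp.ne', ENNReal.rpow_one]
  calc _ ≤ ε + ε * volume S ^ (1 / p) := add_le_add (iSup₂_le h) h2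
    _ = _ := by ring

end

end HomTree

lemma exists_time_scale {k b : ℝ≥0∞} (hk : k ≠ ∞) (hb0 : b ≠ 0) (hb : b ≠ ∞) {l m : ℝ} (hl : 0 < l)
    (hm : 0 ≤ m) : ∃ c : ℝ, 0 < c ∧ ∀ R : ℝ≥0∞, 0 < R → R < ∞ → ∃ Tt : ℝ, 0 < Tt ∧
      ENNReal.ofReal c ≤ ENNReal.ofReal (Tt ^ l) * R ^ m ∧
      k * (ENNReal.ofReal (2 * Tt) ^ l * (b * R) ^ m) ≤ 1 / 2 := by
  set k' := k.toReal + 1 with hk'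
  have hk'0 : 0 < k' := by positivity
  have hkk : k ≤ ENNReal.ofReal k' := by
    rw [← ENNReal.ofReal_toReal hk]; exact ENNReal.ofReal_le_ofReal (by simp [hk'])
  set β := b.toReal with hβ
  have hβ0 : 0 < β := ENNReal.toReal_pos hb0 hb
  refine ⟨1 / (2 * k' * 2 ^ l * β ^ m), by positivity, fun R hR0 hRt => ?_⟩
  set ρ := R.toReal with hρ
  have hρ0 : 0 < ρ := ENNReal.toReal_pos hR0.ne' hRt.ne
  set d := 1 / (2 * k' * 2 ^ l * (β * ρ) ^ m) with hd
  have hd0 : 0 < d := by positivity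
  have hTl : (d ^ (1 / l)) ^ l = d := by
    rw [← Real.rpow_mul hd0.le, one_div_mul_cancel hl.ne', Real.rpow_one]
  refine ⟨d ^ (1 / l), by positivity, ?_, ?_⟩
  · rw [hTl, ← ENNReal.ofReal_toReal hRt.ne, ENNReal.ofReal_rpow_of_nonneg hρ0.le hm,
      ← ENNReal.ofReal_mul hd0.le]
    refine ENNReal.ofReal_le_ofReal (le_of_eq ?_)
    rw [hd, Real.mul_rpow hβ0.le hρ0.le]
    have : 0 < ρ ^ m := by positivity
    have : 0 < β ^ m := by positivity
    field_simp
  · rw [← ENNReal.ofReal_toReal hRt.ne, ← ENNReal.ofReal_toReal hb, ← ENNReal.ofReal_mul hβ0.le,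
      ENNReal.ofReal_rpow_of_nonneg (by positivity) hl.le,
      ENNReal.ofReal_rpow_of_nonneg (by positivity) hm, ← ENNReal.ofReal_mul (by positivity)]
    refine (mul_le_mul_left hkk _).trans ?_
    rw [← ENNReal.ofReal_mul hk'0.le, Real.mul_rpow zero_le_two (by positivity), hTl]
    refine (ENNReal.ofReal_le_ofReal (q := 1 / 2) (le_of_eq ?_)).trans (le_of_eq ?_)
    · rw [hd]
      have : 0 < (β * ρ) ^ m := by positivity
      field_simp
      rfl
    · rw [ENNReal.ofReal_div_of_pos two_pos]; simp

namespace HomTree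

variable {Q : ℕ} {T : HomTree Q} {F : ℂ → ℂ} {γ : ℝ} {C : ℝ≥0} {p q A a r p' : ℝ}

/-- Exponents and constants for which the Strichartz machinery applies. -/
structure StrichartzData (T : HomTree Q) (γ p q A a r p' : ℝ) : Prop where
  A_nonneg : 0 ≤ A
  dispersive : Dispersive T A r
  two_lt_p : 2 < p
  conj_p : p.HolderConjugate p'
  two_le_a : 2 ≤ a
  conj_a : a.HolderConjugate r
  a_le_q : a ≤ q
  q_le : q ≤ r * γ
  lam_pos : 0 < 1 - γ / p - 1 / p

lemma exists_strichartzData (T : HomTree Q) (hQ : 2 ≤ Q) (hγ : 1 < γ) (hp : 2 ≤ p) (hq : 2 < q)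
    (hqγ : q < 2 * γ) (hlam : 0 < 1 - γ / p - 1 / p) :
    ∃ A a r p', StrichartzData T γ p q A a r p' := by
  have hp0 : 0 < p := by linarith
  have hp2 : 2 < p := by
    have : 1 - γ / p - 1 / p = (p - γ - 1) / p := by field_simp
    rw [this, div_pos_iff_of_pos_right hp0] at hlam
    linarith
  have hγ0 : 0 < γ := by linarith
  set ε := min (q - 2) ((2 * γ - q) / γ) with hε
  have hε0 : 0 < ε := lt_min (by linarith) (div_pos (by linarith) hγ0)
  have h1 : ε ≤ q - 2 := min_le_left _ _
  have h2 : ε * γ ≤ 2 * γ - q := (le_div_iff₀ hγ0).1 (min_le_right _ _)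
  have hr := Real.HolderConjugate.conjExponent (p := 2 + ε) (by linarith)
  obtain ⟨A, hA, hd⟩ := T.exists_dispersive hQ (by linarith : 2 < 2 + ε) hr
  refine ⟨A, 2 + ε, _, _, hA, hd, hp2, Real.HolderConjugate.conjExponent (by linarith), by linarith,
    hr, by linarith, ?_, hlam⟩
  have hr2 : 2 - ε ≤ Real.conjExponent (2 + ε) := by
    rw [Real.conjExponent, le_div_iff₀ (by linarith)]
    nlinarith
  nlinarith

lemma lq_anti {s t : ℝ} (hs : 0 < s) (hst : s ≤ t) (u : T.L2) : lq t u ≤ lq s u :=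
  ell_anti hs hst _

namespace StrichartzData

lemma xnorm_U_le (E : StrichartzData T γ p q A a r p') {S : Set ℝ} (hS : volume S ≠ ∞) (f : T.L2) :
    xnorm S p q (fun t => T.U t f) ≤ (1 + strichartzConst A p) * ‖f‖ₑ := by
  have h0 := E.two_lt_p
  have h1 := E.two_le_a
  have e1 : ⨆ t ∈ S, ‖T.U t f‖ₑ ≤ ‖f‖ₑ := iSup₂_le fun t _ => by
    rw [← ofReal_norm, norm_U, ofReal_norm]
  have e2 : (∫⁻ t in S, lq q (T.U t f) ^ p) ^ (1 / p) ≤ strichartzConst A p * ‖f‖ₑ := by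
    refine le_trans ?_ (lintegral_lq_U_le E.dispersive h1 E.conj_a h0 E.conj_p hS f)
    gcongr with t
    exact lq_anti (by linarith) E.a_le_q _
  rw [add_mul, one_mul]
  exact add_le_add e1 e2

end StrichartzData

lemma integrableOn_nonlin (hF : LocLip F γ C) {S : Set ℝ} (hS : volume S ≠ ∞) (hSm : MeasurableSet S)
    {u : ℝ → T.L2} (hu : AEStronglyMeasurable u (volume.restrict S)) {M : ℝ≥0∞} (hM : M ≠ ∞)
    (h : ∀ t ∈ S, ‖u t‖ₑ ≤ M) : IntegrableOn (fun t => nonlin hF (u t)) S := by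
  have h1 : 0 ≤ γ - 1 := by linarith [hF.one_lt]
  refine ⟨(continuous_nonlin hF).comp_aestronglyMeasurable hu, ?_⟩
  calc ∫⁻ t in S, ‖nonlin hF (u t)‖ₑ ≤ ∫⁻ _ in S, C * (M ^ (γ - 1) * M) := by
        refine setLIntegral_mono' hSm fun t ht => ?_
        have := enorm_nonlin_sub_le hF (u t) 0
        rw [nonlin_zero, sub_zero, sub_zero, enorm_zero, add_zero] at this
        refine this.trans ?_
        gcongr <;> exact h t ht
    _ < ∞ := by
        rw [setLIntegral_const]
        finiteness

lemma duhamel_sub {G H : ℝ → T.L2} {S : Set ℝ} (hG : IntegrableOn G S) (hH : IntegrableOn H S) {t : ℝ}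
    (ht : Set.uIoc 0 t ⊆ S) : duhamel (fun s => G s - H s) t = duhamel G t - duhamel H t := by
  have hi : ∀ K : ℝ → T.L2, IntegrableOn K S →
      IntervalIntegrable (fun s => T.U (t - s) (K s)) volume 0 t := fun K hK =>
    intervalIntegrable_iff.2 (T.integrable_U (hK.mono_set ht) _ (by fun_prop))
  simp only [duhamel, map_sub]
  exact intervalIntegral.integral_sub (hi _ hG) (hi _ hH)

namespace StrichartzData

lemma xnorm_duhamel_sub_le (E : StrichartzData T γ p q A a r p') (hF : LocLip F γ C) {S : Set ℝ}
    (hS : volume S ≠ ∞) (hSm : MeasurableSet S) (hSt : ∀ t ∈ S, Set.uIoc 0 t ⊆ S) {u v : ℝ → T.L2}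
    (hu : AEStronglyMeasurable u (volume.restrict S)) (hv : AEStronglyMeasurable v (volume.restrict S))
    {M : ℝ≥0∞} (hM : M ≠ ∞) (huM : xnorm S p q u ≤ M) (hvM : xnorm S p q v ≤ M) :
    xnorm S p q (fun t => duhamel (fun s => nonlin hF (u s)) t - duhamel (fun s => nonlin hF (v s)) t) ≤
      (strichartzConst A p + strichartzConst A p ^ 2) * C *
        (volume S ^ (1 - γ / p - 1 / p) * (2 * M) ^ (γ - 1)) * xnorm S p q (fun t => u t - v t) := by
  have h1 := hF.one_lt
  have hγ1 : 0 ≤ γ - 1 := by linarith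
  have h0 := E.two_lt_p
  have ha := E.two_le_a
  have haq := E.a_le_q
  have hr0 := E.conj_a.symm.pos
  have hp'0 := E.conj_p.symm.pos
  have huM' : ∀ t ∈ S, ‖u t‖ₑ ≤ M := fun t ht => (enorm_le_xnorm ht).trans huM
  have hvM' : ∀ t ∈ S, ‖v t‖ₑ ≤ M := fun t ht => (enorm_le_xnorm ht).trans hvM
  have hui := integrableOn_nonlin hF hS hSm hu hM huM'
  have hvi := integrableOn_nonlin hF hS hSm hv hM hvM'
  set G : ℝ → T.L2 := fun s => nonlin hF (u s) - nonlin hF (v s) with hG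
  have hGi : IntegrableOn G S := hui.sub hvi
  have hlq : ∀ t, lq r (G t) ≤ C * ((lq q (u t) + lq q (v t)) ^ (γ - 1) * lq q (u t - v t)) := fun t =>
    lq_nonlin_sub_le hF hr0 (by linarith) E.q_le _ _
  have hGr : ∫⁻ s in S, lq r (G s) ≠ ∞ := by
    refine ne_top_of_le_ne_top (b := ∫⁻ _ in S, C * ((M + M) ^ (γ - 1) * (M + M))) ?_
      (setLIntegral_mono' hSm fun t ht => (hlq t).trans ?_)
    · rw [setLIntegral_const]; finiteness
    · have e1 := (T.lq_le_enorm (ha.trans haq) (u t)).trans (huM' t ht)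
      have e2 := (T.lq_le_enorm (ha.trans haq) (v t)).trans (hvM' t ht)
      gcongr
      rw [sub_eq_add_neg]
      refine (lq_add_le (by linarith) _ _).trans ?_
      rw [lq_neg]
      gcongr
  set B := (∫⁻ s in S, lq r (G s) ^ p') ^ (1 / p') with hB
  have hBle : B ≤ C * (volume S ^ (1 - γ / p - 1 / p) * ((2 * M) ^ (γ - 1) *
      xnorm S p q (fun t => u t - v t))) := by
    have hmu := aemeasurable_lq hu q
    have hmv := aemeasurable_lq hv q
    have hmd := aemeasurable_lq (hu.sub hv) q
    calc B ≤ (∫⁻ t in S, (C * ((lq q (u t) + lq q (v t)) ^ (γ - 1) * lq q (u t - v t))) ^ p') ^ (1 / p') := by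
          rw [hB]; gcongr with t; exact hlq t
      _ = C * (∫⁻ t in S, ((lq q (u t) + lq q (v t)) ^ (γ - 1) * lq q (u t - v t)) ^ p') ^ (1 / p') := by
          simp only [ENNReal.mul_rpow_of_nonneg _ _ hp'0.le]
          rw [lintegral_const_mul' _ _ (by finiteness), ENNReal.mul_rpow_of_nonneg _ _ (by positivity),
            ← ENNReal.rpow_mul, mul_one_div_cancel hp'0.ne', ENNReal.rpow_one]
      _ ≤ _ := by
          refine mul_le_mul_right (le_trans (ENNReal.lintegral_rpow_mul_Lp_le (hmu.add hmv) hmd h1 E.conj_p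
            E.lam_pos) ?_) _
          rw [Measure.restrict_apply_univ]
          gcongr
          · refine (ENNReal.lintegral_Lp_add_le hmu hmv (by linarith)).trans ?_
            rw [two_mul]
            exact add_le_add (le_add_self.trans huM) (le_add_self.trans hvM)
          · exact le_add_self
  have hcongr : ∀ t ∈ S, duhamel (fun s => nonlin hF (u s)) t - duhamel (fun s => nonlin hF (v s)) t =
      duhamel G t := fun t ht => (duhamel_sub hui hvi (hSt t ht)).symm
  rw [xnorm_congr hSm hcongr]
  have e1 : ⨆ t ∈ S, ‖duhamel G t‖ₑ ≤ strichartzConst A p * B := iSup₂_le fun t ht =>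
    enorm_duhamel_le E.dispersive h0 E.conj_p hGi (hSt t ht)
  have e2 : (∫⁻ t in S, lq q (duhamel G t) ^ p) ^ (1 / p) ≤ strichartzConst A p ^ 2 * B := by
    refine le_trans ?_ (lintegral_lq_duhamel_le E.A_nonneg E.dispersive ha E.conj_a h0 E.conj_p hS hSm
      hGi hGr hSt)
    gcongr with t
    exact lq_anti (by linarith) haq _
  calc _ ≤ strichartzConst A p * B + strichartzConst A p ^ 2 * B := add_le_add e1 e2
    _ = (strichartzConst A p + strichartzConst A p ^ 2) * B := by ring
    _ ≤ (strichartzConst A p + strichartzConst A p ^ 2) * (C * (volume S ^ (1 - γ / p - 1 / p) *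
      ((2 * M) ^ (γ - 1) * xnorm S p q (fun t => u t - v t)))) := by gcongr
    _ = _ := by ring

end StrichartzData

end HomTree

namespace HomTree

variable {Q : ℕ} {T : HomTree Q} {F : ℂ → ℂ} {γ : ℝ} {C : ℝ≥0} {p q A a r p' : ℝ}

lemma continuous_U_apply (f : T.L2) : Continuous fun t => T.U t f := by
  have := T.continuous_U; fun_prop

lemma continuous_duhamel {G : ℝ → T.L2} (hG : Continuous G) : Continuous (duhamel G) := by
  have h1 : Continuous fun s => T.U (-s) (G s) := (T.continuous_U.comp continuous_neg).clm_apply hG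
  have h2 := intervalIntegral.continuous_primitive (μ := volume) (fun a b => h1.intervalIntegrable a b) 0
  have : duhamel G = fun t => T.U t (∫ s in (0 : ℝ)..t, T.U (-s) (G s)) := funext fun t => duhamel_eq G t
  rw [this]
  exact T.continuous_U.clm_apply h2

/-- The Picard map of the integral equation. -/
def picard (hF : LocLip F γ C) (f : T.L2) (u : ℝ → T.L2) (t : ℝ) : T.L2 :=
  T.U t f - I • duhamel (fun s => nonlin hF (u s)) t

lemma continuous_picard (hF : LocLip F γ C) (f : T.L2) {u : ℝ → T.L2} (hu : Continuous u) :
    Continuous (picard hF f u) := by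
  have h : Continuous fun s => nonlin hF (u s) := (continuous_nonlin hF).comp hu
  exact (continuous_U_apply f).sub ((continuous_duhamel h).const_smul I)

/-- The contraction factor of the Picard map. -/
def picardFactor (S : Set ℝ) (A p γ : ℝ) (C : ℝ≥0) (M : ℝ≥0∞) : ℝ≥0∞ :=
  (strichartzConst A p + strichartzConst A p ^ 2) * C *
        (volume S ^ (1 - γ / p - 1 / p) * (2 * M) ^ (γ - 1))

lemma xnorm_smul_I {S : Set ℝ} (u : ℝ → T.L2) : xnorm S p q (fun t => I • u t) = xnorm S p q u := by
  have : ∀ v : T.L2, ‖I • v‖ₑ = ‖v‖ₑ := fun v => by rw [enorm_smul]; simp [enorm_eq_nnnorm]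
  simp [xnorm, lq, this, enorm_eq_nnnorm]

namespace StrichartzData

variable {S : Set ℝ} {M : ℝ≥0∞}

lemma xnorm_picard_sub_le (E : StrichartzData T γ p q A a r p') (hF : LocLip F γ C)
    (hS : volume S ≠ ∞) (hSm : MeasurableSet S) (hSt : ∀ t ∈ S, Set.uIoc 0 t ⊆ S)
    {f : T.L2} {u v : ℝ → T.L2}
    (hu : AEStronglyMeasurable u (volume.restrict S)) (hv : AEStronglyMeasurable v (volume.restrict S))
    (hM : M ≠ ∞) (huM : xnorm S p q u ≤ M) (hvM : xnorm S p q v ≤ M) :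
    xnorm S p q (fun t => picard hF f u t - picard hF f v t) ≤
      picardFactor S A p γ C M * xnorm S p q (fun t => u t - v t) := by
  have h : ∀ t, picard hF f u t - picard hF f v t =
      -(I • (duhamel (fun s => nonlin hF (u s)) t - duhamel (fun s => nonlin hF (v s)) t)) := fun t => by
    simp only [picard, smul_sub]; abel
  simp only [h]
  have := xnorm_neg (S := S) (p := p) (q := q) (u := fun t =>
    (I • (duhamel (fun s => nonlin hF (u s)) t - duhamel (fun s => nonlin hF (v s)) t)))
  simp only [Pi.neg_def] at this
  rw [this, xnorm_smul_I]
  exact E.xnorm_duhamel_sub_le hF hS hSm hSt hu hv hM huM hvM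

/-- Lipschitz dependence of solutions on the data. -/
lemma xnorm_sub_le (E : StrichartzData T γ p q A a r p') (hF : LocLip F γ C)
    (hS : volume S ≠ ∞) (hSm : MeasurableSet S) (hSt : ∀ t ∈ S, Set.uIoc 0 t ⊆ S) (hM : M ≠ ∞)
    (hfac : picardFactor S A p γ C M ≤ 1 / 2) {f g : T.L2} {u v : ℝ → T.L2}
    (hu : AEStronglyMeasurable u (volume.restrict S)) (hv : AEStronglyMeasurable v (volume.restrict S))
    (huM : xnorm S p q u ≤ M) (hvM : xnorm S p q v ≤ M)
    (hue : ∀ t ∈ S, u t = picard hF f u t) (hve : ∀ t ∈ S, v t = picard hF g v t) :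
    xnorm S p q (fun t => u t - v t) ≤ 2 * (1 + strichartzConst A p) * ‖f - g‖ₑ := by
  have hp1 : 1 ≤ p := by linarith [E.two_lt_p]
  have hq1 : 1 ≤ q := by linarith [E.two_le_a, E.a_le_q]
  set w : ℝ → T.L2 := fun t => u t - v t with hw
  set z : ℝ → T.L2 := fun t => picard hF g u t - picard hF g v t with hz
  have hsplit : ∀ t ∈ S, w t = ((fun t => T.U t (f - g)) + z) t := fun t ht => by
    simp only [hw, Pi.add_apply, hz, hue t ht, hve t ht]
    simp only [picard, map_sub]
    abel
  have hUm : AEStronglyMeasurable (fun t => T.U t (f - g)) (volume.restrict S) :=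
    (continuous_U_apply _).aestronglyMeasurable
  have hzm : AEStronglyMeasurable z (volume.restrict S) := by
    refine ((hu.sub hv).sub hUm).congr ((ae_restrict_iff' hSm).2 (ae_of_all _ fun t ht => ?_))
    have := hsplit t ht
    simp only [Pi.add_apply, hw] at this
    simp [this]
  have hwt : xnorm S p q w ≠ ∞ := by
    have h1 := xnorm_add_le (p := p) (q := q) hp1 hq1 hu hv.neg
    rw [xnorm_neg, ← sub_eq_add_neg] at h1
    exact ne_top_of_le_ne_top (by finiteness) (h1.trans (add_le_add huM hvM))
  have h2 : xnorm S p q w ≤ (1 + strichartzConst A p) * ‖f - g‖ₑ + 1 / 2 * xnorm S p q w := by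
    calc xnorm S p q w = xnorm S p q ((fun t => T.U t (f - g)) + z) := xnorm_congr hSm hsplit
      _ ≤ xnorm S p q (fun t => T.U t (f - g)) + xnorm S p q z := xnorm_add_le hp1 hq1 hUm hzm
      _ ≤ _ := by
          refine add_le_add (E.xnorm_U_le hS _) ?_
          refine (E.xnorm_picard_sub_le hF hS hSm hSt hu hv hM huM hvM).trans ?_
          gcongr
  have hhalf : xnorm S p q w = 1 / 2 * xnorm S p q w + 1 / 2 * xnorm S p q w := by
    rw [← add_mul, ENNReal.add_halves, one_mul]
  have h3 : 1 / 2 * xnorm S p q w ≤ (1 + strichartzConst A p) * ‖f - g‖ₑ := by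
    nth_rewrite 1 [hhalf] at h2
    exact (ENNReal.add_le_add_iff_right (by finiteness)).1 h2
  calc xnorm S p q w = 2 * (1 / 2 * xnorm S p q w) := by
        rw [← mul_assoc, ENNReal.mul_div_cancel two_ne_zero ENNReal.ofNat_ne_top, one_mul]
    _ ≤ _ := by rw [mul_assoc]; gcongr

set_option maxHeartbeats 1000000 in
lemma exists_solution (E : StrichartzData T γ p q A a r p') (hF : LocLip F γ C)
    (hS : volume S ≠ ∞) (hSm : MeasurableSet S) (hSt : ∀ t ∈ S, Set.uIoc 0 t ⊆ S) (hM : M ≠ ∞)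
    (hfac : picardFactor S A p γ C M ≤ 1 / 2) {f : T.L2}
    (hf : (1 + strichartzConst A p) * ‖f‖ₑ ≤ 1 / 2 * M) :
    ∃ u : ℝ → T.L2, (∀ t ∈ S, u t = picard hF f u t) ∧ ContinuousOn u S ∧ xnorm S p q u ≤ M := by
  have hp1 : 1 ≤ p := by linarith [E.two_lt_p]
  have hq2 : 2 ≤ q := by linarith [E.two_le_a, E.a_le_q]
  obtain ⟨w, hw, hsucc⟩ : ∃ w : ℕ → ℝ → T.L2, w 0 = (fun _ => 0) ∧ ∀ n, w (n + 1) = picard hF f (w n) :=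
    ⟨fun n => (picard hF f)^[n] (fun _ => 0), rfl, fun n => Function.iterate_succ_apply' _ _ _⟩
  have hcont : ∀ n, Continuous (w n) := fun n => by
    induction n with
    | zero => rw [hw]; exact continuous_const
    | succ n ih => rw [hsucc]; exact continuous_picard hF f ih
  have hm : ∀ n, AEStronglyMeasurable (w n) (volume.restrict S) := fun n =>
    (hcont n).aestronglyMeasurable
  have h0 : xnorm S p q (w 0) = 0 := by
    have hp0 : 0 < p := by linarith
    have hq0 : 0 < q := by linarith
    have : lq q (0 : T.L2) = 0 := by simp [lq, ell, hq0]
    simp [hw, xnorm, this, hp0]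
  have hpic0 : picard hF f (w 0) = fun t => T.U t f := by
    funext t
    simp [picard, hw, nonlin_zero, duhamel]
  have hMhalf : 1 / 2 * M + 1 / 2 * M = M := by rw [← add_mul, ENNReal.add_halves, one_mul]
  have hstep : ∀ v : ℝ → T.L2, Continuous v → xnorm S p q v ≤ M → xnorm S p q (picard hF f v) ≤ M := by
    intro v hv hvM
    have e : picard hF f v = (fun t => T.U t f) + fun t => picard hF f v t - picard hF f (w 0) t := by
      rw [hpic0]; funext t; simp
    rw [e]
    refine (xnorm_add_le hp1 (by linarith) (continuous_U_apply f).aestronglyMeasurable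
      ((continuous_picard hF f hv).sub (continuous_picard hF f (hcont 0))).aestronglyMeasurable).trans ?_
    rw [← hMhalf]
    refine add_le_add ((E.xnorm_U_le hS f).trans hf) ((E.xnorm_picard_sub_le hF hS hSm hSt
      hv.aestronglyMeasurable (hm 0) hM hvM (by rw [h0]; exact zero_le)).trans ?_)
    refine mul_le_mul' hfac ?_
    simpa [hw] using hvM
  have hwM : ∀ n, xnorm S p q (w n) ≤ M := fun n => by
    induction n with
    | zero => rw [h0]; exact zero_le
    | succ n ih => rw [hsucc]; exact hstep _ (hcont n) ih
  have hdiff : ∀ n, xnorm S p q (fun t => w (n + 1) t - w n t) ≤ M / 2 ^ n := fun n => by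
    induction n with
    | zero => simpa [hw] using hwM 1
    | succ n ih =>
      have h1 := E.xnorm_picard_sub_le hF hS hSm hSt (f := f) (hm (n + 1)) (hm n) hM (hwM (n + 1)) (hwM n)
      rw [← hsucc, ← hsucc] at h1
      refine (h1.trans (mul_le_mul' hfac ih)).trans (le_of_eq ?_)
      rw [div_eq_mul_inv, div_eq_mul_inv, div_eq_mul_inv, pow_succ, ENNReal.mul_inv (by simp) (by simp)]
      ring
  have hed : ∀ t ∈ S, ∀ n, edist (w n t) (w (n + 1) t) ≤ M / 2 ^ n := fun t ht n => by
    rw [edist_comm, edist_eq_enorm_sub]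
    exact (enorm_le_xnorm (u := fun t => w (n + 1) t - w n t) ht).trans (hdiff n)
  have hlim : ∀ t, ∃ l, t ∈ S → Tendsto (fun n => w n t) atTop (𝓝 l) := fun t => by
    by_cases ht : t ∈ S
    · obtain ⟨l, hl⟩ := cauchySeq_tendsto_of_complete (cauchySeq_of_edist_le_geometric_two M hM (hed t ht))
      exact ⟨l, fun _ => hl⟩
    · exact ⟨0, fun h => absurd h ht⟩
  choose u hu using hlim
  have hun : ∀ n, ∀ t ∈ S, ‖u t - w n t‖ₑ ≤ 2 * M / 2 ^ n := fun n t ht => by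
    rw [← edist_eq_enorm_sub, edist_comm]
    exact edist_le_of_edist_le_geometric_two_of_tendsto M (hed t ht) (hu t ht) n
  have hε : Tendsto (fun n : ℕ => 2 * M / 2 ^ n) atTop (𝓝 0) := by
    have h1 := ENNReal.tendsto_pow_atTop_nhds_zero_of_lt_one (r := 2⁻¹) (by simp)
    have h2 := ENNReal.Tendsto.const_mul (a := 2 * M) h1 (.inr (by finiteness))
    rw [mul_zero] at h2
    refine h2.congr fun n => ?_
    rw [div_eq_mul_inv, ENNReal.inv_pow]
  have hucont : ContinuousOn u S := by
    refine TendstoUniformlyOn.continuousOn (F := w) (p := atTop) ?_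
      (Frequently.of_forall fun n => (hcont n).continuousOn)
    rw [EMetric.tendstoUniformlyOn_iff]
    intro ε hε0
    filter_upwards [hε.eventually_lt_const hε0] with n hn t ht
    rw [edist_eq_enorm_sub]
    exact (hun n t ht).trans_lt hn
  have hum : AEStronglyMeasurable u (volume.restrict S) := hucont.aestronglyMeasurable hSm
  set V := 1 + volume S ^ (1 / p) with hV
  have hVt : V ≠ ∞ := by
    have : 0 ≤ 1 / p := by positivity
    finiteness
  have hxn : ∀ n, xnorm S p q (fun t => u t - w n t) ≤ 2 * M / 2 ^ n * V := fun n =>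
    xnorm_le_of_enorm_le hSm (by linarith) hq2 (hun n)
  have hεV : Tendsto (fun n : ℕ => 2 * M / 2 ^ n * V) atTop (𝓝 0) := by
    simpa using ENNReal.Tendsto.mul_const hε (.inr hVt)
  have huM : xnorm S p q u ≤ M := by
    have h1 : ∀ n, xnorm S p q u ≤ M + 2 * M / 2 ^ n * V := fun n => by
      have : u = w n + fun t => u t - w n t := by funext t; simp
      calc xnorm S p q u = xnorm S p q (w n + fun t => u t - w n t) := by rw [← this]
        _ ≤ _ := (xnorm_add_le hp1 (by linarith) (hm n) (hum.sub (hm n))).trans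
          (add_le_add (hwM n) (hxn n))
    have h2 := hεV.const_add M
    rw [add_zero] at h2
    exact ge_of_tendsto' h2 h1
  refine ⟨u, fun t ht => ?_, hucont, huM⟩
  have h1 : ∀ n, ‖u t - picard hF f u t‖ₑ ≤ 2 * M / 2 ^ (n + 1) + 2 * M / 2 ^ n * V := fun n => by
    have e : u t - picard hF f u t = (u t - w (n + 1) t) - (picard hF f u t - picard hF f (w n) t) := by
      rw [hsucc]; abel
    rw [e]
    refine enorm_sub_le.trans (add_le_add (hun _ t ht) ?_)
    refine (enorm_le_xnorm (p := p) (q := q) (u := fun t => picard hF f u t - picard hF f (w n) t) ht).trans ?_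
    refine (E.xnorm_picard_sub_le hF hS hSm hSt hum (hm n) hM huM (hwM n)).trans ?_
    calc _ ≤ 1 * (2 * M / 2 ^ n * V) := mul_le_mul' (hfac.trans (by simp)) (hxn n)
      _ = _ := one_mul _
  have h2 := ((tendsto_add_atTop_iff_nat 1).2 hε).add hεV
  rw [add_zero] at h2
  have h3 := ge_of_tendsto' h2 h1
  rw [← sub_eq_zero, ← enorm_eq_zero]
  exact le_antisymm h3 zero_le

end StrichartzData

end HomTree

/-- A set of reals that is open for the topology of half-open intervals is Borel. -/
lemma measurableSet_of_exists_Ioo_subset {D : Set ℝ} (h : ∀ t ∈ D, ∃ y, t < y ∧ Set.Ioo t y ⊆ D) :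
    MeasurableSet D := by
  choose! y hy hyD using h
  have hc : (D \ interior D).Countable := by
    refine Set.PairwiseDisjoint.countable_of_Ioo (y := y) ?_ fun t ht => hy t ht.1
    have key : ∀ t ∈ D \ interior D, ∀ t' ∈ D \ interior D, t < t' → y t ≤ t' := by
      intro t ht t' ht' hlt
      by_contra! hcon
      exact ht'.2 (mem_interior.2 ⟨_, hyD t ht.1, isOpen_Ioo, hlt, hcon⟩)
    intro t ht t' ht' hne
    rcases lt_or_gt_of_ne hne with hlt | hlt
    · have := key t ht t' ht' hlt
      exact Set.disjoint_left.2 fun x hx hx' => absurd (hx.2.trans_le this) hx'.1.not_gt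
    · have := key t' ht' t ht hlt
      exact Set.disjoint_left.2 fun x hx hx' => absurd (hx'.2.trans_le this) hx.1.not_gt
  rw [← Set.union_sdiff_cancel (interior_subset (s := D))]
  exact isOpen_interior.measurableSet.union hc.measurableSet

/-- Measurability of a variable-endpoint integral whose integrand need not be measurable in `s`:
the times at which it is measurable are closed under limits from the right. -/
lemma aestronglyMeasurable_integral_Icc_zero {φ : ℝ → ℝ → ℂ} {a B : ℝ} {ω : ℝ → ℝ}
    (hB : ∀ t ∈ Set.Icc 0 a, ∀ s ∈ Set.Icc 0 a, ‖φ t s‖ ≤ B)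
    (hω : Tendsto ω (𝓝 0) (𝓝 0))
    (hφ : ∀ t ∈ Set.Icc 0 a, ∀ t' ∈ Set.Icc 0 a, ∀ s ∈ Set.Icc 0 a, ‖φ t s - φ t' s‖ ≤ ω (t - t')) :
    AEStronglyMeasurable (fun t => ∫ s in (0 : ℝ)..t, φ t s) (volume.restrict (Set.Icc 0 a)) := by
  rcases lt_or_ge a 0 with ha | ha
  · simp [Set.Icc_eq_empty ha.not_ge]
  set E : Set ℝ := {t | AEStronglyMeasurable (φ t) (volume.restrict (Set.Ioc 0 t))} with hE
  set D : Set ℝ := Set.Ico 0 a \ E with hD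
  have hDm : MeasurableSet D := by
    refine measurableSet_of_exists_Ioo_subset fun t ht => ?_
    by_contra! hcon
    have hex : ∀ n : ℕ, ∃ t' ∈ E, t' ∈ Set.Ioo t (min a (t + 1 / (n + 1))) := fun n => by
      have hlt : t < min a (t + 1 / (n + 1)) := lt_min ht.1.2 (by simp; positivity)
      obtain ⟨t', h1, h2⟩ := Set.not_subset.1 (hcon _ hlt)
      refine ⟨t', ?_, h1⟩
      by_contra hE'
      exact h2 ⟨⟨ht.1.1.trans h1.1.le, h1.2.trans_le (min_le_left _ _)⟩, hE'⟩
    choose τ hτE hτ using hex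
    have hτt : Tendsto τ atTop (𝓝 t) := by
      have h1 : Tendsto (fun n : ℕ => t + 1 / ((n : ℝ) + 1)) atTop (𝓝 t) := by
        simpa using tendsto_one_div_add_atTop_nhds_zero_nat.const_add t
      exact tendsto_of_tendsto_of_tendsto_of_le_of_le tendsto_const_nhds h1 (fun n => (hτ n).1.le)
        fun n => ((hτ n).2.trans_le (min_le_right _ _)).le
    refine ht.2 (aestronglyMeasurable_of_tendsto_ae (f := fun n => φ (τ n)) atTop (fun n => ?_) ?_)
    · exact (hτE n : AEStronglyMeasurable _ _).mono_set (Set.Ioc_subset_Ioc_right (hτ n).1.le)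
    · refine (ae_restrict_iff' measurableSet_Ioc).2 (ae_of_all _ fun s hs => ?_)
      rw [tendsto_iff_norm_sub_tendsto_zero]
      have h1 : Tendsto (fun n => ω (τ n - t)) atTop (𝓝 0) := by
        refine hω.comp ?_
        simpa using hτt.sub_const t
      refine squeeze_zero (fun _ => norm_nonneg _) (fun n => ?_) h1
      exact hφ _ ⟨ht.1.1.trans (hτ n).1.le, ((hτ n).2.trans_le (min_le_left _ _)).le⟩ _ ⟨ht.1.1, ht.1.2.le⟩
        _ ⟨hs.1.le, hs.2.trans ht.1.2.le⟩
  set I : ℝ → ℂ := fun t => ∫ s in (0 : ℝ)..t, φ t s with hI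
  have hint : ∀ t ∈ Set.Icc 0 a, t ∈ E → ∀ t' ∈ Set.Icc 0 t, ∀ t'' ∈ Set.Icc 0 t,
      IntervalIntegrable (φ t) volume t' t'' := by
    intro t ht htE t' ht' t'' ht''
    have hsub : Set.uIoc t' t'' ⊆ Set.Ioc 0 t := fun s hs =>
      ⟨(le_min ht'.1 ht''.1).trans_lt hs.1, hs.2.trans (max_le ht'.2 ht''.2)⟩
    refine intervalIntegrable_iff.2 (IntegrableOn.mono_set ?_ hsub)
    refine Integrable.mono' (integrable_const B) htE
      ((ae_restrict_iff' measurableSet_Ioc).2 (ae_of_all _ fun s hs => ?_))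
    exact hB t ht s ⟨hs.1.le, hs.2.trans ht.2⟩
  have hle : ∀ t ∈ Set.Icc 0 a, t ∈ E → ∀ t' ∈ Set.Icc 0 a, t' ∈ E → t ≤ t' → ∀ w : ℝ,
      (∀ s ∈ Set.Icc 0 a, ‖φ t' s - φ t s‖ ≤ w) → ‖I t' - I t‖ ≤ w * a + B * |t' - t| := by
    intro t ht htE t' ht' htE' htt w hw
    have hw0 : 0 ≤ w := (norm_nonneg _).trans (hw t ht)
    have i1 := hint t ht htE 0 ⟨le_rfl, ht.1⟩ t ⟨ht.1, le_rfl⟩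
    have i2 := hint t' ht' htE' 0 ⟨le_rfl, ht'.1⟩ t ⟨ht.1, htt⟩
    have i3 := hint t' ht' htE' t ⟨ht.1, htt⟩ t' ⟨ht'.1, le_rfl⟩
    have e : I t' - I t = (∫ s in (0 : ℝ)..t, (φ t' s - φ t s)) + ∫ s in t..t', φ t' s := by
      rw [intervalIntegral.integral_sub i2 i1, hI]
      simp only
      rw [← intervalIntegral.integral_add_adjacent_intervals i2 i3]
      ring
    rw [e]
    refine (norm_add_le _ _).trans (add_le_add ?_ ?_)
    · refine (intervalIntegral.norm_integral_le_of_norm_le_const (C := w) fun s hs => ?_).trans ?_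
      · rw [Set.uIoc_of_le ht.1] at hs
        exact hw s ⟨hs.1.le, hs.2.trans ht.2⟩
      · rw [sub_zero, abs_of_nonneg ht.1]
        exact mul_le_mul_of_nonneg_left ht.2 hw0
    · refine intervalIntegral.norm_integral_le_of_norm_le_const fun s hs => ?_
      rw [Set.uIoc_of_le htt] at hs
      exact hB t' ht' s ⟨ht.1.trans hs.1.le, hs.2.trans ht'.2⟩
  have hcont : ContinuousOn I (Set.Ico 0 a ∩ E) := by
    intro t₀ ht₀
    have h0 : t₀ ∈ Set.Icc 0 a := ⟨ht₀.1.1, ht₀.1.2.le⟩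
    rw [ContinuousWithinAt, tendsto_iff_norm_sub_tendsto_zero]
    have hlim : Tendsto (fun t => ω (t - t₀) * a + B * |t - t₀|) (𝓝[Set.Ico 0 a ∩ E] t₀) (𝓝 0) := by
      have hs : Tendsto (fun t => t - t₀) (𝓝[Set.Ico 0 a ∩ E] t₀) (𝓝 0) := by
        have : Continuous fun t : ℝ => t - t₀ := by fun_prop
        simpa using (this.tendsto t₀).mono_left nhdsWithin_le_nhds
      simpa using ((hω.comp hs).mul_const a).add (hs.abs.const_mul B)
    refine tendsto_of_tendsto_of_tendsto_of_le_of_le' tendsto_const_nhds hlim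
      (Eventually.of_forall fun _ => norm_nonneg _) ?_
    filter_upwards [self_mem_nhdsWithin] with t ht
    have h1 : t ∈ Set.Icc 0 a := ⟨ht.1.1, ht.1.2.le⟩
    rcases le_total t₀ t with hle' | hle'
    · exact hle t₀ h0 ht₀.2 t h1 ht.2 hle' _ fun s hs => hφ t h1 t₀ h0 s hs
    · rw [norm_sub_rev, abs_sub_comm]
      exact hle t h1 ht.2 t₀ h0 ht₀.2 hle' _ fun s hs => by
        rw [norm_sub_rev]; exact hφ t h1 t₀ h0 s hs
  have hEm : MeasurableSet (Set.Ico 0 a ∩ E) := by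
    have : Set.Ico 0 a ∩ E = Set.Ico 0 a \ D := by ext t; simp [hD]
    rw [this]
    exact measurableSet_Ico.diff hDm
  rw [← restrict_Ico_eq_restrict_Icc, ← Set.inter_union_sdiff (Set.Ico 0 a) E,
    aestronglyMeasurable_union_iff]
  refine ⟨hcont.aestronglyMeasurable hEm, (aestronglyMeasurable_const (b := (0 : ℂ))).congr
    ((ae_restrict_iff' hDm).2 (ae_of_all _ fun t ht => ?_))⟩
  refine (intervalIntegral.integral_undef fun hi => ht.2 ?_).symm
  rw [intervalIntegrable_iff_integrableOn_Ioc_of_le ht.1.1] at hi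
  exact hi.1

lemma aestronglyMeasurable_integral_Icc {φ : ℝ → ℝ → ℂ} {a B : ℝ} {ω : ℝ → ℝ}
    (hB : ∀ t ∈ Set.Icc (-a) a, ∀ s ∈ Set.Icc (-a) a, ‖φ t s‖ ≤ B)
    (hω : Tendsto ω (𝓝 0) (𝓝 0))
    (hφ : ∀ t ∈ Set.Icc (-a) a, ∀ t' ∈ Set.Icc (-a) a, ∀ s ∈ Set.Icc (-a) a,
      ‖φ t s - φ t' s‖ ≤ ω (t - t')) :
    AEStronglyMeasurable (fun t => ∫ s in (0 : ℝ)..t, φ t s) (volume.restrict (Set.Icc (-a) a)) := by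
  have hpos : ∀ t ∈ Set.Icc 0 a, t ∈ Set.Icc (-a) a := fun t ht =>
    ⟨by linarith [ht.1, ht.1.trans ht.2], ht.2⟩
  have hneg : ∀ t ∈ Set.Icc 0 a, -t ∈ Set.Icc (-a) a := fun t ht =>
    ⟨by linarith [ht.2], by linarith [ht.1, ht.1.trans ht.2]⟩
  have h1 := aestronglyMeasurable_integral_Icc_zero (fun t ht s hs => hB t (hpos t ht) s (hpos s hs)) hω
    fun t ht t' ht' s hs => hφ t (hpos t ht) t' (hpos t' ht') s (hpos s hs)
  have hω' : Tendsto (fun h => ω (-h)) (𝓝 0) (𝓝 0) := by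
    refine hω.comp ?_
    simpa using (continuous_neg (G := ℝ)).tendsto 0
  have h2 := aestronglyMeasurable_integral_Icc_zero (φ := fun t s => φ (-t) (-s)) (a := a)
    (fun t ht s hs => hB _ (hneg t ht) _ (hneg s hs)) hω'
    fun t ht t' ht' s hs => by
      have := hφ _ (hneg t ht) _ (hneg t' ht') _ (hneg s hs)
      rwa [show -t - -t' = -(t - t') by ring] at this
  have hmp := (Measure.measurePreserving_neg (volume : Measure ℝ)).restrict_preimage
    (measurableSet_Icc (a := (0 : ℝ)) (b := a))
  have h3 := (h2.comp_measurePreserving hmp).neg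
  have hpre : (Neg.neg ⁻¹' Set.Icc 0 a : Set ℝ) = Set.Icc (-a) 0 := by
    ext t; simp
  rw [hpre] at h3
  have h4 : AEStronglyMeasurable (fun t => ∫ s in (0 : ℝ)..t, φ t s) (volume.restrict (Set.Icc (-a) 0)) := by
    refine h3.congr (ae_of_all _ fun t => ?_)
    simp only [Pi.neg_apply, Function.comp_apply, neg_neg]
    rw [intervalIntegral.integral_comp_neg (fun s => φ t s), neg_neg, neg_zero,
      intervalIntegral.integral_symm, neg_neg]
  refine ((aestronglyMeasurable_union_iff).2 ⟨h4, h1⟩).mono_set fun t ht => ?_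
  rcases le_total t 0 with h | h
  · exact .inl ⟨ht.1, h⟩
  · exact .inr ⟨h, ht.2⟩

namespace HomTree

variable {Q : ℕ} {T : HomTree Q} {F : ℂ → ℂ} {γ : ℝ} {C : ℝ≥0} {p q A a r p' : ℝ} {M : ℝ≥0∞}

lemma spaceNorm_two (g : T.V → ℂ) : spaceNorm T 2 g = ell 2 fun x => ‖g x‖ₑ := by
  simp [spaceNorm, ell, enorm_eq_nnnorm]

lemma spaceNorm_ofReal (hq : 0 < q) (g : T.V → ℂ) :
    spaceNorm T (ENNReal.ofReal q) g = ell q fun x => ‖g x‖ₑ := by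
  simp [spaceNorm, ell, enorm_eq_nnnorm, ENNReal.toReal_ofReal hq.le]

lemma Xnorm_eq_xnorm (hp : 0 < p) (hq : 0 < q) {S : Set ℝ} (hS : MeasurableSet S) {u : ℝ → T.V → ℂ}
    {v : ℝ → T.L2} (h : ∀ t ∈ S, ∀ x, v t x = u t x) :
    Xnorm T (ENNReal.ofReal p) (ENNReal.ofReal q) S u = xnorm S p q v := by
  have h' : ∀ t ∈ S, u t = v t := fun t ht => funext fun x => (h t ht x).symm
  rw [Xnorm, mixedNorm, if_neg ENNReal.ofReal_ne_top, ENNReal.toReal_ofReal hp.le, xnorm]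
  congr 1
  · refine iSup_congr fun t => iSup_congr fun ht => ?_
    rw [spaceNorm_two, enorm_eq_ell, h' t ht]
  · rw [setLIntegral_congr_fun hS fun t ht => ?_]
    rw [spaceNorm_ofReal hq, h' t ht, lq]

lemma duhamel_apply {G : ℝ → T.L2} {S : Set ℝ} (hG : IntegrableOn G S) {t : ℝ} (ht : Set.uIoc 0 t ⊆ S)
    (x : T.V) : duhamel G t x = ∫ s in (0 : ℝ)..t, T.U (t - s) (G s) x := by
  have hi : IntervalIntegrable (fun s => T.U (t - s) (G s)) volume 0 t :=
    intervalIntegrable_iff.2 (T.integrable_U (hG.mono_set ht) _ (by fun_prop))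
  have h := (innerSL ℂ (T.delta x)).intervalIntegral_comp_comm hi
  simp only [innerSL_apply_apply, inner_delta_left] at h
  exact h.symm

lemma picard_apply (hF : LocLip F γ C) {S : Set ℝ} {u : ℝ → T.L2}
    (hu : IntegrableOn (fun t => nonlin hF (u t)) S) {t : ℝ} (ht : Set.uIoc 0 t ⊆ S) (f : T.L2) (x : T.V) :
    picard hF f u t x = T.U t f x - I * ∫ s in (0 : ℝ)..t, T.U (t - s) (nonlin hF (u s)) x := by
  rw [picard, lp.coeFn_sub, Pi.sub_apply, lp.coeFn_smul, Pi.smul_apply, duhamel_apply hu ht, smul_eq_mul]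

lemma propagate_sub_integral_eq (hQ : 2 ≤ Q) (hF : LocLip F γ C) (f : T.L2) (u : ℝ → T.L2) (t : ℝ) (x : T.V) :
    propagate T t f x - I * ∫ s in (0 : ℝ)..t, propagate T (t - s) (fun y => F (u s y)) x =
      T.U t f x - I * ∫ s in (0 : ℝ)..t, T.U (t - s) (nonlin hF (u s)) x := by
  have h : ∀ s, propagate T (t - s) (fun y => F (u s y)) x = T.U (t - s) (nonlin hF (u s)) x := fun s =>
    T.propagate_eq hQ (t - s) (nonlin hF (u s)) x
  simp only [h, T.propagate_eq hQ]

lemma enorm_nonlin_le (hF : LocLip F γ C) {u : T.L2} (h : ‖u‖ₑ ≤ M) :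
    ‖nonlin hF u‖ₑ ≤ C * (M ^ (γ - 1) * M) := by
  have h1 : 0 ≤ γ - 1 := by linarith [hF.one_lt]
  have := enorm_nonlin_sub_le hF u 0
  rw [nonlin_zero, sub_zero, sub_zero, enorm_zero, add_zero] at this
  refine this.trans ?_
  gcongr

lemma norm_coord_le (u : T.L2) (x : T.V) : ‖u x‖ ≤ ‖u‖ := lp.norm_apply_le_norm (by simp) u x

/-- Bounded solutions are automatically measurable in time. -/
lemma aestronglyMeasurable_of_solution (hF : LocLip F γ C) (hM : M ≠ ∞) {f : T.L2} {u : ℝ → T.L2}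
    (hu : ∀ t ∈ Set.Icc (-a) a, ‖u t‖ₑ ≤ M)
    (h : ∀ t ∈ Set.Icc (-a) a, ∀ x,
      u t x = T.U t f x - I * ∫ s in (0 : ℝ)..t, T.U (t - s) (nonlin hF (u s)) x) :
    AEStronglyMeasurable u (volume.restrict (Set.Icc (-a) a)) := by
  have h1 : 0 ≤ γ - 1 := by linarith [hF.one_lt]
  set B := (C * (M ^ (γ - 1) * M)).toReal with hB
  have hN : ∀ t ∈ Set.Icc (-a) a, ‖nonlin hF (u t)‖ ≤ B := fun t ht => by
    rw [← toReal_enorm]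
    exact ENNReal.toReal_mono (by finiteness) (enorm_nonlin_le hF (hu t ht))
  refine aestronglyMeasurable_of_coord fun x => ?_
  have hω : Tendsto (fun h => ‖T.U h - T.U 0‖ * B) (𝓝 0) (𝓝 0) := by
    have : Continuous fun h => ‖T.U h - T.U 0‖ * B :=
      ((T.continuous_U.sub continuous_const).norm).mul_const B
    simpa using this.tendsto 0
  have hI := aestronglyMeasurable_integral_Icc (a := a) (B := B)
    (φ := fun t s => T.U (t - s) (nonlin hF (u s)) x)
    (fun t _ s hs => (norm_coord_le _ x).trans ((T.norm_U _ _).le.trans (hN s hs))) hω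
    (fun t _ t' _ s hs => by
      have e : T.U (t - s) (nonlin hF (u s)) x - T.U (t' - s) (nonlin hF (u s)) x =
          ((T.U (t - t') - T.U 0) (T.U (t' - s) (nonlin hF (u s)))) x := by
        rw [_root_.sub_apply, ← U_add_apply, ← U_add_apply, lp.coeFn_sub, Pi.sub_apply, zero_add,
          sub_add_sub_cancel]
      rw [e]
      refine (norm_coord_le _ x).trans ((ContinuousLinearMap.le_opNorm _ _).trans ?_)
      rw [norm_U]
      exact mul_le_mul_of_nonneg_left (hN s hs) (norm_nonneg _))
  have hU : AEStronglyMeasurable (fun t => T.U t f x) (volume.restrict (Set.Icc (-a) a)) :=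
    aestronglyMeasurable_coord (continuous_U_apply f).aestronglyMeasurable x
  exact (hU.sub (hI.const_mul I)).congr
    ((ae_restrict_iff' measurableSet_Icc).2 (ae_of_all _ fun t ht => (h t ht x).symm))

lemma uIcc_zero_subset {t : ℝ} (ht : t ∈ Set.Icc (-a) a) : Set.uIcc 0 t ⊆ Set.Icc (-a) a :=
  Set.uIcc_subset_Icc ⟨by linarith [ht.1, ht.2], by linarith [ht.1, ht.2]⟩ ht

lemma uIoc_zero_subset {t : ℝ} (ht : t ∈ Set.Icc (-a) a) : Set.uIoc 0 t ⊆ Set.Icc (-a) a :=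
  Set.uIoc_subset_uIcc.trans (uIcc_zero_subset ht)

/-- A solution of the integral equation, as a measurable fixed point of the Picard map. -/
lemma exists_lift (hQ : 2 ≤ Q) (hF : LocLip F γ C) (hp : 0 < p) (hq : 0 < q) (hM : M ≠ ∞) (f : T.L2)
    {u : ℝ → T.V → ℂ} (hu : SolvesNLS T F f u (Set.Icc (-a) a))
    (huM : Xnorm T (ENNReal.ofReal p) (ENNReal.ofReal q) (Set.Icc (-a) a) u ≤ M) :
    ∃ v : ℝ → T.L2, (∀ t ∈ Set.Icc (-a) a, ∀ x, v t x = u t x) ∧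
      AEStronglyMeasurable v (volume.restrict (Set.Icc (-a) a)) ∧ xnorm (Set.Icc (-a) a) p q v ≤ M ∧
      ∀ t ∈ Set.Icc (-a) a, v t = picard hF f v t := by
  have hfin : ∀ t ∈ Set.Icc (-a) a, ell 2 (fun x => ‖u t x‖ₑ) ≠ ∞ := fun t ht => by
    refine ne_top_of_le_ne_top hM (le_trans ?_ huM)
    rw [← spaceNorm_two]
    exact (le_iSup₂ (f := fun t _ => spaceNorm T 2 (u t)) t ht).trans le_self_add
  classical
  set v : ℝ → T.L2 := fun t => if h : ell 2 (fun x => ‖u t x‖ₑ) ≠ ∞ then T.toL2 (u t) h else 0 with hv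
  have hvu : ∀ t ∈ Set.Icc (-a) a, ∀ x, v t x = u t x := fun t ht x => by
    rw [hv]; simp only [dif_pos (hfin t ht), toL2_apply]
  have hvM : xnorm (Set.Icc (-a) a) p q v ≤ M := by
    rwa [← Xnorm_eq_xnorm hp hq measurableSet_Icc hvu]
  have hb : ∀ t ∈ Set.Icc (-a) a, ‖v t‖ₑ ≤ M := fun t ht => (enorm_le_xnorm ht).trans hvM
  have hsol : ∀ t ∈ Set.Icc (-a) a, ∀ x,
      v t x = T.U t f x - I * ∫ s in (0 : ℝ)..t, T.U (t - s) (nonlin hF (v s)) x := fun t ht x => by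
    rw [← propagate_sub_integral_eq hQ, hvu t ht, hu t ht x]
    congr 2
    refine intervalIntegral.integral_congr fun s hs => ?_
    simp only [hvu s (uIcc_zero_subset ht hs)]
  have hm := aestronglyMeasurable_of_solution hF hM hb hsol
  refine ⟨v, hvu, hm, hvM, fun t ht => ?_⟩
  ext x
  rw [hsol t ht, picard_apply hF (integrableOn_nonlin hF (by simp) measurableSet_Icc hm hM hb)
    (uIoc_zero_subset ht)]

end HomTree

/-- Local well-posedness for arbitrary `L²` data: for exponents `p ∈ [2,∞)`,
`q ∈ (2,∞)` with `p > γ`, `q < 2γ` and `λ = 1 - γ/p - 1/p > 0`, there is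
`c > 0` such that for every bound `R` on `‖f‖_{L²}` there are a time
`T > 0` with `T^λ ≥ c ‖f‖_{L²}^{-(γ-1)}` (i.e. `T^λ R^{γ-1} ≥ c`) and a ball of
`X_T = C([-T,T]; L²) ∩ L^p([-T,T]; L^q)` in which the NLS has a unique
solution, with Lipschitz dependence on the data. -/
theorem local_wellposedness (Q : ℕ) (hQ : 2 ≤ Q) (T : HomTree Q)
    (γ : ℝ) (hγ : 1 < γ) (F : ℂ → ℂ) (hF : PowerLike F γ)
    (p q : ℝ) (hp : 2 ≤ p) (hq : 2 < q) (hpγ : γ < p) (hqγ : q < 2 * γ)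
    (hlam : 0 < 1 - γ / p - 1 / p) :
    ∃ c : ℝ, 0 < c ∧ ∀ R : ℝ≥0∞, 0 < R → R < ∞ →
      ∃ Tt : ℝ, 0 < Tt ∧
        ENNReal.ofReal c ≤
          ENNReal.ofReal (Tt ^ (1 - γ / p - 1 / p)) * R ^ (γ - 1) ∧
        ∃ M : ℝ≥0∞, 0 < M ∧ M < ∞ ∧
          (∀ f : T.V → ℂ, spaceNorm T 2 f ≤ R →
            ∃ u : ℝ → T.V → ℂ,
              (SolvesNLS T F f u (Set.Icc (-Tt) Tt) ∧
                ContL2On T u (Set.Icc (-Tt) Tt) ∧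
                Xnorm T (ENNReal.ofReal p) (ENNReal.ofReal q)
                  (Set.Icc (-Tt) Tt) u ≤ M) ∧
              ∀ v : ℝ → T.V → ℂ, SolvesNLS T F f v (Set.Icc (-Tt) Tt) →
                ContL2On T v (Set.Icc (-Tt) Tt) →
                Xnorm T (ENNReal.ofReal p) (ENNReal.ofReal q)
                  (Set.Icc (-Tt) Tt) v ≤ M →
                ∀ t ∈ Set.Icc (-Tt) Tt, ∀ x : T.V, v t x = u t x) ∧
          ∃ K : ℝ≥0, 0 < K ∧ ∀ (f₁ f₂ : T.V → ℂ) (u₁ u₂ : ℝ → T.V → ℂ),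
            spaceNorm T 2 f₁ ≤ R → spaceNorm T 2 f₂ ≤ R →
            SolvesNLS T F f₁ u₁ (Set.Icc (-Tt) Tt) →
            Xnorm T (ENNReal.ofReal p) (ENNReal.ofReal q)
              (Set.Icc (-Tt) Tt) u₁ ≤ M →
            SolvesNLS T F f₂ u₂ (Set.Icc (-Tt) Tt) →
            Xnorm T (ENNReal.ofReal p) (ENNReal.ofReal q)
              (Set.Icc (-Tt) Tt) u₂ ≤ M →
            Xnorm T (ENNReal.ofReal p) (ENNReal.ofReal q) (Set.Icc (-Tt) Tt)
                (fun t x => u₁ t x - u₂ t x) ≤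
              (K : ℝ≥0∞) * spaceNorm T 2 (fun x => f₁ x - f₂ x) := by
  obtain ⟨C, hC, hF0, hFs⟩ := hF.exists_enorm_sub_le hγ
  have hL : LocLip F γ C := ⟨hγ, hF0, hFs⟩
  obtain ⟨A, a, r, p', E⟩ := HomTree.exists_strichartzData T hQ hγ hp hq hqγ hlam
  have hp0 : 0 < p := by linarith
  have hq0 : 0 < q := by linarith
  set sC := HomTree.strichartzConst A p with hsC
  have hsCt : sC ≠ ∞ := HomTree.strichartzConst_ne_top E.A_nonneg E.two_lt_p
  obtain ⟨c, hc, hscale⟩ := exists_time_scale (k := (sC + sC ^ 2) * C) (b := 2 * (2 * (1 + sC)))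
    (by finiteness) (by simp) (by finiteness) hlam (by linarith : 0 ≤ γ - 1)
  refine ⟨c, hc, fun R hR0 hRt => ?_⟩
  obtain ⟨Tt, hTt, hTc, hTk⟩ := hscale R hR0 hRt
  refine ⟨Tt, hTt, hTc, ?_⟩
  set M := 2 * (1 + sC) * R with hM
  set S := Set.Icc (-Tt) Tt with hS
  have hMt : M ≠ ∞ := by finiteness
  have hSv : volume S = ENNReal.ofReal (2 * Tt) := by rw [hS, Real.volume_Icc]; congr 1; ring
  have hSt : volume S ≠ ∞ := by rw [hSv]; exact ENNReal.ofReal_ne_top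
  have hfac : HomTree.picardFactor S A p γ C M ≤ 1 / 2 := by
    rw [HomTree.picardFactor, hSv, hM, ← mul_assoc 2 _ R]
    exact hTk
  have hsub : ∀ t ∈ S, Set.uIoc 0 t ⊆ S := fun t ht => HomTree.uIoc_zero_subset ht
  have hdata : ∀ f : T.V → ℂ, spaceNorm T 2 f ≤ R → ∃ g : T.L2, ⇑g = f ∧ ‖g‖ₑ ≤ R := fun f hf => by
    rw [HomTree.spaceNorm_two] at hf
    refine ⟨T.toL2 f (ne_top_of_le_ne_top hRt.ne hf), rfl, ?_⟩
    rw [HomTree.enorm_eq_ell]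
    exact hf
  have hlip : ∀ (f₁ f₂ : T.V → ℂ) (u₁ u₂ : ℝ → T.V → ℂ),
      spaceNorm T 2 f₁ ≤ R → spaceNorm T 2 f₂ ≤ R → SolvesNLS T F f₁ u₁ S →
      Xnorm T (ENNReal.ofReal p) (ENNReal.ofReal q) S u₁ ≤ M → SolvesNLS T F f₂ u₂ S →
      Xnorm T (ENNReal.ofReal p) (ENNReal.ofReal q) S u₂ ≤ M →
      Xnorm T (ENNReal.ofReal p) (ENNReal.ofReal q) S (fun t x => u₁ t x - u₂ t x) ≤
        2 * (1 + sC) * spaceNorm T 2 (fun x => f₁ x - f₂ x) := by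
    intro f₁ f₂ u₁ u₂ hf₁ hf₂ hu₁ hM₁ hu₂ hM₂
    obtain ⟨g₁, rfl, -⟩ := hdata f₁ hf₁
    obtain ⟨g₂, rfl, -⟩ := hdata f₂ hf₂
    obtain ⟨v₁, hv₁, hm₁, hx₁, he₁⟩ := HomTree.exists_lift hQ hL hp0 hq0 hMt g₁ hu₁ hM₁
    obtain ⟨v₂, hv₂, hm₂, hx₂, he₂⟩ := HomTree.exists_lift hQ hL hp0 hq0 hMt g₂ hu₂ hM₂
    rw [HomTree.Xnorm_eq_xnorm (v := fun t => v₁ t - v₂ t) hp0 hq0 measurableSet_Icc fun t ht x => by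
      rw [lp.coeFn_sub, Pi.sub_apply, hv₁ t ht, hv₂ t ht]]
    have hg : spaceNorm T 2 (fun x => g₁ x - g₂ x) = ‖g₁ - g₂‖ₑ := by
      rw [HomTree.spaceNorm_two, HomTree.enorm_eq_ell]
      rfl
    rw [hg]
    exact E.xnorm_sub_le hL hSt measurableSet_Icc hsub hMt hfac hm₁ hm₂ hx₁ hx₂ he₁ he₂
  refine ⟨M, by positivity, hMt.lt_top, fun f hf => ?_, (2 * (1 + sC)).toNNReal,
    ENNReal.toNNReal_pos (by simp) (by finiteness), ?_⟩
  · obtain ⟨g, rfl, hg⟩ := hdata f hf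
    obtain ⟨v, hvs, hvc, hvM⟩ := E.exists_solution hL hSt measurableSet_Icc hsub hMt hfac (f := g) <| by
      calc (1 + sC) * ‖g‖ₑ ≤ (1 + sC) * R := by gcongr
        _ = 1 / 2 * M := by
          rw [hM, ← mul_assoc, ← mul_assoc, one_div, ENNReal.inv_mul_cancel two_ne_zero ENNReal.ofNat_ne_top,
            one_mul]
    have hvi := HomTree.integrableOn_nonlin hL hSt measurableSet_Icc
      (hvc.aestronglyMeasurable measurableSet_Icc) hMt fun t ht => (HomTree.enorm_le_xnorm ht).trans hvM
    have hsol : SolvesNLS T F g (fun t x => v t x) S := fun t ht x => by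
      rw [HomTree.propagate_sub_integral_eq hQ hL]
      simp only
      rw [hvs t ht, HomTree.picard_apply hL hvi (hsub t ht)]
    have hX : Xnorm T (ENNReal.ofReal p) (ENNReal.ofReal q) S (fun t x => v t x) ≤ M :=
      (HomTree.Xnorm_eq_xnorm (v := v) hp0 hq0 measurableSet_Icc fun _ _ _ => rfl).trans_le hvM
    refine ⟨fun t x => v t x, ⟨hsol, fun t₀ ht₀ => ?_, hX⟩, fun w hw _ hwM t ht x => ?_⟩
    · have h1 := tendsto_iff_edist_tendsto_0.1 (hvc t₀ ht₀)
      refine h1.congr fun t => ?_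
      rw [edist_eq_enorm_sub, HomTree.spaceNorm_two, HomTree.enorm_eq_ell]
      rfl
    · have h1 := hlip g g w _ hf hf hw hwM hsol hX
      have h0 : spaceNorm T 2 (fun x => g x - g x) = 0 := by
        rw [HomTree.spaceNorm_two]; simp [ell]
      rw [h0, mul_zero] at h1
      have h2 : spaceNorm T 2 (fun x => w t x - v t x) = 0 := le_antisymm
        (((le_iSup₂ (f := fun t _ => spaceNorm T 2 (fun x => w t x - v t x)) t ht).trans
          le_self_add).trans h1) zero_le
      rw [HomTree.spaceNorm_two] at h2
      have h3 := (le_ell two_pos (fun x => ‖w t x - v t x‖ₑ) x).trans_eq h2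
      simpa [sub_eq_zero] using h3
  · rw [ENNReal.coe_toNNReal (by finiteness)]
    exact hlip
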